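/- For every integer g ≥ 3, the second group cohomology of the Siegel modular group Γ_g = Sp_{2g}(ℤ) with trivial integer coefficients is infinite cyclic: H²(Sp_{2g}(ℤ), ℤ) ≅ ℤ. -/

import Mathlib

open Matrix

/-- The paper's standard symplectic form matrix `J = [[0, 1_g], [-1_g, 0]]`. -/
def paperJ (l R : Type*) [DecidableEq l] [CommRing R] : Matrix (l ⊕ l) (l ⊕ l) R :=
  Matrix.fromBlocks 0 1 (-1) 0

/-- The paper's symplectic condition `ᵀM·J·M = J` (with `J = [[0, 1_g], [-1_g, 0]]`)
characterizes membership in Mathlib's `Matrix.symplecticGroup`; hence the latter *is* the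
symplectic group `Sp_{2g}(R)` of the paper. -/
theorem mem_symplecticGroup_iff_paper {l R : Type*} [DecidableEq l] [Fintype l] [CommRing R]
    (M : Matrix (l ⊕ l) (l ⊕ l) R) :
    M ∈ Matrix.symplecticGroup l R ↔ Mᵀ * paperJ l R * M = paperJ l R := by
  have hJ : paperJ l R = -(Matrix.J l R) := by
    rw [paperJ, Matrix.J, Matrix.fromBlocks_neg]; norm_num
  rw [SymplecticGroup.mem_iff', hJ]
  constructor
  · intro h; rw [Matrix.mul_neg, Matrix.neg_mul, h]
  · intro h
    have := congrArg Neg.neg h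
    simpa [Matrix.mul_neg, Matrix.neg_mul] using this

set_option linter.unusedSectionVars false

local notation "SL2Z" => Matrix.SpecialLinearGroup (Fin 2) ℤ

/-! ### Cocycles on the orthogonality graph of a symplectic lattice -/

namespace OrthGraph

variable {D A : Type*} [AddCommGroup D] [AddCommGroup A]

/-- A function on orthogonal pairs of nonzero vectors which is antisymmetric, has vanishing sums
around linearly dependent triangles, and around quadrilaterals with a hyperbolic diagonal. -/
structure IsData (ω : D →ₗ[ℤ] D →ₗ[ℤ] ℤ) (f : D → D → A) : Prop where
  self : ∀ x, ω x x = 0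
  skew : ∀ x y, ω x y = -ω y x
  div : ∀ (m : ℤ) (a : D), (∀ x, m ∣ ω a x) → ∃ a', a = m • a'
  anti : ∀ x y, x ≠ 0 → y ≠ 0 → ω x y = 0 → f x y = -f y x
  dep : ∀ x y z, x ≠ 0 → y ≠ 0 → z ≠ 0 → ω x y = 0 → ω y z = 0 → ω z x = 0 →
    ∀ α β γ : ℤ, (α ≠ 0 ∨ β ≠ 0 ∨ γ ≠ 0) → α • x + β • y + γ • z = 0 → f x y + f y z + f z x = 0
  hyp : ∀ a b c d, a ≠ 0 → c ≠ 0 → ω a b = 0 → ω b c = 0 → ω c d = 0 → ω d a = 0 →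
    ω b d = 1 → f a b + f b c + f c d + f d a = 0

/-- A closed walk of length four in the orthogonality graph. -/
structure Quad (ω : D →ₗ[ℤ] D →ₗ[ℤ] ℤ) (a b c d : D) : Prop where
  a0 : a ≠ 0
  b0 : b ≠ 0
  c0 : c ≠ 0
  d0 : d ≠ 0
  ab : ω a b = 0
  bc : ω b c = 0
  cd : ω c d = 0
  da : ω d a = 0

/-- The sum of `f` around a closed walk of length four. -/
def Q (f : D → D → A) (a b c d : D) : A := f a b + f b c + f c d + f d a

theorem Quad.rot {ω : D →ₗ[ℤ] D →ₗ[ℤ] ℤ} {a b c d : D} (q : Quad ω a b c d) : Quad ω b c d a :=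
  ⟨q.b0, q.c0, q.d0, q.a0, q.bc, q.cd, q.da, q.ab⟩

theorem Q_rot (f : D → D → A) (a b c d : D) : Q f a b c d = Q f b c d a := by
  unfold Q; abel

namespace IsData

variable {ω : D →ₗ[ℤ] D →ₗ[ℤ] ℤ} {f : D → D → A}

theorem eq_zero (h : IsData ω f) {a : D} (ha : ∀ x, ω a x = 0) : a = 0 := by
  obtain ⟨a', ha'⟩ := h.div 0 a (fun x => by simp [ha x])
  simpa using ha'

theorem exists_ne (h : IsData ω f) {a : D} (ha : a ≠ 0) : ∃ x, ω a x ≠ 0 := by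
  by_contra! hx
  exact ha (h.eq_zero hx)

theorem smul_ne (h : IsData ω f) {a : D} (ha : a ≠ 0) {k : ℤ} (hk : k ≠ 0) : k • a ≠ 0 := by
  intro h0
  refine ha (h.eq_zero fun x => ?_)
  have : ω (k • a) x = 0 := by simp [h0]
  simpa [hk] using this

theorem ne_zero_of_left {x y : D} (hxy : ω x y ≠ 0) : x ≠ 0 := by
  rintro rfl; simp at hxy

theorem ne_zero_of_right {x y : D} (hxy : ω x y ≠ 0) : y ≠ 0 := by
  rintro rfl; simp at hxy

theorem symm0 (h : IsData ω f) {x y : D} (hxy : ω x y = 0) : ω y x = 0 := by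
  rw [h.skew, hxy, neg_zero]

theorem reflect (h : IsData ω f) {a b c d : D} (q : Quad ω a b c d) :
    Q f a b c d = - Q f a d c b := by
  unfold Q
  rw [h.anti a b q.a0 q.b0 q.ab, h.anti b c q.b0 q.c0 q.bc, h.anti c d q.c0 q.d0 q.cd,
    h.anti d a q.d0 q.a0 q.da]
  abel

theorem _root_.OrthGraph.exists_common (n : ℤ) (p q : D →ₗ[ℤ] ℤ) (hp : ∃ x, ¬ n ∣ p x)
    (hq : ∃ x, ¬ n ∣ q x) : ∃ x, ¬ n ∣ p x ∧ ¬ n ∣ q x := by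
  obtain ⟨x, hx⟩ := hp
  obtain ⟨y, hy⟩ := hq
  by_cases h1 : n ∣ q x
  · by_cases h2 : n ∣ p y
    · refine ⟨x + y, ?_, ?_⟩
      · rw [map_add]; exact fun h => hx ((Int.dvd_add_left h2).1 h)
      · rw [map_add]; exact fun h => hy ((Int.dvd_add_right h1).1 h)
    · exact ⟨y, h2, hy⟩
  · exact ⟨x, hx, h1⟩

/-- Replace a vertex by a proportional one. -/
theorem proportional (h : IsData ω f) {a a' b c d : D} (q : Quad ω a b c d) (ha' : a' ≠ 0)
    {α β : ℤ} (hα : α ≠ 0) (hβ : β ≠ 0) (e : α • a = β • a') :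
    Quad ω a' b c d ∧ Q f a b c d = Q f a' b c d := by
  have key : ∀ x, α * ω a x = β * ω a' x := fun x => by
    have := congrArg (fun y => ω y x) e
    simpa using this
  have o : ∀ x, ω a x = 0 → ω a' x = 0 := fun x hx => by
    have := key x; rw [hx, mul_zero] at this
    simpa [hβ] using this.symm
  have hb := o b q.ab
  have hd := o d (h.symm0 q.da)
  have haa := o a (h.self a)
  have dep0 : α • a + (-β) • a' + (0:ℤ) • b = 0 := by rw [e]; simp
  have t1 := h.dep a a' b q.a0 ha' q.b0 (h.symm0 haa) hb (h.symm0 q.ab) α (-β) 0 (Or.inl hα)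
    (by rw [e]; simp)
  have t2 := h.dep a a' d q.a0 ha' q.d0 (h.symm0 haa) hd q.da α (-β) 0 (Or.inl hα)
    (by rw [e]; simp)
  refine ⟨⟨ha', q.b0, q.c0, q.d0, hb, q.bc, q.cd, h.symm0 hd⟩, ?_⟩
  unfold Q
  have e1 := h.anti a b q.a0 q.b0 q.ab
  have e2 := h.anti a' d ha' q.d0 hd
  rw [e2] at t2
  have t3 := t1.trans t2.symm
  rw [e1]
  have : f b a = -(f a' b) + (-f d a' + f d a) := by
    have : f a a' + (f a' b + f b a) = f a a' + (-f d a' + f d a) := by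
      rw [← add_assoc, ← add_assoc]; exact t3
    have := add_left_cancel this
    rw [← this]; abel
  rw [this]; abel

theorem insert (h : IsData ω f) {a b c d y : D} (q2 : Quad ω a y c d)
    (h1 : Q f a b c y = 0) (h2 : Q f a y c d = 0) : Q f a b c d = 0 := by
  have := congrArg₂ (· + ·) h1 h2
  simp only [Q, add_zero] at this
  rw [h.anti a y q2.a0 q2.b0 q2.ab, h.anti y c q2.b0 q2.c0 q2.bc] at this
  rw [← this]; unfold Q; abel

/-- A vector orthogonal to `a` and `c`, pairing with `b` and `d` like a multiple of `x`. -/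
theorem perp_vector (h : IsData ω f) {a b c d : D} (q : Quad ω a b c d) (x : D) :
    ∃ y, ω a y = 0 ∧ ω c y = 0 ∧ ω b y = ω a c * ω b x ∧ ω d y = ω a c * ω d x := by
  refine ⟨ω a c • x - ω x c • a + ω x a • c, ?_, ?_, ?_, ?_⟩
  · simp [h.self, h.skew x a]; ring
  · simp [h.self, h.skew x c, h.skew c a]; ring
  · simp [q.bc, h.symm0 q.ab]
  · simp [q.da, h.symm0 q.cd]

theorem quad_hyp (h : IsData ω f) {a b c d : D} (q : Quad ω a b c d) (hm : |ω b d| = 1) :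
    Q f a b c d = 0 := by
  rcases abs_eq (by norm_num) |>.1 hm with h1 | h1
  · exact h.hyp a b c d q.a0 q.c0 q.ab q.bc q.cd q.da h1
  · rw [h.reflect q, neg_eq_zero]
    exact h.hyp a d c b q.a0 q.c0 (h.symm0 q.da) (h.symm0 q.cd) (h.symm0 q.bc) (h.symm0 q.ab)
      (by rw [h.skew, h1]; rfl)

/-- A quadrilateral `b, k b + l c, x, k' b + l' a` all of whose vertices lie on two lines. -/
theorem flat (h : IsData ω f) {b x : D} (hb : b ≠ 0) (hx : x ≠ 0) (hbx : ω b x = 0) {k l : ℤ}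
    (hk : k ≠ 0) (hl : l ≠ 0) : Q f b (k • b) x (l • b) = 0 := by
  have t1 := h.dep b (k • b) (l • b) hb (h.smul_ne hb hk) (h.smul_ne hb hl) (by simp [h.self])
    (by simp [h.self]) (by simp [h.self]) k (-1) 0 (Or.inl hk) (by simp)
  have t2 := h.dep (k • b) x (l • b) (h.smul_ne hb hk) hx (h.smul_ne hb hl) (by simp [hbx])
    (by simp [h.symm0 hbx]) (by simp [h.self]) l 0 (-k) (Or.inl hl) (by
      rw [smul_smul, smul_smul, mul_comm]; simp)
  have e := h.anti (k • b) (l • b) (h.smul_ne hb hk) (h.smul_ne hb hl) (by simp [h.self])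
  rw [e] at t1
  have := congrArg₂ (· + ·) t1 t2
  simp only [add_zero] at this
  rw [← this]; unfold Q; abel

theorem between (h : IsData ω f) {a b : D} (ha : a ≠ 0) (hb : b ≠ 0) (hab : ω a b = 0) {k l : ℤ}
    (hne : k • a + l • b ≠ 0) :
    f a b = f a (k • a + l • b) + f (k • a + l • b) b := by
  have t := h.dep a (k • a + l • b) b ha hne hb (by simp [hab, h.self]) (by simp [hab, h.self])
    (h.symm0 hab) k (-1) l (by simp) (by simp)
  rw [h.anti b a hb ha (h.symm0 hab), ← sub_eq_add_neg, sub_eq_zero] at t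
  exact t.symm

/-- Subdivide a quadrilateral by a fifth vertex joined to the four edges. -/
theorem cut (h : IsData ω f) {a b c d x : D} (q : Quad ω a b c d) (hac : ω a c ≠ 0) (hbd : ω b d ≠ 0)
    (ha : ω a x ≠ 0) (hc : ω c x ≠ 0)
    (hQ : ∀ y p r, Quad ω y p x r → (y = a ∨ y = b ∨ y = c ∨ y = d) → ω y x ≠ 0 → ω p r ≠ 0 →
      Q f y p x r = 0) : Q f a b c d = 0 := by
  have hx : x ≠ 0 := ne_zero_of_right ha
  have hac' := h.skew c a
  have hdb := h.skew d b
  obtain ⟨ha0, hb0, hc0, hd0, hab, hbc, hcd, hda⟩ := q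
  have hba := h.symm0 hab
  have hcb := h.symm0 hbc
  have hdc := h.symm0 hcd
  have had := h.symm0 hda
  have hxa := h.skew x a
  have hxb := h.skew x b
  have hxc := h.skew x c
  have hxd := h.skew x d
  set α := ω a x
  set β := ω b x
  set γ := ω c x
  set δ := ω d x
  set pab := β • a + (-α) • b with hpab
  set pbc := γ • b + (-β) • c with hpbc
  set pcd := δ • c + (-γ) • d with hpcd
  set pda := α • d + (-δ) • a with hpda
  have nab : pab ≠ 0 := ne_zero_of_left (y := d) (ω := ω) (by simp [pab, had, ha, hbd])
  have nbc : pbc ≠ 0 := ne_zero_of_left (y := d) (ω := ω) (by simp [pbc, hcd, hc, hbd])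
  have ncd : pcd ≠ 0 := ne_zero_of_left (y := b) (ω := ω) (by simp [pcd, hcb, hc, hdb, hbd])
  have nda : pda ≠ 0 := ne_zero_of_left (y := b) (ω := ω) (by simp [pda, hab, ha, hdb, hbd])
  have ab_x : ω pab x = 0 := by simp [pab, α, β]; ring
  have bc_x : ω pbc x = 0 := by simp [pbc, γ, β]; ring
  have cd_x : ω pcd x = 0 := by simp [pcd, γ, δ]; ring
  have da_x : ω pda x = 0 := by simp [pda, α, δ]; ring
  have q1 : Quad ω a pab x pda := ⟨ha0, nab, hx, nda, by simp [pab, h.self, hab], ab_x,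
    h.symm0 da_x, by simp [pda, h.self, hda]⟩
  have q2 : Quad ω b pbc x pab := ⟨hb0, nbc, hx, nab, by simp [pbc, h.self, hbc], bc_x,
    h.symm0 ab_x, by simp [pab, h.self, hab]⟩
  have q3 : Quad ω c pcd x pbc := ⟨hc0, ncd, hx, nbc, by simp [pcd, h.self, hcd], cd_x,
    h.symm0 bc_x, by simp [pbc, h.self, hbc]⟩
  have q4 : Quad ω d pda x pcd := ⟨hd0, nda, hx, ncd, by simp [pda, h.self, hda], da_x,
    h.symm0 cd_x, by simp [pcd, h.self, hcd]⟩
  have r1 : Q f a pab x pda = 0 := hQ _ _ _ q1 (by simp) ha (by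
    have : ω pab pda = - (α * α * ω b d) := by
      simp [pab, pda, h.self, hba, had]; ring
    simp [this, ha, hbd])
  have r3 : Q f c pcd x pbc = 0 := hQ _ _ _ q3 (by simp) hc (by
    have : ω pcd pbc = γ * γ * ω b d := by
      simp [pcd, pbc, h.self, hcb, hdb, hdc]; ring
    simp [this, hc, hbd])
  have r2 : Q f b pbc x pab = 0 := by
    by_cases hβ : β = 0
    · have e1 : pbc = γ • b := by simp [pbc, hβ]
      have e2 : pab = (-α) • b := by simp [pab, hβ]
      rw [e1, e2]
      exact h.flat hb0 hx hβ hc (neg_ne_zero.2 ha)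
    · refine hQ _ _ _ q2 (by simp) hβ ?_
      have : ω pbc pab = β * β * ω a c := by
        simp [pab, pbc, h.self, hba, hcb, hac']; ring
      simp [this, hβ, hac]
  have r4 : Q f d pda x pcd = 0 := by
    by_cases hδ : δ = 0
    · have e1 : pda = α • d := by simp [pda, hδ]
      have e2 : pcd = (-γ) • d := by simp [pcd, hδ]
      rw [e1, e2]
      exact h.flat hd0 hx hδ ha (neg_ne_zero.2 hc)
    · refine hQ _ _ _ q4 (by simp) hδ ?_
      have : ω pda pcd = - (δ * δ * ω a c) := by
        simp [pda, pcd, h.self, hdc, had]; ring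
      simp [this, hδ, hac]
  have b1 := h.between ha0 hb0 hab nab
  have b2 := h.between hb0 hc0 hbc nbc
  have b3 := h.between hc0 hd0 hcd ncd
  have b4 := h.between hd0 ha0 hda nda
  have s1 := h.anti x pab hx nab (h.symm0 ab_x)
  have s2 := h.anti x pbc hx nbc (h.symm0 bc_x)
  have s3 := h.anti x pcd hx ncd (h.symm0 cd_x)
  have s4 := h.anti x pda hx nda (h.symm0 da_x)
  have tot : Q f a b c d
      = Q f a pab x pda + Q f b pbc x pab + Q f c pcd x pbc + Q f d pda x pcd := by
    unfold Q
    rw [b1, b2, b3, b4, s1, s2, s3, s4]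
    abel
  rw [tot, r1, r2, r3, r4]; simp

theorem exists_emod (y n : ℤ) {k : ℤ} (hk : |k| = n) : ∃ j : ℤ, y + j * k = y % n := by
  rcases abs_eq_abs.1 (hk.trans (abs_of_nonneg (hk ▸ abs_nonneg k)).symm) with e | e
  · exact ⟨-(y / n), by rw [e]; have := Int.emod_add_mul_ediv y n; linarith⟩
  · exact ⟨y / n, by rw [e]; have := Int.emod_add_mul_ediv y n; linarith⟩

theorem abs_emod_lt {y n : ℤ} (hn : 0 < n) : |y % n| < n := by
  rw [abs_of_nonneg (Int.emod_nonneg _ hn.ne')]; exact Int.emod_lt_of_pos _ hn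

theorem quad_nondeg (h : IsData ω f) : ∀ (m n : ℕ), ∀ a b c d : D, Quad ω a b c d →
    (ω a c).natAbs = m → (ω b d).natAbs = n → m ≠ 0 → n ≠ 0 → Q f a b c d = 0 := by
  intro m
  induction m using Nat.strong_induction_on with
  | _ m ihm =>
  intro n
  induction n using Nat.strong_induction_on with
  | _ n ihn =>
  intro a b c d q hac hbd hm hn
  have hac0 : ω a c ≠ 0 := by rw [← Int.natAbs_ne_zero, hac]; exact hm
  have hbd0 : ω b d ≠ 0 := by rw [← Int.natAbs_ne_zero, hbd]; exact hn
  have hac' : |ω a c| = m := by rw [← hac, Int.natCast_natAbs]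
  have hbd' : |ω b d| = n := by rw [← hbd, Int.natCast_natAbs]
  have hca' : |ω c a| = m := by rw [h.skew, abs_neg, hac']
  have hdb' : |ω d b| = n := by rw [h.skew, abs_neg, hbd']
  have hmz : (0:ℤ) < m := by exact_mod_cast Nat.pos_of_ne_zero hm
  have hnz : (0:ℤ) < n := by exact_mod_cast Nat.pos_of_ne_zero hn
  rcases lt_trichotomy n m with hlt | heq | hgt
  · rw [Q_rot]
    exact ihm n hlt m _ _ _ _ q.rot hbd (by rw [h.skew, Int.natAbs_neg, hac]) hn hm
  · subst heq
    rcases Nat.lt_or_ge n 2 with h1 | h2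
    · have : n = 1 := by omega
      subst this
      exact h.quad_hyp q (by simpa using hbd')
    have hsm : ∀ a b c d : D, Quad ω a b c d → (ω a c).natAbs = n → (ω b d).natAbs = n →
        (∀ x, (n:ℤ) ∣ ω a x) → Q f a b c d = 0 := by
      intro a b c d q hac hbd hdiv
      obtain ⟨a', ha'⟩ := h.div n a hdiv
      have ha0 : a' ≠ 0 := by rintro rfl; exact q.a0 (by simpa using ha')
      obtain ⟨q', e⟩ := h.proportional q ha0 (α := 1) (β := n) one_ne_zero hnz.ne'
        (by simpa using ha')
      rw [e]
      have : n * (ω a' c).natAbs = n := by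
        rw [ha'] at hac
        simpa [Int.natAbs_mul] using hac
      have h1 : (ω a' c).natAbs = 1 := by
        exact Nat.eq_of_mul_eq_mul_left (Nat.pos_of_ne_zero hn) (by rw [this, mul_one])
      exact ihm 1 (by omega) n _ _ _ _ q' h1 hbd one_ne_zero hn
    by_cases hda : ∀ x, (n:ℤ) ∣ ω a x
    · exact hsm a b c d q hac hbd hda
    by_cases hdc : ∀ x, (n:ℤ) ∣ ω c x
    · rw [Q_rot, Q_rot]
      exact hsm c d a b q.rot.rot (by rw [h.skew, Int.natAbs_neg, hac])
        (by rw [h.skew, Int.natAbs_neg, hbd]) hdc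
    push Not at hda hdc
    obtain ⟨x, hxa, hxc⟩ := exists_common (n:ℤ) (ω a) (ω c) hda hdc
    obtain ⟨ja, hja⟩ := exists_emod (ω a x) n hac'
    obtain ⟨jc, hjc⟩ := exists_emod (ω c x) n hca'
    obtain ⟨jb, hjb⟩ := exists_emod (ω b x) n hbd'
    obtain ⟨jd, hjd⟩ := exists_emod (ω d x) n hdb'
    set x' := x + ja • c + jc • a + jb • d + jd • b with hx'
    have ea : ω a x' = ω a x % n := by
      simp [x', h.self, q.ab, h.symm0 q.da, hja]
    have ec : ω c x' = ω c x % n := by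
      simp [x', h.self, q.cd, h.symm0 q.bc, hjc]
    have eb : ω b x' = ω b x % n := by
      simp [x', h.self, q.bc, h.symm0 q.ab, hjb]
    have ed : ω d x' = ω d x % n := by
      simp [x', h.self, q.da, h.symm0 q.cd, hjd]
    refine h.cut (x := x') q hac0 hbd0 (by rwa [ea, ne_eq, ← Int.dvd_iff_emod_eq_zero])
      (by rwa [ec, ne_eq, ← Int.dvd_iff_emod_eq_zero]) ?_
    intro y p r q' hy hyx hpr
    refine ihm _ ?_ _ _ _ _ _ q' rfl rfl (Int.natAbs_ne_zero.2 hyx) (Int.natAbs_ne_zero.2 hpr)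
    zify
    rcases hy with rfl | rfl | rfl | rfl
    · rw [ea]; exact abs_emod_lt hnz
    · rw [eb]; exact abs_emod_lt hnz
    · rw [ec]; exact abs_emod_lt hnz
    · rw [ed]; exact abs_emod_lt hnz
  · have hsm : ∀ a b c d : D, Quad ω a b c d → (ω a c).natAbs = m → (ω b d).natAbs = n →
        (∀ x, (n:ℤ) ∣ ω a c * ω b x) → Q f a b c d = 0 := by
      intro a b c d q hac hbd hdiv
      have hac0 : ω a c ≠ 0 := by rw [← Int.natAbs_ne_zero, hac]; exact hm
      obtain ⟨b', hb'⟩ := h.div n (ω a c • b) (by simpa using hdiv)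
      have hb0 : b' ≠ 0 := by
        rintro rfl
        exact h.smul_ne q.b0 hac0 (by simpa using hb')
      obtain ⟨q', e⟩ := h.proportional q.rot hb0 hac0 hnz.ne' hb'
      have e2 : n * (ω b' d).natAbs = m * n := by
        have := congrArg (fun y => (ω y d).natAbs) hb'
        simpa [Int.natAbs_mul, hac, hbd] using this.symm
      have e3 : (ω b' d).natAbs = m :=
        Nat.eq_of_mul_eq_mul_left (Nat.pos_of_ne_zero hn) (by rw [e2, mul_comm])
      rw [Q_rot, e, ← Q_rot]
      exact ihn m hgt _ _ _ _ q'.rot.rot.rot hac e3 hm hm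
    by_cases hdb : ∀ x, (n:ℤ) ∣ ω a c * ω b x
    · exact hsm a b c d q hac hbd hdb
    by_cases hdd : ∀ x, (n:ℤ) ∣ ω a c * ω d x
    · rw [Q_rot, Q_rot]
      exact hsm c d a b q.rot.rot (by rw [h.skew, Int.natAbs_neg, hac])
        (by rw [h.skew, Int.natAbs_neg, hbd]) (fun x => by
          rw [h.skew c a, neg_mul]; exact (dvd_neg).2 (hdd x))
    push Not at hdb hdd
    obtain ⟨x, hxb, hxd⟩ := exists_common (n:ℤ) (ω a c • ω b) (ω a c • ω d)
      (by simpa using hdb) (by simpa using hdd)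
    obtain ⟨y, ya, yc, yb, yd⟩ := h.perp_vector q x
    simp only [LinearMap.smul_apply, smul_eq_mul] at hxb hxd
    rw [← yb] at hxb
    rw [← yd] at hxd
    obtain ⟨jb, hjb⟩ := exists_emod (ω b y) n hbd'
    obtain ⟨jd, hjd⟩ := exists_emod (ω d y) n hdb'
    set z := y + jb • d + jd • b with hz
    have eb : ω b z = ω b y % n := by simp [z, h.self, hjb]
    have ed : ω d z = ω d y % n := by simp [z, h.self, hjd]
    have za : ω a z = 0 := by simp [z, ya, q.ab, h.symm0 q.da]
    have zc : ω c z = 0 := by simp [z, yc, q.cd, h.symm0 q.bc]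
    have eb0 : ω b z ≠ 0 := by rwa [eb, ne_eq, ← Int.dvd_iff_emod_eq_zero]
    have ed0 : ω d z ≠ 0 := by rwa [ed, ne_eq, ← Int.dvd_iff_emod_eq_zero]
    have z0 := ne_zero_of_right eb0
    have q1 : Quad ω a b c z := ⟨q.a0, q.b0, q.c0, z0, q.ab, q.bc, zc, h.symm0 za⟩
    have q2 : Quad ω a z c d := ⟨q.a0, z0, q.c0, q.d0, za, h.symm0 zc, q.cd, q.da⟩
    refine h.insert q2 (ihn _ ?_ _ _ _ _ q1 hac rfl hm (Int.natAbs_ne_zero.2 eb0))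
      (ihn _ ?_ _ _ _ _ q2 hac rfl hm ?_)
    · zify; rw [eb]; exact abs_emod_lt hnz
    · rw [h.skew, Int.natAbs_neg]; zify; rw [ed]; exact abs_emod_lt hnz
    · rw [h.skew, Int.natAbs_neg]; exact Int.natAbs_ne_zero.2 ed0

theorem quad_of_ne (h : IsData ω f) {a b c d : D} (q : Quad ω a b c d) (hac : ω a c ≠ 0) :
    Q f a b c d = 0 := by
  obtain ⟨x, hxb, hxd⟩ := exists_common (0:ℤ) (ω b) (ω d)
    (by simpa using h.exists_ne q.b0) (by simpa using h.exists_ne q.d0)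
  rw [zero_dvd_iff] at hxb hxd
  obtain ⟨y, ya, yc, yb, yd⟩ := h.perp_vector q x
  have hb : ω b y ≠ 0 := by rw [yb]; exact mul_ne_zero hac hxb
  have hd : ω d y ≠ 0 := by rw [yd]; exact mul_ne_zero hac hxd
  have y0 := ne_zero_of_right hb
  have q1 : Quad ω a b c y := ⟨q.a0, q.b0, q.c0, y0, q.ab, q.bc, yc, h.symm0 ya⟩
  have q2 : Quad ω a y c d := ⟨q.a0, y0, q.c0, q.d0, ya, h.symm0 yc, q.cd, q.da⟩
  refine h.insert q2 (h.quad_nondeg _ _ _ _ _ _ q1 rfl rfl (Int.natAbs_ne_zero.2 hac)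
    (Int.natAbs_ne_zero.2 hb)) (h.quad_nondeg _ _ _ _ _ _ q2 rfl rfl (Int.natAbs_ne_zero.2 hac) ?_)
  rw [h.skew, Int.natAbs_neg]; exact Int.natAbs_ne_zero.2 hd

theorem dependent_of_perp (h : IsData ω f) {u v w : D} (hu : u ≠ 0)
    (hw : ∀ t, ω u t = 0 → ω v t = 0 → ω w t = 0) :
    ∃ α β γ : ℤ, (α ≠ 0 ∨ β ≠ 0 ∨ γ ≠ 0) ∧ α • u + β • v + γ • w = 0 := by
  obtain ⟨p, hp⟩ := h.exists_ne hu
  by_cases hv' : ω u p • v - ω v p • u = 0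
  · exact ⟨-ω v p, ω u p, 0, Or.inr (Or.inl hp), by rw [← hv']; module⟩
  obtain ⟨q, hq⟩ := h.exists_ne hv'
  set v' := ω u p • v - ω v p • u with hv'def
  set q' := ω u p • q - ω u q • p with hq'
  have e1 : ω u q' = 0 := by simp [q']; ring
  have e2 : ω v' p = 0 := by simp [v']; ring
  have e3 : ω v' q' = ω u p * ω v' q := by
    simp only [q', map_sub, map_smul, e2]; simp
  have hβ : ω v' q' ≠ 0 := by rw [e3]; exact mul_ne_zero hp hq
  have key : ∀ x, ω ((ω u p * ω v' q') • w - (ω v' q' * ω w p) • u - (ω u p * ω w q') • v') x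
      = 0 := by
    intro x
    have := hw ((ω u p * ω v' q') • x - (ω v' q' * ω u x) • p - (ω u p * ω v' x) • q')
      (by simp only [map_sub, map_smul, e1, smul_eq_mul]; ring) (by
        have hh : ∀ t, ω u t = 0 → ω v' t = 0 → ω v t = 0 := by
          intro t h1 h2
          simp only [v', map_sub, map_smul, LinearMap.sub_apply, LinearMap.smul_apply, h1] at h2
          simpa [hp] using h2
        refine hh _ (by simp only [map_sub, map_smul, e1, smul_eq_mul]; ring) ?_
        simp only [map_sub, map_smul, e2, smul_eq_mul]; ring)
    rw [← this]
    simp only [map_sub, map_smul, LinearMap.sub_apply, LinearMap.smul_apply, smul_eq_mul]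
    ring
  have := h.eq_zero key
  refine ⟨-(ω v' q' * ω w p) + ω u p * ω w q' * ω v p, -(ω u p * ω w q' * ω u p),
    ω u p * ω v' q', Or.inr (Or.inr (mul_ne_zero hp hβ)), ?_⟩
  rw [← this]
  generalize ω v' q' = s
  generalize ω w q' = s'
  rw [hv'def]
  module

theorem triangle (h : IsData ω f) {u v w : D} (hu : u ≠ 0) (hv : v ≠ 0) (hw : w ≠ 0)
    (huv : ω u v = 0) (hvw : ω v w = 0) (hwu : ω w u = 0) : f u v + f v w + f w u = 0 := by
  by_cases h1 : ∀ t, ω u t = 0 → ω v t = 0 → ω w t = 0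
  · obtain ⟨α, β, γ, hne, e⟩ := h.dependent_of_perp hu h1
    exact h.dep u v w hu hv hw huv hvw hwu α β γ hne e
  by_cases h2 : ∀ t, ω u t = 0 → ω w t = 0 → ω v t = 0
  · obtain ⟨α, β, γ, hne, e⟩ := h.dependent_of_perp hu h2
    exact h.dep u v w hu hv hw huv hvw hwu α γ β (by tauto) (by rw [← e]; abel)
  by_cases h3 : v + w = 0
  · exact h.dep u v w hu hv hw huv hvw hwu 0 1 1 (by simp) (by simpa using h3)
  push Not at h1 h2
  have step : ∀ v w : D, v ≠ 0 → w ≠ 0 → ω u v = 0 → ω v w = 0 → ω w u = 0 → v + w ≠ 0 →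
      (∃ t, ω u t = 0 ∧ ω v t = 0 ∧ ω w t ≠ 0) → Q f v w u (v + w) = 0 := by
    rintro v w hv hw huv hvw hwu h3 ⟨t, tu, tv, tw⟩
    have t0 := ne_zero_of_right tw
    have q1 : Quad ω v w u t := ⟨hv, hw, hu, t0, hvw, hwu, tu, h.symm0 tv⟩
    have q2 : Quad ω v t u (v + w) := ⟨hv, t0, hu, h3, tv, h.symm0 tu,
      by simp [huv, h.symm0 hwu], by simp [h.self, h.symm0 hvw]⟩
    refine h.insert q2 ?_ ?_
    · rw [Q_rot]; exact h.quad_of_ne q1.rot tw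
    · rw [Q_rot]; exact h.quad_of_ne q2.rot (by simp [h.symm0 tv, h.skew t w, tw])
  have s1 := step v w hv hw huv hvw hwu h3 h1
  have s2 := step w v hw hv (h.symm0 hwu) (h.symm0 hvw) (h.symm0 huv) (by rwa [add_comm]) h2
  have s3 := h.dep v w (v + w) hv hw h3 hvw (by simp [h.self, h.symm0 hvw])
    (by simp [h.self, h.symm0 hvw]) 1 1 (-1) (by simp) (by module)
  rw [add_comm w v] at s2
  unfold Q at s1 s2
  have a1 := h.anti v u hv hu (h.symm0 huv)
  have a2 := h.anti w v hw hv (h.symm0 hvw)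
  have a3 := h.anti (v + w) w h3 hw (by simp [h.self, hvw])
  rw [a1, a2, a3] at s2
  have : f u v + f v w + f w u = (f v w + f w u + f u (v + w) + f (v + w) v)
    - (-f v w + -f u v + f u (v + w) + -f w (v + w)) - (f v w + f w (v + w) + f (v + w) v) := by
    abel
  rw [this, s1, s2, s3]; simp

theorem quad (h : IsData ω f) {a b c d : D} (q : Quad ω a b c d) : Q f a b c d = 0 := by
  by_cases hac : ω a c = 0
  · have t1 := h.triangle q.a0 q.b0 q.c0 q.ab q.bc (h.symm0 hac)
    have t2 := h.triangle q.a0 q.c0 q.d0 hac q.cd q.da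
    rw [h.anti a c q.a0 q.c0 hac] at t2
    have : Q f a b c d = (f a b + f b c + f c a) + (-f c a + f c d + f d a) := by
      unfold Q; abel
    rw [this, t1, t2, add_zero]
  · exact h.quad_of_ne q hac

theorem exists_perp (h : IsData ω f) {u v : D} (hu : u ≠ 0) (huv : ω u v = 0)
    (hind : ∀ α β : ℤ, α • u + β • v = 0 → α = 0 ∧ β = 0) (x : D) :
    ∃ w, w ≠ 0 ∧ ω u w = 0 ∧ ω x w = 0 := by
  by_cases hx : ω x v • u + (-ω x u) • v = 0
  · obtain ⟨_, h2⟩ := hind _ _ hx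
    exact ⟨u, hu, h.self u, neg_eq_zero.1 h2⟩
  · refine ⟨_, hx, by simp [h.self, huv], by simp; ring⟩

/-- A function satisfying the local conditions is a coboundary. -/
theorem exists_potential (h : IsData ω f) {u v : D} (hu : u ≠ 0) (huv : ω u v = 0)
    (hind : ∀ α β : ℤ, α • u + β • v = 0 → α = 0 ∧ β = 0) :
    ∃ ψ : D → A, ∀ x y, x ≠ 0 → y ≠ 0 → ω x y = 0 → f x y = ψ y - ψ x := by
  choose w hw0 hwu hwx using h.exists_perp hu huv hind
  have hψ : ∀ x z, x ≠ 0 → z ≠ 0 → ω u z = 0 → ω x z = 0 →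
      f u (w x) + f (w x) x = f u z + f z x := by
    intro x z hx hz h1 h2
    have q := h.quad (a := u) (b := w x) (c := x) (d := z)
      ⟨hu, hw0 x, hx, hz, hwu x, h.symm0 (hwx x), h2, h.symm0 h1⟩
    unfold Q at q
    rw [h.anti x z hx hz h2, h.anti z u hz hu (h.symm0 h1)] at q
    rw [← sub_eq_zero, ← q]; abel
  refine ⟨fun x => f u (w x) + f (w x) x, fun x y hx hy hxy => ?_⟩
  obtain ⟨z, hz, zu, zx, zy⟩ : ∃ z, z ≠ 0 ∧ ω u z = 0 ∧ ω x z = 0 ∧ ω y z = 0 := by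
    by_cases hu' : ω u x = 0
    · exact ⟨x, hx, hu', h.self x, h.symm0 hxy⟩
    by_cases hd : ω u y • x + (-ω u x) • y = 0
    · refine ⟨w x, hw0 x, hwu x, hwx x, ?_⟩
      have := congrArg (fun s => ω s (w x)) hd
      simpa [hwx x, hu'] using this
    · exact ⟨_, hd, by simp; ring, by simp [h.self, hxy], by simp [h.self, h.symm0 hxy]⟩
  simp only
  rw [hψ x z hx hz zu zx, hψ y z hy hz zu zy]
  have t := h.triangle hz hx hy (h.symm0 zx) hxy zy
  rw [h.anti y z hy hz zy] at t
  rw [← sub_eq_zero, ← t]; abel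

end IsData
end OrthGraph

/-! ### A presentation of `SL(2, ℤ)` -/

namespace SL2Pres

open ModularGroup SpecialLinearGroup

/-- The standard element of order six. -/
def U : SL2Z := S * T

theorem coe_U : (U : Matrix (Fin 2) (Fin 2) ℤ) = !![0, -1; 1, 1] := by
  simp [U, coe_S, coe_T]

theorem S_sq : (S : SL2Z) ^ 2 = -1 := by
  ext i j; fin_cases i <;> fin_cases j <;> simp [pow_two, coe_S]

theorem U_cube : U ^ 3 = -1 := by
  ext i j; fin_cases i <;> fin_cases j <;> simp [pow_succ, coe_U]

theorem S_pow_four : (S : SL2Z) ^ 4 = 1 := by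
  rw [show 4 = 2 * 2 from rfl, pow_mul, S_sq]; simp

theorem U_pow_six : U ^ 6 = 1 := by
  rw [show 6 = 3 * 2 from rfl, pow_mul, U_cube]; simp

theorem closure_SU : Subgroup.closure {S, U} = (⊤ : Subgroup SL2Z) := by
  rw [eq_top_iff, ← SL2Z_generators, Subgroup.closure_le]
  have hS : S ∈ Subgroup.closure {S, U} := Subgroup.subset_closure (by simp)
  have hU : U ∈ Subgroup.closure {S, U} := Subgroup.subset_closure (by simp)
  rintro x (rfl | rfl)
  · exact hS
  · rw [show T = S⁻¹ * U by simp [U]]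
    exact mul_mem (inv_mem hS) hU

theorem induction {p : SL2Z → Prop} (hS : p S) (hU : p U) (one : p 1)
    (mul : ∀ x y, p x → p y → p (x * y)) (inv : ∀ x, p x → p x⁻¹) (x : SL2Z) : p x := by
  have hx : x ∈ Subgroup.closure {S, U} := by rw [closure_SU]; trivial
  induction hx using Subgroup.closure_induction with
  | mem x hx => rcases hx with rfl | rfl <;> assumption
  | one => exact one
  | mul x y _ _ hx hy => exact mul x y hx hy
  | inv x _ hx => exact inv x hx

theorem induction_ST {p : SL2Z → Prop} (hS : p S) (hT : p T) (one : p 1)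
    (mul : ∀ x y, p x → p y → p (x * y)) (inv : ∀ x, p x → p x⁻¹) (x : SL2Z) : p x :=
  induction hS (mul _ _ hS hT) one mul inv x

theorem hom_ext {H : Type*} [Group H] {φ ψ : SL2Z →* H} (hS : φ S = ψ S) (hU : φ U = ψ U) :
    φ = ψ := by
  ext x
  induction x using induction with
  | hS => exact hS
  | hU => exact hU
  | one => simp
  | mul x y hx hy => simp [hx, hy]
  | inv x hx => simp [hx]

section

variable {H : Type*} [Group H]

/-- Normal forms for words in two elements `s`, `u` with `s ^ 2 = u ^ 3` of order two. -/
def IsNormal (s u x : H) : Prop :=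
  ∃ ζ v m w, (ζ = 1 ∨ ζ = s ^ 2) ∧ (v = 1 ∨ v = u ∨ v = u ^ 2) ∧
    m ∈ Submonoid.closure {s⁻¹ * u, s⁻¹ * u ^ 2} ∧ (w = 1 ∨ w = s) ∧ x = ζ * v * m * w

theorem IsNormal.central_mul {s u x : H} (hs : s ^ 4 = 1) (hx : IsNormal s u x) :
    IsNormal s u (s ^ 2 * x) := by
  obtain ⟨ζ, v, m, w, hζ, hv, hm, hw, rfl⟩ := hx
  refine ⟨s ^ 2 * ζ, v, m, w, ?_, hv, hm, hw, by group⟩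
  rcases hζ with rfl | rfl
  · right; simp
  · left; rw [← hs]; group

theorem IsNormal.mul_u {s u x : H} (hs : s ^ 4 = 1) (hsu : s ^ 2 = u ^ 3) (hx : IsNormal s u x) :
    IsNormal s u (u * x) := by
  have hc : u * s ^ 2 = s ^ 2 * u := by rw [hsu]; group
  obtain ⟨ζ, v, m, w, hζ, hv, hm, hw, rfl⟩ := hx
  have hζc : u * ζ = ζ * u := by rcases hζ with rfl | rfl <;> simp [hc]
  have e : u * (ζ * v * m * w) = ζ * (u * v) * m * w := by
    simp only [← mul_assoc, hζc]
  rw [e]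
  rcases hv with rfl | rfl | rfl
  · exact ⟨ζ, u, m, w, hζ, by simp, hm, hw, by simp⟩
  · exact ⟨ζ, v ^ 2, m, w, hζ, by simp, hm, hw, by simp [pow_two]⟩
  · have : IsNormal s u (ζ * 1 * m * w) := ⟨ζ, 1, m, w, hζ, by simp, hm, hw, rfl⟩
    have h2 := this.central_mul hs
    convert h2 using 1
    have hz : ζ * s ^ 2 = s ^ 2 * ζ := by rcases hζ with rfl | rfl <;> simp
    rw [← pow_succ', ← hsu, hz]; simp [mul_assoc]

theorem IsNormal.mul_s {s u x : H} (hs : s ^ 4 = 1) (hx : IsNormal s u x) :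
    IsNormal s u (s * x) := by
  have hc : s * s ^ 2 = s ^ 2 * s := by group
  obtain ⟨ζ, v, m, w, hζ, hv, hm, hw, rfl⟩ := hx
  have hζc : s * ζ = ζ * s := by rcases hζ with rfl | rfl <;> simp [hc]
  have hz : ζ * s ^ 2 = s ^ 2 * ζ := by rcases hζ with rfl | rfl <;> simp
  have e : s * (ζ * v * m * w) = ζ * (s * v) * m * w := by
    simp only [← mul_assoc, hζc]
  rw [e]
  have h1 : s⁻¹ * u ∈ Submonoid.closure {s⁻¹ * u, s⁻¹ * u ^ 2} :=
    Submonoid.subset_closure (by simp)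
  have h2 : s⁻¹ * u ^ 2 ∈ Submonoid.closure {s⁻¹ * u, s⁻¹ * u ^ 2} :=
    Submonoid.subset_closure (by simp)
  rcases hv with rfl | rfl | rfl
  · induction hm using Submonoid.closure_induction_left with
    | one =>
      rcases hw with rfl | rfl
      · exact ⟨ζ, 1, 1, s, hζ, by simp, one_mem _, by simp, by simp⟩
      · have : IsNormal w u (ζ * 1 * 1 * 1) :=
          ⟨ζ, 1, 1, 1, hζ, by simp, one_mem _, by simp, rfl⟩
        have h2 := this.central_mul hs
        convert h2 using 1
        simp only [mul_one]
        rw [mul_assoc, ← pow_two, hz]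
    | mul_left x hx y hy _ =>
      rcases hx with rfl | rfl
      · exact ⟨ζ, u, y, w, hζ, by simp, hy, hw, by simp [mul_assoc]⟩
      · exact ⟨ζ, u ^ 2, y, w, hζ, by simp, hy, hw, by simp [mul_assoc]⟩
  · have : IsNormal s v (ζ * 1 * (s⁻¹ * v * m) * w) :=
      ⟨ζ, 1, _, w, hζ, by simp, mul_mem h1 hm, hw, rfl⟩
    have h2 := this.central_mul hs
    convert h2 using 1
    simp only [mul_one, ← mul_assoc]
    rw [← hz, show ζ * s ^ 2 * s⁻¹ = ζ * s by group]
  · have : IsNormal s u (ζ * 1 * (s⁻¹ * u ^ 2 * m) * w) :=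
      ⟨ζ, 1, _, w, hζ, by simp, mul_mem h2 hm, hw, rfl⟩
    have h2 := this.central_mul hs
    convert h2 using 1
    simp only [mul_one, ← mul_assoc]
    rw [← hz, show ζ * s ^ 2 * s⁻¹ = ζ * s by group]

theorem isNormal_of_mem {s u : H} (hs : s ^ 4 = 1) (hsu : s ^ 2 = u ^ 3) {x : H}
    (hx : x ∈ Subgroup.closure {s, u}) : IsNormal s u x := by
  induction hx using Subgroup.closure_induction_left with
  | one => exact ⟨1, 1, 1, 1, by simp, by simp, one_mem _, by simp, by simp⟩
  | mul_left x hx y _ ih =>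
    rcases hx with rfl | rfl
    · exact ih.mul_s hs
    · exact ih.mul_u hs hsu
  | inv_mul_cancel x hx y _ ih =>
    rcases hx with rfl | rfl
    · have : x⁻¹ = x ^ 2 * x := by
        rw [inv_eq_iff_mul_eq_one, ← hs]; group
      rw [this, mul_assoc]
      exact (ih.mul_s hs).central_mul hs
    · have : x⁻¹ = s ^ 2 * (x * x) := by
        rw [inv_eq_iff_mul_eq_one, ← hs, show s ^ 4 = s ^ 2 * s ^ 2 by group]
        nth_rw 3 [hsu]
        rw [hsu]; group
      rw [this, mul_assoc, mul_assoc]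
      exact ((ih.mul_u hs hsu).mul_u hs hsu).central_mul hs

theorem coe_inv_S_mul_U : ((S⁻¹ * U : SL2Z) : Matrix (Fin 2) (Fin 2) ℤ) = !![1, 1; 0, 1] := by
  simp [U, coe_T]

theorem coe_inv_S_mul_U_sq :
    ((S⁻¹ * U ^ 2 : SL2Z) : Matrix (Fin 2) (Fin 2) ℤ) = !![1, 0; 1, 1] := by
  simp [U, pow_two, coe_T, coe_S, ← mul_assoc]

theorem nonneg_of_mem {s u : H} {m : SL2Z × H}
    (hm : m ∈ Submonoid.closure {((S, s) : SL2Z × H)⁻¹ * (U, u), ((S, s) : SL2Z × H)⁻¹ * (U, u) ^ 2}) :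
    0 ≤ m.1 0 0 ∧ 0 ≤ m.1 0 1 ∧ 0 ≤ m.1 1 0 ∧ 0 ≤ m.1 1 1 ∧ 1 ≤ m.1 0 0 + m.1 0 1 ∧
    1 ≤ m.1 1 0 + m.1 1 1 ∧ (m = 1 ∨ 3 ≤ m.1 0 0 + m.1 0 1 + m.1 1 0 + m.1 1 1) := by
  induction hm using Submonoid.closure_induction_left with
  | one => simp
  | mul_left x hx y hy ih =>
    obtain ⟨a0, b0, c0, d0, ab, cd, _⟩ := ih
    rcases hx with rfl | rfl
    · have e : ∀ i j, (((S, s) : SL2Z × H)⁻¹ * (U, u) * y).1 i j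
          = ((!![1, 1; 0, 1] : Matrix (Fin 2) (Fin 2) ℤ) * (y.1 : Matrix (Fin 2) (Fin 2) ℤ)) i j := by
        intro i j
        rw [← coe_inv_S_mul_U, ← Matrix.SpecialLinearGroup.coe_mul]; rfl
      simp only [e, Matrix.mul_apply, Fin.sum_univ_two]
      simp
      omega
    · have e : ∀ i j, (((S, s) : SL2Z × H)⁻¹ * (U, u) ^ 2 * y).1 i j
          = ((!![1, 0; 1, 1] : Matrix (Fin 2) (Fin 2) ℤ) * (y.1 : Matrix (Fin 2) (Fin 2) ℤ)) i j := by
        intro i j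
        rw [← coe_inv_S_mul_U_sq, ← Matrix.SpecialLinearGroup.coe_mul]; rfl
      simp only [e, Matrix.mul_apply, Fin.sum_univ_two]
      simp
      omega

theorem eq_one_of_fst {s u : H} (hs : s ^ 4 = 1) (hsu : s ^ 2 = u ^ 3) {x : SL2Z × H}
    (hx : x ∈ Subgroup.closure {((S, s) : SL2Z × H), (U, u)}) (h1 : x.1 = 1) : x = 1 := by
  have hs' : ((S, s) : SL2Z × H) ^ 4 = 1 := by
    rw [Prod.pow_mk, S_pow_four, hs]; rfl
  have hsu' : ((S, s) : SL2Z × H) ^ 2 = (U, u) ^ 3 := by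
    rw [Prod.pow_mk, Prod.pow_mk, S_sq, U_cube, hsu]
  obtain ⟨ζ, v, m, w, hζ, hv, hm, hw, rfl⟩ := isNormal_of_mem hs' hsu' hx
  obtain ⟨a0, b0, c0, d0, ab, cd, h3⟩ := nonneg_of_mem hm
  have hm1 : m.1 = v.1⁻¹ * ζ.1⁻¹ * w.1⁻¹ := by
    rw [eq_mul_inv_iff_mul_eq, ← _root_.mul_inv_rev, eq_inv_iff_mul_eq_one, ← h1]
    have hc : Commute (m.1 * w.1) (ζ.1 * v.1) := by
      have h2 : ζ.1 * v.1 * (m.1 * w.1) = 1 := by rw [← h1]; simp [mul_assoc]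
      rw [commute_iff_eq, h2]
      exact mul_eq_one_comm.1 h2
    rw [hc.eq]; simp [mul_assoc]
  have e : ∀ i j, m.1 i j = (v.1⁻¹ * ζ.1⁻¹ * w.1⁻¹ : SL2Z) i j := fun i j => by rw [hm1]
  have e00 := e 0 0
  have e01 := e 0 1
  have e10 := e 1 0
  have e11 := e 1 1
  rcases hζ with rfl | rfl <;> rcases hv with rfl | rfl | rfl <;> rcases hw with rfl | rfl <;>
    simp [pow_two, coe_S, coe_U, Matrix.mul_apply, Matrix.adjugate_fin_two, Matrix.vecHead,
      Matrix.vecTail] at e00 e01 e10 e11 <;>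
    first
    | (exfalso; omega)
    | (rcases h3 with h3 | h3
       · simp [h3]
       · exfalso; omega)

theorem exists_hom {s u : H} (hs : s ^ 4 = 1) (hsu : s ^ 2 = u ^ 3) :
    ∃ φ : SL2Z →* H, φ S = s ∧ φ U = u := by
  set K := Subgroup.closure {((S, s) : SL2Z × H), (U, u)} with hK
  have hSK : (S, s) ∈ K := Subgroup.subset_closure (by simp)
  have hUK : (U, u) ∈ K := Subgroup.subset_closure (by simp)
  let p : K →* SL2Z := (MonoidHom.fst SL2Z H).comp K.subtype
  have inj : Function.Injective p := by
    rw [injective_iff_map_eq_one]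
    intro x hx
    exact Subtype.ext (eq_one_of_fst hs hsu x.2 hx)
  have surj : Function.Surjective p := by
    intro x
    change x ∈ p.range
    have : Subgroup.closure {S, U} ≤ p.range := by
      rw [Subgroup.closure_le]
      rintro y (rfl | rfl)
      · exact ⟨⟨_, hSK⟩, rfl⟩
      · exact ⟨⟨_, hUK⟩, rfl⟩
    rw [closure_SU] at this
    exact this trivial
  let eq := MulEquiv.ofBijective p ⟨inj, surj⟩
  have key : ∀ (x : SL2Z) (h : H) (hx : (x, h) ∈ K), (eq.symm x).1.2 = h := by
    intro x h hx
    have : eq.symm x = ⟨_, hx⟩ := by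
      rw [MulEquiv.symm_apply_eq]; rfl
    rw [this]
  exact ⟨((MonoidHom.snd SL2Z H).comp K.subtype).comp eq.symm.toMonoidHom, key _ _ hSK, key _ _ hUK⟩

end

end SL2Pres

/-! ### Central extensions by divisible torsion-free groups -/

/-- A central extension `A → E → G`, with `A` written additively. -/
structure CExt {E G A : Type*} [Group E] [Group G] [AddCommGroup A] (π : E →* G) (ι : A → E) :
    Prop where
  surj : Function.Surjective π
  add : ∀ a b, ι (a + b) = ι a * ι b
  inj : ∀ a, ι a = 1 → a = 0
  proj : ∀ a, π (ι a) = 1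
  ker : ∀ e, π e = 1 → ∃ a, e = ι a
  comm : ∀ a e, ι a * e = e * ι a

/-- A partial retraction of a central extension onto its kernel, defined over a subgroup. -/
structure IsRetr {E G A : Type*} [Group E] [Group G] [AddCommGroup A] (π : E →* G) (ι : A → E)
    (K : Subgroup G) (r : E → A) : Prop where
  mul : ∀ e e', π e ∈ K → π e' ∈ K → r (e * e') = r e + r e'
  inc : ∀ a, r (ι a) = a

namespace CExt

variable {E G A : Type*} [Group E] [Group G] [AddCommGroup A] {π : E →* G} {ι : A → E}

theorem zero (h : CExt π ι) : ι 0 = 1 := by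
  have := h.add 0 0
  simpa using this

theorem neg (h : CExt π ι) (a : A) : ι (-a) = (ι a)⁻¹ := by
  rw [eq_inv_iff_mul_eq_one, ← h.add, neg_add_cancel, h.zero]

theorem injective (h : CExt π ι) {a b : A} (hab : ι a = ι b) : a = b := by
  rw [← sub_eq_zero]
  apply h.inj
  rw [sub_eq_add_neg, h.add, h.neg, hab, mul_inv_cancel]

theorem nsmul (h : CExt π ι) (n : ℕ) (a : A) : ι (n • a) = ι a ^ n := by
  induction n with
  | zero => simp [h.zero]
  | succ n ih => rw [succ_nsmul, h.add, ih, pow_succ]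

theorem zsmul (h : CExt π ι) (n : ℤ) (a : A) : ι (n • a) = ι a ^ n := by
  cases n with
  | ofNat n => simpa using h.nsmul n a
  | negSucc n => rw [negSucc_zsmul, h.neg, h.nsmul, zpow_negSucc]

theorem commute (h : CExt π ι) (a : A) (e : E) : Commute (ι a) e := h.comm a e

theorem exists_eq_mul (h : CExt π ι) {e e' : E} (hee : π e = π e') : ∃ a, e = e' * ι a := by
  obtain ⟨a, ha⟩ := h.ker (e'⁻¹ * e) (by simp [hee])
  exact ⟨a, by rw [← ha]; group⟩

theorem conj_ι (h : CExt π ι) (a : A) (e : E) : e * ι a * e⁻¹ = ι a := by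
  rw [← h.comm]; group

theorem mul_pow (h : CExt π ι) (a : A) (e : E) (n : ℕ) : (e * ι a) ^ n = e ^ n * ι (n • a) := by
  rw [((h.commute a e).symm).mul_pow, h.nsmul]

/-- Elements over the identity commute with everything; hence commutators depend only on
projections. -/
theorem conj_eq_of_proj (h : CExt π ι) {e e' x : E} (hee : π e = π e') :
    e * x * e⁻¹ = e' * x * e'⁻¹ := by
  obtain ⟨a, rfl⟩ := h.exists_eq_mul hee
  have := h.comm a x
  rw [_root_.mul_inv_rev, mul_assoc e', this]; group

variable [Module ℚ A]

theorem eq_zero_of_nsmul {n : ℕ} (hn : n ≠ 0) {a : A} (ha : n • a = 0) : a = 0 := by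
  have : (n : ℚ) • a = 0 := by rw [Nat.cast_smul_eq_nsmul, ha]
  exact (smul_eq_zero.1 this).resolve_left (by exact_mod_cast hn)

theorem exists_nsmul {n : ℕ} (hn : n ≠ 0) (a : A) : ∃ b : A, n • b = a :=
  ⟨((n : ℚ)⁻¹) • a, by
    rw [← Nat.cast_smul_eq_nsmul ℚ, smul_smul, mul_inv_cancel₀ (by exact_mod_cast hn), one_smul]⟩

theorem torsion_unique (h : CExt π ι) {e e' : E} (he : IsOfFinOrder e) (he' : IsOfFinOrder e')
    (hee : π e = π e') : e = e' := by
  obtain ⟨a, rfl⟩ := h.exists_eq_mul hee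
  obtain ⟨n, hn, h1⟩ := isOfFinOrder_iff_pow_eq_one.1 he
  obtain ⟨m, hm, h2⟩ := isOfFinOrder_iff_pow_eq_one.1 he'
  have h3 : (e' * ι a) ^ (n * m) = 1 := by rw [pow_mul, h1, one_pow]
  rw [h.mul_pow, mul_comm, pow_mul, h2, one_pow, one_mul] at h3
  have := eq_zero_of_nsmul (Nat.mul_ne_zero hm.ne' hn.ne') (h.inj _ h3)
  rw [this, h.zero, mul_one]

theorem exists_torsion (h : CExt π ι) {g : G} {n : ℕ} (hn : n ≠ 0) (hg : g ^ n = 1) :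
    ∃ e, π e = g ∧ e ^ n = 1 := by
  obtain ⟨e, rfl⟩ := h.surj g
  obtain ⟨a, ha⟩ := h.ker (e ^ n) (by rw [map_pow, hg])
  obtain ⟨b, hb⟩ := exists_nsmul hn (-a)
  refine ⟨e * ι b, by simp [h.proj], ?_⟩
  rw [h.mul_pow, hb, ha, ← h.add, add_neg_cancel, h.zero]

theorem isOfFinOrder_of_pow {e : E} {n : ℕ} (hn : n ≠ 0) (he : e ^ n = 1) : IsOfFinOrder e :=
  isOfFinOrder_iff_pow_eq_one.2 ⟨n, Nat.pos_of_ne_zero hn, he⟩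

theorem exists_sl2_lift (h : CExt π ι) (ρ : SL2Z →* G) : ∃ φ : SL2Z →* E, π.comp φ = ρ := by
  obtain ⟨s, hs, hs4⟩ := h.exists_torsion (g := ρ ModularGroup.S) (n := 4) (by norm_num)
    (by rw [← map_pow, SL2Pres.S_pow_four, map_one])
  obtain ⟨u, hu, hu6⟩ := h.exists_torsion (g := ρ SL2Pres.U) (n := 6) (by norm_num)
    (by rw [← map_pow, SL2Pres.U_pow_six, map_one])
  have hsu : s ^ 2 = u ^ 3 := by
    refine h.torsion_unique (isOfFinOrder_of_pow (n := 2) (by norm_num) (by rw [← pow_mul, hs4]))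
      (isOfFinOrder_of_pow (n := 2) (by norm_num) (by rw [← pow_mul, hu6])) ?_
    rw [map_pow, map_pow, hs, hu, ← map_pow, ← map_pow, SL2Pres.S_sq, SL2Pres.U_cube]
  obtain ⟨φ, h1, h2⟩ := SL2Pres.exists_hom hs4 hsu
  exact ⟨φ, SL2Pres.hom_ext (by simp [h1, hs]) (by simp [h2, hu])⟩

/-- The lift of a homomorphism from `SL(2, ℤ)` to a central extension. -/
noncomputable def lift (h : CExt π ι) (ρ : SL2Z →* G) : SL2Z →* E := (h.exists_sl2_lift ρ).choose

@[simp] theorem proj_lift (h : CExt π ι) (ρ : SL2Z →* G) (k : SL2Z) : π (h.lift ρ k) = ρ k :=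
  DFunLike.congr_fun (h.exists_sl2_lift ρ).choose_spec k

theorem sl2_unique (h : CExt π ι) {φ ψ : SL2Z →* E} (e : ∀ k, π (φ k) = π (ψ k)) : φ = ψ := by
  have tS : IsOfFinOrder (ModularGroup.S : SL2Z) :=
    isOfFinOrder_of_pow (n := 4) (by norm_num) SL2Pres.S_pow_four
  have tU : IsOfFinOrder SL2Pres.U := isOfFinOrder_of_pow (n := 6) (by norm_num) SL2Pres.U_pow_six
  exact SL2Pres.hom_ext (h.torsion_unique (φ.isOfFinOrder tS) (ψ.isOfFinOrder tS) (e _))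
    (h.torsion_unique (φ.isOfFinOrder tU) (ψ.isOfFinOrder tU) (e _))

theorem conj_lift (h : CExt π ι) (ρ ρ' : SL2Z →* G) (w : E)
    (hw : ∀ k, π w * ρ k * (π w)⁻¹ = ρ' k) (k : SL2Z) : w * h.lift ρ k * w⁻¹ = h.lift ρ' k := by
  have := h.sl2_unique (φ := (MulAut.conj w).toMonoidHom.comp (h.lift ρ)) (ψ := h.lift ρ')
    (fun k => by simp [hw])
  exact DFunLike.congr_fun this k

theorem lift_eq (h : CExt π ι) {ρ : SL2Z →* G} {φ : SL2Z →* E} (e : ∀ k, π (φ k) = ρ k) :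
    φ = h.lift ρ := h.sl2_unique (by simpa using e)

theorem sl2_map_eq_zero {χ : SL2Z → A} (hχ : ∀ x y, χ (x * y) = χ x + χ y) (k : SL2Z) :
    χ k = 0 := by
  have one : χ 1 = 0 := by simpa using hχ 1 1
  have hpow : ∀ x (n : ℕ), χ (x ^ n) = n • χ x := by
    intro x n
    induction n with
    | zero => simp [one]
    | succ n ih => rw [pow_succ, hχ, ih, succ_nsmul]
  induction k using SL2Pres.induction with
  | hS =>
    refine eq_zero_of_nsmul (n := 4) (by norm_num) ?_
    rw [← hpow, SL2Pres.S_pow_four, one]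
  | hU =>
    refine eq_zero_of_nsmul (n := 6) (by norm_num) ?_
    rw [← hpow, SL2Pres.U_pow_six, one]
  | one => exact one
  | mul x y hx hy => rw [hχ, hx, hy, add_zero]
  | inv x hx =>
    have := hχ x x⁻¹
    rw [mul_inv_cancel, one, hx, zero_add] at this
    exact this.symm

end CExt

namespace IsRetr

variable {E G A : Type*} [Group E] [Group G] [AddCommGroup A] {π : E →* G} {ι : A → E}
  {K : Subgroup G} {r : E → A}

theorem mono (hr : IsRetr π ι K r) {K' : Subgroup G} (hK : K' ≤ K) : IsRetr π ι K' r :=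
  ⟨fun e e' he he' => hr.mul e e' (hK he) (hK he'), hr.inc⟩

theorem one (hr : IsRetr π ι K r) : r 1 = 0 := by
  have := hr.mul 1 1 (by simp) (by simp)
  simpa using this

theorem inv (hr : IsRetr π ι K r) {e : E} (he : π e ∈ K) : r e⁻¹ = -r e := by
  have := hr.mul e e⁻¹ he (by simpa using he)
  rw [mul_inv_cancel, hr.one] at this
  rw [eq_neg_iff_add_eq_zero, add_comm, ← this]

theorem pow (hr : IsRetr π ι K r) {e : E} (he : π e ∈ K) (n : ℕ) : r (e ^ n) = n • r e := by
  induction n with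
  | zero => simp [hr.one]
  | succ n ih => rw [pow_succ, hr.mul _ _ (by simpa using pow_mem he n) he, ih, succ_nsmul]

theorem zpow (hr : IsRetr π ι K r) {e : E} (he : π e ∈ K) (n : ℤ) : r (e ^ n) = n • r e := by
  cases n with
  | ofNat n => simpa using hr.pow he n
  | negSucc n =>
    rw [zpow_negSucc, hr.inv (by simpa using pow_mem he (n + 1)), hr.pow he, negSucc_zsmul]

theorem mul_ι (hr : IsRetr π ι K r) (h : CExt π ι) {e : E} (he : π e ∈ K) (a : A) :
    r (e * ι a) = r e + a := by
  rw [hr.mul _ _ he (by simp [h.proj]), hr.inc]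

theorem conj (hr : IsRetr π ι K r) {e x : E} (he : π e ∈ K) (hx : π x ∈ K) :
    r (e * x * e⁻¹) = r x := by
  rw [hr.mul _ _ (by simpa using mul_mem he hx) (by simpa using he), hr.mul _ _ he hx, hr.inv he]
  abel

variable [Module ℚ A]

theorem torsion (hr : IsRetr π ι K r) {e : E} (he : π e ∈ K) (ht : IsOfFinOrder e) : r e = 0 := by
  obtain ⟨n, hn, h1⟩ := isOfFinOrder_iff_pow_eq_one.1 ht
  refine CExt.eq_zero_of_nsmul hn.ne' ?_
  rw [← hr.pow he, h1, hr.one]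

theorem sl2 (hr : IsRetr π ι K r) {φ : SL2Z →* E} (hφ : ∀ k, π (φ k) ∈ K) (k : SL2Z) :
    r (φ k) = 0 :=
  CExt.sl2_map_eq_zero (χ := fun k => r (φ k))
    (fun x y => by simp only [map_mul]; exact hr.mul _ _ (hφ x) (hφ y)) k

/-- Extend a retraction across an involution. -/
theorem exists_extend (h : CExt π ι) (hr : IsRetr π ι K r) {K' : Subgroup G} {ζ : E}
    (hζ : ζ * ζ = 1) (hK : ∀ k ∈ K, π ζ * k * π ζ ∈ K)
    (hK' : ∀ k ∈ K', k ∈ K ∨ π ζ * k ∈ K) (hinv : ∀ e, π e ∈ K → r (ζ * e * ζ) = r e) :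
    ∃ r', IsRetr π ι K' r' ∧ (∀ e, π e ∈ K → r' e = r e) ∧
      (∀ e, π ζ * π e ∈ K → r' e = r (ζ * e)) := by
  classical
  have hζK : π ζ ∈ K → r ζ = 0 := fun hk =>
    hr.torsion hk (CExt.isOfFinOrder_of_pow (n := 2) (by norm_num) (by rw [pow_two, hζ]))
  have hz : π ζ * π ζ = 1 := by rw [← map_mul, hζ, map_one]
  have hin : ∀ k k', π ζ * k ∈ K → π ζ * k' ∈ K → k * k' ∈ K := by
    intro k k' h1 h2
    have := mul_mem (hK _ h1) h2
    convert this using 1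
    rw [← mul_assoc (π ζ) (π ζ) k, hz]
    simp only [mul_assoc]
    rw [← mul_assoc (π ζ) (π ζ) k', hz]; simp
  refine ⟨fun e => if π e ∈ K then r e else r (ζ * e), ⟨?_, ?_⟩, ?_, ?_⟩
  · intro e e' he he'
    simp only [map_mul]
    by_cases h1 : π e ∈ K <;> by_cases h2 : π e' ∈ K
    · rw [if_pos (mul_mem h1 h2), if_pos h1, if_pos h2, hr.mul _ _ h1 h2]
    · have h3 := (hK' _ he').resolve_left h2
      rw [if_neg (fun hh => h2 ((K.mul_mem_cancel_left h1).1 hh)), if_pos h1, if_neg h2]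
      rw [show ζ * (e * e') = (ζ * e * ζ) * (ζ * e') by
        simp only [mul_assoc]; rw [← mul_assoc ζ ζ e', hζ]; simp]
      rw [hr.mul _ _ (by simpa using hK _ h1) (by simpa using h3), hinv _ h1]
    · have h3 := (hK' _ he).resolve_left h1
      rw [if_neg (fun hh => h1 ((K.mul_mem_cancel_right h2).1 hh)), if_neg h1, if_pos h2,
        ← mul_assoc, hr.mul _ _ (by simpa using h3) h2]
    · have h3 := (hK' _ he).resolve_left h1
      have h4 := (hK' _ he').resolve_left h2
      rw [if_pos (hin _ _ h3 h4), if_neg h1, if_neg h2]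
      rw [show e * e' = (ζ * (ζ * e) * ζ) * (ζ * e') by
        rw [← mul_assoc ζ ζ e, hζ]; simp only [mul_assoc]; rw [← mul_assoc ζ ζ e', hζ]; simp]
      rw [hr.mul _ _ (by simpa using hK _ h3) (by simpa using h4), hinv _ (by simpa using h3)]
  · intro a
    simp [h.proj, hr.inc]
  · intro e he
    simp [he]
  · intro e he
    by_cases h1 : π e ∈ K
    · have h2 : π ζ ∈ K := (K.mul_mem_cancel_right h1).1 he
      simp only [h1, if_true]
      rw [hr.mul _ _ h2 h1, hζK h2, zero_add]
    · simp [h1]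

end IsRetr

/-! ### Isometries of the standard symplectic lattice -/

namespace Symp

variable {ι : Type*} [Fintype ι] [DecidableEq ι]

variable (ι) in
/-- The lattice underlying the standard symplectic space. -/
def Vec := ι ⊕ ι → ℤ

instance : AddCommGroup (Vec ι) := inferInstanceAs (AddCommGroup (ι ⊕ ι → ℤ))

@[simp] theorem Vec.add_apply (x y : Vec ι) (s : ι ⊕ ι) : (x + y) s = x s + y s := rfl

@[simp] theorem Vec.neg_apply (x : Vec ι) (s : ι ⊕ ι) : (-x) s = -x s := rfl

@[simp] theorem Vec.sub_apply (x y : Vec ι) (s : ι ⊕ ι) : (x - y) s = x s - y s := rfl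

@[simp] theorem Vec.zero_apply (s : ι ⊕ ι) : (0 : Vec ι) s = 0 := rfl

@[simp] theorem Vec.smul_apply (c : ℤ) (x : Vec ι) (s : ι ⊕ ι) : (c • x) s = c * x s :=
  Pi.smul_apply (M := fun _ => ℤ) c x s

/-- The standard symplectic form. -/
def ω : Vec ι →ₗ[ℤ] Vec ι →ₗ[ℤ] ℤ :=
  LinearMap.mk₂ ℤ (fun x y => ∑ i, (x (Sum.inl i) * y (Sum.inr i) - x (Sum.inr i) * y (Sum.inl i)))
    (fun x y z => by rw [← Finset.sum_add_distrib]; congr; ext; simp; ring)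
    (fun c x y => by rw [smul_eq_mul, Finset.mul_sum]; congr; ext; simp; ring)
    (fun x y z => by rw [← Finset.sum_add_distrib]; congr; ext; simp; ring)
    (fun c x y => by rw [smul_eq_mul, Finset.mul_sum]; congr; ext; simp; ring)

/-- The standard basis vectors of the first kind. -/
def e (i : ι) : Vec ι := Pi.single (M := fun _ => ℤ) (Sum.inl i) 1

/-- The standard basis vectors of the second kind. -/
def f (i : ι) : Vec ι := Pi.single (M := fun _ => ℤ) (Sum.inr i) 1

theorem ω_apply (x y : Vec ι) :
    ω x y = ∑ i, (x (Sum.inl i) * y (Sum.inr i) - x (Sum.inr i) * y (Sum.inl i)) := rfl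

@[simp] theorem ω_self (x : Vec ι) : ω x x = 0 := by
  rw [ω_apply]; exact Finset.sum_eq_zero fun i _ => by ring

theorem ω_skew (x y : Vec ι) : ω x y = -ω y x := by
  rw [ω_apply, ω_apply, ← Finset.sum_neg_distrib]; congr; ext; ring

@[simp] theorem e_inl (i j : ι) : e i (Sum.inl j) = if j = i then 1 else 0 := by
  simp [e, Pi.single_apply]

@[simp] theorem e_inr (i j : ι) : e i (Sum.inr j) = 0 := by simp [e]

@[simp] theorem f_inr (i j : ι) : f i (Sum.inr j) = if j = i then 1 else 0 := by
  simp [f, Pi.single_apply]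

@[simp] theorem f_inl (i j : ι) : f i (Sum.inl j) = 0 := by simp [f]

@[simp] theorem ω_f (x : Vec ι) (i : ι) : ω x (f i) = x (Sum.inl i) := by
  rw [ω_apply]; simp

@[simp] theorem ω_e (x : Vec ι) (i : ι) : ω x (e i) = -x (Sum.inr i) := by
  rw [ω_apply]; simp

theorem f_ω (x : Vec ι) (i : ι) : ω (f i) x = -x (Sum.inl i) := by rw [ω_skew, ω_f]

theorem e_ω (x : Vec ι) (i : ι) : ω (e i) x = x (Sum.inr i) := by rw [ω_skew, ω_e, neg_neg]

theorem vec_eq_of_ω {x y : Vec ι} (h : ∀ z, ω x z = ω y z) : x = y := by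
  funext s
  rcases s with i | i
  · simpa using h (f i)
  · simpa using h (e i)

variable (ι) in
/-- The group of linear isometries of the standard symplectic form. -/
def Sp : Subgroup (Vec ι ≃ₗ[ℤ] Vec ι) where
  carrier := {g | ∀ x y, ω (g x) (g y) = ω x y}
  mul_mem' := fun {a b} ha hb x y => by
    rw [LinearEquiv.mul_apply, LinearEquiv.mul_apply, ha, hb]
  one_mem' := fun x y => rfl
  inv_mem' := fun {a} ha x y => by
    rw [← ha (a⁻¹ x) (a⁻¹ y), ← LinearEquiv.mul_apply, ← LinearEquiv.mul_apply]
    simp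

@[simp] theorem ω_map (g : Sp ι) (x y : Vec ι) : ω (g.1 x) (g.1 y) = ω x y := g.2 x y

@[simp] theorem mul_apply (g h : Sp ι) (x : Vec ι) : (g * h).1 x = g.1 (h.1 x) := rfl

@[simp] theorem one_apply (x : Vec ι) : (1 : Sp ι).1 x = x := rfl

@[simp] theorem inv_apply_self (g : Sp ι) (x : Vec ι) : (g⁻¹).1 (g.1 x) = x := by
  rw [← mul_apply, inv_mul_cancel, one_apply]

@[simp] theorem apply_inv_self (g : Sp ι) (x : Vec ι) : g.1 ((g⁻¹).1 x) = x := by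
  rw [← mul_apply, mul_inv_cancel, one_apply]

theorem inv_apply_eq {g : Sp ι} {x y : Vec ι} : (g⁻¹).1 x = y ↔ x = g.1 y := by
  constructor
  · rintro rfl; simp
  · rintro rfl; simp

theorem ω_apply_left (g : Sp ι) (x y : Vec ι) : ω (g.1 x) y = ω x ((g⁻¹).1 y) := by
  rw [← ω_map g x, apply_inv_self]

theorem ω_apply_right (g : Sp ι) (x y : Vec ι) : ω x (g.1 y) = ω ((g⁻¹).1 x) y := by
  rw [← ω_map g _ y, apply_inv_self]

theorem ext {g h : Sp ι} (H : ∀ x, g.1 x = h.1 x) : g = h :=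
  Subtype.ext (LinearEquiv.ext H)

theorem map_ne_zero (g : Sp ι) {x : Vec ι} (hx : x ≠ 0) : g.1 x ≠ 0 := by
  simpa using hx

/-- A homomorphism to the isometry group from a family of linear maps. -/
def homMk {K : Type*} [Group K] (F : K → Vec ι →ₗ[ℤ] Vec ι) (one : ∀ x, F 1 x = x)
    (mul : ∀ k l x, F (k * l) x = F k (F l x)) (iso : ∀ k x y, ω (F k x) (F k y) = ω x y) :
    K →* Sp ι where
  toFun k := ⟨LinearEquiv.ofLinearMap (F k) (F k⁻¹)
    (LinearMap.ext fun x => by simp [← mul, one]) (LinearMap.ext fun x => by simp [← mul, one]),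
    fun x y => iso k x y⟩
  map_one' := ext fun x => one x
  map_mul' k l := ext fun x => mul k l x

@[simp] theorem homMk_apply {K : Type*} [Group K] (F : K → Vec ι →ₗ[ℤ] Vec ι) (one mul iso) (k : K)
    (x : Vec ι) : (homMk F one mul iso k).1 x = F k x := rfl

/-- Powers of the transvection along `a`. -/
def tvHom (a : Vec ι) : Multiplicative ℤ →* Sp ι :=
  homMk (fun t => LinearMap.id + (t.toAdd • (ω a).smulRight a))
    (fun x => by simp)
    (fun k l x => by simp; module)
    (fun k x y => by simp [ω_skew x a]; ring)

/-- The `t`-th power of the transvection along `a`. -/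
def tv (a : Vec ι) (t : ℤ) : Sp ι := tvHom a (Multiplicative.ofAdd t)

@[simp] theorem tv_apply (a : Vec ι) (t : ℤ) (x : Vec ι) :
    (tv a t).1 x = x + (t * ω a x) • a := by
  simp [tv, tvHom, smul_smul, mul_comm]

@[simp] theorem tv_zero (a : Vec ι) : tv a 0 = 1 := by simp [tv]

theorem tv_zpow (a : Vec ι) (t s : ℤ) : tv a t ^ s = tv a (s * t) := by
  rw [tv, ← map_zpow, ← ofAdd_zsmul, smul_eq_mul]; rfl

theorem conj_tv (q : Sp ι) (a : Vec ι) (t : ℤ) : q * tv a t * q⁻¹ = tv (q.1 a) t := by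
  refine ext fun x => ?_
  simp [ω_apply_left]

/-- The Heisenberg elements `x ↦ x + ω(u,x) m + ω(m,x) u + t ω(u,x) u` for `m` orthogonal
to `u`. -/
def nn (u m : Vec ι) (t : ℤ) : Sp ι := tv (u + m) 1 * tv u (t - 1) * tv m (-1)

theorem nn_apply {u m : Vec ι} (h : ω u m = 0) (t : ℤ) (x : Vec ι) :
    (nn u m t).1 x = x + ω u x • m + ω m x • u + (t * ω u x) • u := by
  have h' : ω m u = 0 := by rw [ω_skew, h, neg_zero]
  simp [nn, h, h']
  module

theorem conj_nn (q : Sp ι) (u m : Vec ι) (t : ℤ) :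
    q * nn u m t * q⁻¹ = nn (q.1 u) (q.1 m) t := by
  rw [nn, nn, ← map_add, ← conj_tv, ← conj_tv, ← conj_tv]; group

theorem nn_mul {u m m' : Vec ι} (h : ω u m = 0) (h' : ω u m' = 0) (t t' : ℤ) :
    nn u m t * nn u m' t' = nn u (m + m') (t + t' + ω m m') := by
  refine ext fun x => ?_
  have h1 : ω m u = 0 := by rw [ω_skew, h, neg_zero]
  rw [mul_apply, nn_apply h, nn_apply h', nn_apply (by simp [h, h'])]
  simp [h', h1]
  module

theorem nn_zero (u : Vec ι) (t : ℤ) : nn u 0 t = tv u t := by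
  refine ext fun x => ?_
  rw [nn_apply (by simp)]; simp

theorem nn_inv {u m : Vec ι} (h : ω u m = 0) (t : ℤ) : (nn u m t)⁻¹ = nn u (-m) (-t) := by
  rw [inv_eq_iff_mul_eq_one, nn_mul h (by simp [h])]
  simp [nn_zero]

theorem nn_fix {u m : Vec ι} (h : ω u m = 0) (t : ℤ) : (nn u m t).1 u = u := by
  rw [nn_apply h]; simp [ω_skew m u, h]

/-- `SL(2, ℤ)` acting on a hyperbolic plane. -/
def plane (u u' : Vec ι) (h : ω u u' = 1) : SL2Z →* Sp ι :=
  homMk (fun k => LinearMap.id + ((k 0 0 - 1) • ω.flip u' + k 0 1 • ω u).smulRight u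
      + (k 1 0 • ω.flip u' + (k 1 1 - 1) • ω u).smulRight u')
    (fun x => by simp)
    (fun k l x => by
      simp [Matrix.mul_apply, h]
      module)
    (fun k x y => by
      have hd := k.det_coe
      rw [Matrix.det_fin_two] at hd
      simp [h, ω_skew u' u, ω_skew u' y, ω_skew x u]
      linear_combination (ω x u' * ω u y - ω u x * ω y u') * hd)

theorem plane_apply (u u' : Vec ι) (h : ω u u' = 1) (k : SL2Z) (x : Vec ι) :
    (plane u u' h k).1 x = x + ((k 0 0 - 1) * ω x u' + k 0 1 * ω u x) • u
      + (k 1 0 * ω x u' + (k 1 1 - 1) * ω u x) • u' := by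
  simp [plane]

/-- Two orthogonal hyperbolic pairs. -/
structure Hyp (u u' v v' : Vec ι) : Prop where
  uu' : ω u u' = 1
  vv' : ω v v' = 1
  uv : ω u v = 0
  uv' : ω u v' = 0
  u'v : ω u' v = 0
  u'v' : ω u' v' = 0

/-- `SL(2, ℤ)` acting on the Lagrangian spanned by `u`, `v` and dually on `u'`, `v'`. -/
def levi (u u' v v' : Vec ι) (h : Hyp u u' v v') : SL2Z →* Sp ι :=
  homMk (fun k => LinearMap.id + ((k 0 0 - 1) • ω.flip u' + k 0 1 • ω.flip v').smulRight u
      + (k 1 0 • ω.flip u' + (k 1 1 - 1) • ω.flip v').smulRight v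
      + ((k 1 1 - 1) • ω u - k 1 0 • ω v).smulRight u'
      + (-k 0 1 • ω u + (k 0 0 - 1) • ω v).smulRight v')
    (fun x => by simp)
    (fun k l x => by
      have h1 := h.uu'; have h2 := h.vv'; have h3 := h.uv; have h4 := h.uv'; have h5 := h.u'v
      have h6 := h.u'v'
      simp [Matrix.mul_apply, h1, h2, h3, h4, h5, h6, ω_skew v u, ω_skew v u',
        ω_skew v' u']
      module)
    (fun k x y => by
      have hd := k.det_coe
      rw [Matrix.det_fin_two] at hd
      have h1 := h.uu'; have h2 := h.vv'; have h3 := h.uv; have h4 := h.uv'; have h5 := h.u'v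
      have h6 := h.u'v'
      simp [h1, h2, h3, h4, h5, h6, ω_skew u' u, ω_skew v' v, ω_skew v u,
        ω_skew v' u, ω_skew v u', ω_skew v' u', ω_skew u' y, ω_skew v' y,
        ω_skew x u, ω_skew x v]
      linear_combination (ω x u' * ω u y - ω u x * ω y u' + ω x v' * ω v y - ω v x * ω y v') * hd)

theorem levi_apply (u u' v v' : Vec ι) (h : Hyp u u' v v') (k : SL2Z) (x : Vec ι) :
    (levi u u' v v' h k).1 x = x + ((k 0 0 - 1) * ω x u' + k 0 1 * ω x v') • u
      + (k 1 0 * ω x u' + (k 1 1 - 1) * ω x v') • v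
      + ((k 1 1 - 1) * ω u x - k 1 0 * ω v x) • u'
      + (-k 0 1 * ω u x + (k 0 0 - 1) * ω v x) • v' := by
  simp [levi]

theorem conj_plane (q : Sp ι) (u u' : Vec ι) (h : ω u u' = 1) (k : SL2Z) :
    q * plane u u' h k * q⁻¹ = plane (q.1 u) (q.1 u') (by simpa) k := by
  refine ext fun x => ?_
  simp [plane_apply, ω_apply_left, ω_apply_right]

theorem conj_levi (q : Sp ι) (u u' v v' : Vec ι) (h : Hyp u u' v v') (k : SL2Z) :
    q * levi u u' v v' h k * q⁻¹ = levi (q.1 u) (q.1 u') (q.1 v) (q.1 v')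
      ⟨by simp [h.uu'], by simp [h.vv'], by simp [h.uv], by simp [h.uv'], by simp [h.u'v],
        by simp [h.u'v']⟩ k := by
  refine ext fun x => ?_
  simp [levi_apply, ω_apply_left, ω_apply_right]

end Symp

/-! ### Coordinate sublattices and their isometry groups -/

namespace Symp

variable {ι : Type*} [Fintype ι] [DecidableEq ι]

theorem vec_eq_sum (x : Vec ι) :
    x = ∑ i, (x (Sum.inl i) • e i + x (Sum.inr i) • f i) := by
  refine vec_eq_of_ω fun z => ?_
  rw [map_sum, LinearMap.sum_apply, ω_apply]
  refine Finset.sum_congr rfl fun i _ => ?_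
  simp [e_ω, f_ω]; ring

theorem ext_basis {g h : Sp ι} (he : ∀ i, g.1 (e i) = h.1 (e i)) (hf : ∀ i, g.1 (f i) = h.1 (f i)) :
    g = h := by
  refine ext fun x => ?_
  rw [vec_eq_sum x, map_sum, map_sum]
  refine Finset.sum_congr rfl fun i _ => ?_
  rw [map_add, map_add, map_zsmul, map_zsmul, map_zsmul, map_zsmul, he, hf]

/-- The sublattice spanned by the basis vectors with index in `I`. -/
def lat (I : Finset ι) : Submodule ℤ (Vec ι) where
  carrier := {x | ∀ i ∉ I, x (Sum.inl i) = 0 ∧ x (Sum.inr i) = 0}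
  add_mem' := fun {x y} hx hy i hi => by simp [hx i hi, hy i hi]
  zero_mem' := fun i _ => by simp
  smul_mem' := fun c x hx i hi => by simp [hx i hi]

/-- The isometries fixing the basis vectors with index outside `I`. -/
def fixer (I : Finset ι) : Subgroup (Sp ι) where
  carrier := {g | ∀ i ∉ I, g.1 (e i) = e i ∧ g.1 (f i) = f i}
  mul_mem' := fun {g h} hg hh i hi => by
    rw [mul_apply, mul_apply, (hh i hi).1, (hh i hi).2]; exact hg i hi
  one_mem' := fun i _ => ⟨rfl, rfl⟩
  inv_mem' := fun {g} hg i hi => by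
    rw [inv_apply_eq, inv_apply_eq]; exact ⟨(hg i hi).1.symm, (hg i hi).2.symm⟩

variable {I J : Finset ι} {x y : Vec ι}

theorem e_mem_lat {i : ι} (hi : i ∈ I) : e i ∈ lat I := fun j hj => by
  have : j ≠ i := fun h => hj (h ▸ hi)
  simp [this]

theorem f_mem_lat {i : ι} (hi : i ∈ I) : f i ∈ lat I := fun j hj => by
  have : j ≠ i := fun h => hj (h ▸ hi)
  simp [this]

theorem lat_ω_e {i : ι} (hi : i ∉ I) (hx : x ∈ lat I) : ω x (e i) = 0 := by
  simp [(hx i hi).2]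

theorem lat_ω_f {i : ι} (hi : i ∉ I) (hx : x ∈ lat I) : ω x (f i) = 0 := by
  simp [(hx i hi).1]

theorem e_ω_lat {i : ι} (hi : i ∉ I) (hx : x ∈ lat I) : ω (e i) x = 0 := by
  simp [e_ω, (hx i hi).2]

theorem f_ω_lat {i : ι} (hi : i ∉ I) (hx : x ∈ lat I) : ω (f i) x = 0 := by
  simp [f_ω, (hx i hi).1]

theorem lat_mono (h : I ⊆ J) : lat I ≤ lat J := fun _ hx i hi => hx i fun h' => hi (h h')

theorem fixer_mono (h : I ⊆ J) : fixer I ≤ fixer J := fun _ hg i hi => hg i fun h' => hi (h h')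

theorem map_mem_lat {g : Sp ι} (hg : g ∈ fixer I) (hx : x ∈ lat I) : g.1 x ∈ lat I := by
  intro i hi
  rw [← ω_f (g.1 x) i, ← neg_eq_zero (a := (g.1 x) (Sum.inr i)), ← ω_e (g.1 x) i]
  constructor
  · rw [← (hg i hi).2, ω_map]; exact lat_ω_f hi hx
  · rw [← (hg i hi).1, ω_map]; exact lat_ω_e hi hx

theorem map_eq_self {g : Sp ι} (hg : g ∈ fixer I) (h : Disjoint I J) (hx : x ∈ lat J) :
    g.1 x = x := by
  rw [vec_eq_sum x, map_sum]
  refine Finset.sum_congr rfl fun i _ => ?_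
  by_cases hi : i ∈ I
  · simp [hx i (Finset.disjoint_left.1 h hi)]
  · rw [map_add, map_zsmul, map_zsmul, (hg i hi).1, (hg i hi).2]

theorem tv_mem (hx : x ∈ lat I) (t : ℤ) : tv x t ∈ fixer I := fun i hi => by
  simp [-ω_e, -ω_f, lat_ω_e hi hx, lat_ω_f hi hx]

theorem nn_mem (hx : x ∈ lat I) (hy : y ∈ lat I) (t : ℤ) : nn x y t ∈ fixer I :=
  mul_mem (mul_mem (tv_mem (add_mem hx hy) _) (tv_mem hx _)) (tv_mem hy _)

theorem plane_mem (hx : x ∈ lat I) (hy : y ∈ lat I) (h : ω x y = 1) (k : SL2Z) :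
    plane x y h k ∈ fixer I := fun i hi => by
  simp [-ω_e, -ω_f, plane_apply, lat_ω_e hi hx, lat_ω_f hi hx, e_ω_lat hi hy, f_ω_lat hi hy]

theorem levi_mem {u u' v v' : Vec ι} (h : Hyp u u' v v') (hu : u ∈ lat I) (hu' : u' ∈ lat I)
    (hv : v ∈ lat I) (hv' : v' ∈ lat I) (k : SL2Z) : levi u u' v v' h k ∈ fixer I :=
  fun i hi => by
  simp [-ω_e, -ω_f, levi_apply, lat_ω_e hi hu, lat_ω_f hi hu, e_ω_lat hi hu', f_ω_lat hi hu',
    lat_ω_e hi hv, lat_ω_f hi hv, e_ω_lat hi hv', f_ω_lat hi hv']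

/-- The map negating the coordinates with index in `I`. -/
def zFun (I : Finset ι) (x : Vec ι) : Vec ι :=
  fun s => if Sum.elim id id s ∈ I then -x s else x s

theorem zFun_apply (x : Vec ι) (s : ι ⊕ ι) :
    zFun I x s = if Sum.elim id id s ∈ I then -x s else x s := rfl

/-- The linear map negating the coordinates with index in `I`. -/
def zLin (I : Finset ι) : Vec ι →ₗ[ℤ] Vec ι where
  toFun := zFun I
  map_add' x y := by
    funext s; simp only [Vec.add_apply, zFun_apply]; split_ifs <;> ring
  map_smul' c x := by
    funext s; simp only [Vec.smul_apply, zFun_apply, RingHom.id_apply]; split_ifs <;> ring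

theorem zLin_apply (x : Vec ι) (s : ι ⊕ ι) :
    zLin I x s = if Sum.elim id id s ∈ I then -x s else x s := rfl

theorem zLin_zLin (x : Vec ι) : zLin I (zLin I x) = x := by
  funext s; rw [zLin_apply, zLin_apply]; split_ifs <;> simp

/-- The isometry negating the coordinates with index in `I`. -/
def z (I : Finset ι) : Sp ι :=
  ⟨LinearEquiv.ofLinearMap (zLin I) (zLin I) (LinearMap.ext zLin_zLin) (LinearMap.ext zLin_zLin),
    fun x y => by
      change ω (zLin I x) (zLin I y) = ω x y
      rw [ω_apply, ω_apply]
      refine Finset.sum_congr rfl fun i _ => ?_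
      simp only [zLin_apply, Sum.elim_inl, Sum.elim_inr, id]
      by_cases hi : i ∈ I <;> simp [hi]⟩

theorem z_apply (x : Vec ι) (s : ι ⊕ ι) :
    (z I).1 x s = if Sum.elim id id s ∈ I then -x s else x s := rfl

theorem z_mul_self : z I * z I = 1 := ext fun x => zLin_zLin x

theorem z_neg (h : J ⊆ I) (hx : x ∈ lat J) : (z I).1 x = -x := by
  funext s
  rw [z_apply]
  rcases s with i | i
  all_goals
    by_cases hi : i ∈ J
    · simp [h hi]
    · simp [hx i hi]

theorem z_fix (h : Disjoint I J) (hx : x ∈ lat J) : (z I).1 x = x := by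
  funext s
  rw [z_apply]
  rcases s with i | i
  all_goals
    by_cases hi : i ∈ J
    · simp [Finset.disjoint_right.1 h hi]
    · simp [hx i hi]

theorem z_e_neg {i : ι} (hi : i ∈ I) : (z I).1 (e i) = -e i := z_neg subset_rfl (e_mem_lat hi)

theorem z_f_neg {i : ι} (hi : i ∈ I) : (z I).1 (f i) = -f i := z_neg subset_rfl (f_mem_lat hi)

theorem z_e {i : ι} (hi : i ∉ I) : (z I).1 (e i) = e i :=
  z_fix (J := {i}) (by simpa using hi) (e_mem_lat (by simp))

theorem z_f {i : ι} (hi : i ∉ I) : (z I).1 (f i) = f i :=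
  z_fix (J := {i}) (by simpa using hi) (f_mem_lat (by simp))

theorem z_mem (h : I ⊆ J) : z I ∈ fixer J := fun _ hi =>
  ⟨z_e fun h' => hi (h h'), z_f fun h' => hi (h h')⟩

theorem z_comm {g : Sp ι} (hg : g ∈ fixer I) (h : I ⊆ J ∨ Disjoint J I) : z J * g = g * z J := by
  have key : ∀ x ∈ lat I, (z J).1 (g.1 x) = g.1 ((z J).1 x) := by
    intro x hx
    rcases h with h | h
    · rw [z_neg h hx, z_neg h (map_mem_lat hg hx), map_neg]
    · rw [z_fix h hx, z_fix h (map_mem_lat hg hx)]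
  refine ext_basis (fun i => ?_) (fun i => ?_)
  all_goals
    rw [mul_apply, mul_apply]
    by_cases hi : i ∈ I
    · exact key _ (by first | exact e_mem_lat hi | exact f_mem_lat hi)
    · by_cases hj : i ∈ J
      · simp [hg i hi, z_e_neg hj, z_f_neg hj]
      · simp [hg i hi, z_e hj, z_f hj]

theorem exists_div (m : ℤ) (hx : x ∈ lat I) (h : ∀ y ∈ lat I, m ∣ ω x y) :
    ∃ y ∈ lat I, x = m • y := by
  have hd : ∀ s, m ∣ x s := by
    rintro (i | i)
    all_goals
      by_cases hi : i ∈ I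
      · first
        | simpa using h (f i) (f_mem_lat hi)
        | simpa using h (e i) (e_mem_lat hi)
      · simp [hx i hi]
  refine ⟨fun s => x s / m, fun i hi => by simp [hx i hi], ?_⟩
  funext s
  exact ((Vec.smul_apply m _ s).trans (Int.mul_ediv_cancel' (hd s))).symm

theorem hyp {i j : ι} (h : i ≠ j) : Hyp (e i) (f i) (e j) (f j) := by
  constructor <;> simp [h.symm]

theorem ω_e_f (i : ι) : ω (e i) (f i) = 1 := by simp

/-- The parabolic decomposition of the stabilizer of a basis vector. -/
theorem exists_decomp {j : ι} (hj : j ∈ I) {p : Sp ι} (hp : p ∈ fixer I) (h : p.1 (e j) = e j) :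
    ∃ m ∈ lat (I.erase j), ∃ t : ℤ, ∃ q ∈ fixer (I.erase j), p = nn (e j) m t * q := by
  set t := (p.1 (f j)) (Sum.inl j) with ht
  set m := p.1 (f j) - f j - t • e j with hm
  have h1 : (p.1 (f j)) (Sum.inr j) = 1 := by
    have := ω_map p (e j) (f j)
    rw [h, e_ω] at this
    simpa using this
  have hmem := map_mem_lat hp (f_mem_lat hj)
  have hmI : m ∈ lat (I.erase j) := by
    intro i hi
    by_cases hij : i = j
    · subst hij
      simp [hm, ht, h1]
    · have : i ∉ I := fun h' => hi (Finset.mem_erase.2 ⟨hij, h'⟩)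
      simp [hm, hmem i this, hij]
  have hjm : j ∉ I.erase j := by simp
  have hu : ω (e j) m = 0 := e_ω_lat hjm hmI
  have hf : (nn (e j) m t).1 (f j) = p.1 (f j) := by
    rw [nn_apply hu, lat_ω_f hjm hmI, ω_e_f, hm]
    simp
    abel
  refine ⟨m, hmI, t, (nn (e j) m t)⁻¹ * p, ?_, by group⟩
  intro i hi
  by_cases hij : i = j
  · subst hij
    rw [mul_apply, mul_apply, inv_apply_eq, inv_apply_eq, h, hf, nn_fix hu]
    exact ⟨rfl, rfl⟩
  · have hiI : i ∉ I := fun h' => hi (Finset.mem_erase.2 ⟨hij, h'⟩)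
    exact mul_mem (inv_mem (nn_mem (e_mem_lat hj) (lat_mono (Finset.erase_subset _ _) hmI) t)) hp
      i hiI

theorem nn_unique {j : ι} {m m' : Vec ι} (hj : j ∉ I) (hm : m ∈ lat I) (hm' : m' ∈ lat I) {t t' : ℤ}
    {q q' : Sp ι} (hq : q ∈ fixer I) (hq' : q' ∈ fixer I)
    (h : nn (e j) m t * q = nn (e j) m' t' * q') : m = m' ∧ t = t' ∧ q = q' := by
  have h1 := congrArg (fun p : Sp ι => p.1 (f j)) h
  simp only [mul_apply, (hq j hj).2, (hq' j hj).2, nn_apply (e_ω_lat hj hm),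
    nn_apply (e_ω_lat hj hm'), lat_ω_f hj hm, lat_ω_f hj hm'] at h1
  have ht : t = t' := by
    have := congrFun h1 (Sum.inl j)
    simpa [hm j hj, hm' j hj] using this
  subst ht
  have hmm : m = m' := by simpa using h1
  subst hmm
  exact ⟨rfl, rfl, by simpa using h⟩

theorem exists_column (a b : ℤ) : ∃ (c : ℤ) (k : SL2Z), a = c * k 0 0 ∧ b = c * k 1 0 := by
  by_cases h : a = 0 ∧ b = 0
  · exact ⟨0, 1, by simp [h.1], by simp [h.2]⟩
  · obtain ⟨a', b', hc, ha, hb⟩ := Int.exists_gcd_one (m := a) (n := b)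
      (Int.gcd_pos_iff.2 (by tauto))
    obtain ⟨k, hk, hk'⟩ := IsCoprime.exists_SL2_col (Int.isCoprime_iff_gcd_eq_one.2 hc) 0
    refine ⟨Int.gcd a b, k, ?_, ?_⟩
    · rw [hk, mul_comm]; exact ha
    · rw [hk', mul_comm]; exact hb

theorem plane_e (i : ι) (k : SL2Z) :
    (plane (e i) (f i) (ω_e_f i) k).1 (e i) = k 0 0 • e i + k 1 0 • f i := by
  rw [plane_apply]; simp; module

theorem levi_e {i j : ι} (h : i ≠ j) (k : SL2Z) :
    (levi _ _ _ _ (hyp h) k).1 (e i) = k 0 0 • e i + k 1 0 • e j := by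
  rw [levi_apply]; simp [h.symm]; module

theorem levi_e' {i j : ι} (h : i ≠ j) (k : SL2Z) :
    (levi _ _ _ _ (hyp h) k).1 (e j) = k 0 1 • e i + k 1 1 • e j := by
  rw [levi_apply]; simp [h]; module

/-- Every vector of a coordinate sublattice is a multiple of a translate of a given basis
vector. -/
theorem exists_translate (Γ : Subgroup (Sp ι)) (hΓ : ∀ i k, plane (e i) (f i) (ω_e_f i) k ∈ Γ)
    (hΓ' : ∀ i j (h : i ≠ j) k, levi _ _ _ _ (hyp h) k ∈ Γ) {j : ι} (hj : j ∈ I) (hx : x ∈ lat I) :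
    ∃ g ∈ Γ, g ∈ fixer I ∧ ∃ c : ℤ, x = c • g.1 (e j) := by
  induction I using Finset.induction_on generalizing j x with
  | empty => simp at hj
  | insert i I hi ih =>
    suffices ∃ g ∈ Γ, g ∈ fixer (insert i I) ∧ ∃ c : ℤ, x = c • g.1 (e i) by
      obtain ⟨g, hg, hgI, c, rfl⟩ := this
      by_cases hij : j = i
      · subst hij; exact ⟨g, hg, hgI, c, rfl⟩
      · refine ⟨g * levi _ _ _ _ (hyp hij) ModularGroup.S, mul_mem hg (hΓ' _ _ hij _),
          mul_mem hgI (levi_mem (hyp hij) (e_mem_lat hj) (f_mem_lat hj) (e_mem_lat (by simp))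
            (f_mem_lat (by simp)) _), c, ?_⟩
        rw [mul_apply, levi_e hij]
        simp [ModularGroup.S]
    obtain ⟨c, k, hc, hc'⟩ := exists_column (x (Sum.inl i)) (x (Sum.inr i))
    set y : Vec ι := x - c • (plane (e i) (f i) (ω_e_f i) k).1 (e i) with hy
    have hyI : y ∈ lat I := by
      intro l hl
      by_cases hli : l = i
      · subst hli
        rw [hy, plane_e]
        simp [hc, hc']
      · rw [hy, plane_e]
        simp [hx l (by simp [hli, hl]), hli]
    have hpl : plane (e i) (f i) (ω_e_f i) k ∈ fixer ({i} : Finset ι) :=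
      plane_mem (e_mem_lat (by simp)) (f_mem_lat (by simp)) _ _
    rcases I.eq_empty_or_nonempty with rfl | ⟨l, hl⟩
    · have hy0 : y = 0 := by
        funext s
        rcases s with s | s
        · exact (hyI s (by simp)).1
        · exact (hyI s (by simp)).2
      refine ⟨_, hΓ i k, by simpa using hpl, c, ?_⟩
      rw [← sub_eq_zero, ← hy, hy0]
    · obtain ⟨g, hg, hgI, d, hd⟩ := ih hl hyI
      have hil : i ≠ l := fun h => hi (h ▸ hl)
      obtain ⟨c', k', h1, h2⟩ := exists_column c d
      refine ⟨plane (e i) (f i) (ω_e_f i) k * g * levi _ _ _ _ (hyp hil) k',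
        mul_mem (mul_mem (hΓ i k) hg) (hΓ' _ _ hil _),
        mul_mem (mul_mem (fixer_mono (by simp) hpl) (fixer_mono (by simp) hgI))
          (levi_mem (hyp hil) (e_mem_lat (by simp)) (f_mem_lat (by simp)) (e_mem_lat (by simp [hl]))
            (f_mem_lat (by simp [hl])) _), c', ?_⟩
      have hgi : g.1 (e i) = e i := (hgI i hi).1
      have hgl : (plane (e i) (f i) (ω_e_f i) k).1 (g.1 (e l)) = g.1 (e l) :=
        map_eq_self hpl (by simpa using hi) (map_mem_lat hgI (e_mem_lat hl))
      have hxy : x = c • (plane (e i) (f i) (ω_e_f i) k).1 (e i) + y := by rw [hy]; abel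
      rw [mul_apply, mul_apply, levi_e hil, map_add, map_add, map_zsmul, map_zsmul, map_zsmul,
        map_zsmul, hgi, hgl, smul_add, smul_smul, smul_smul, ← h1, ← h2, ← hd, hxy]

end Symp

/-! ### Heisenberg groups in a central extension of the symplectic group -/

namespace CExt

variable {E G A : Type*} [Group E] [Group G] [AddCommGroup A] {π : E →* G} {inc : A → E}

theorem mul_mul_right (h : CExt π inc) (x y : E) (a : A) :
    x * inc a * y = x * y * inc a := by
  rw [mul_assoc, h.comm, mul_assoc]

theorem conj_mul (h : CExt π inc) (w x : E) (a : A) :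
    w * (x * inc a) * w⁻¹ = w * x * w⁻¹ * inc a := by
  rw [← mul_assoc, h.mul_mul_right]

theorem mul_inv (h : CExt π inc) (x : E) (a : A) : (x * inc a)⁻¹ = x⁻¹ * inc (-a) := by
  rw [_root_.mul_inv_rev, ← h.neg, h.comm]

theorem mul_zpow (h : CExt π inc) (a : A) (e : E) (n : ℤ) :
    (e * inc a) ^ n = e ^ n * inc (n • a) := by
  rw [((h.commute a e).symm).mul_zpow, h.zsmul]

theorem mul_cancel (h : CExt π inc) {x : E} {a b : A} (hab : x * inc a = x * inc b) : a = b :=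
  h.injective (mul_left_cancel hab)

theorem eq_zero_of_mul (h : CExt π inc) {x : E} {a : A} (hab : x * inc a = x) : a = 0 :=
  h.inj _ (by simpa using hab)

variable [Module ℚ A]

theorem eq_zero_of_add_self {a : A} (ha : a + a = 0) : a = 0 :=
  eq_zero_of_nsmul (n := 2) (by norm_num) (by rw [two_nsmul, ha])

theorem eq_zero_of_zsmul {n : ℤ} (hn : n ≠ 0) {a : A} (ha : n • a = 0) : a = 0 := by
  have : (n : ℚ) • a = 0 := by rw [Int.cast_smul_eq_zsmul, ha]
  exact (smul_eq_zero.1 this).resolve_left (by exact_mod_cast hn)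

theorem exists_involution (h : CExt π inc) {g : G} (hg : g * g = 1) :
    ∃ ε, π ε = g ∧ ε * ε = 1 := by
  obtain ⟨ε, h1, h2⟩ := h.exists_torsion (g := g) (n := 2) (by norm_num) (by rw [pow_two, hg])
  exact ⟨ε, h1, by rw [← pow_two, h2]⟩

theorem involution_comm (h : CExt π inc) {ε q : E} (hε : ε * ε = 1)
    (hq : π ε * π q = π q * π ε) : q * ε * q⁻¹ = ε := by
  refine h.torsion_unique (isOfFinOrder_of_pow (n := 2) (by norm_num) ?_)
    (isOfFinOrder_of_pow (n := 2) (by norm_num) (by rw [pow_two, hε])) ?_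
  · rw [pow_two]
    simp only [mul_assoc, inv_mul_cancel_left]
    rw [← mul_assoc ε ε, hε, one_mul, mul_inv_cancel]
  · simp [← hq]

/-- An involution inverting an element of the quotient inverts a unique lift. -/
theorem exists_inverted (h : CExt π inc) {ε : E} {g : G}
    (hg : π ε * g * π ε = g⁻¹) : ∃ x, π x = g ∧ ε * x * ε = x⁻¹ := by
  obtain ⟨s, rfl⟩ := h.surj g
  obtain ⟨a, ha⟩ := h.exists_eq_mul (e := ε * s * ε) (e' := s⁻¹) (by simpa using hg)
  obtain ⟨b, hb⟩ := exists_nsmul (n := 2) (by norm_num) (-a)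
  refine ⟨s * inc b, by simp [h.proj], ?_⟩
  have hab : a + b = -b := by
    rw [two_nsmul] at hb
    rw [eq_neg_iff_add_eq_zero, add_assoc, hb, add_neg_cancel]
  rw [← mul_assoc ε, h.mul_mul_right, ha, h.mul_inv, mul_assoc, ← h.add, hab]

theorem inverted_unique (h : CExt π inc) {ε x y : E} (hx : ε * x * ε = x⁻¹)
    (hy : ε * y * ε = y⁻¹) (hxy : π x = π y) : x = y := by
  obtain ⟨a, rfl⟩ := h.exists_eq_mul hxy
  rw [← mul_assoc ε, h.mul_mul_right, hy, h.mul_inv] at hx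
  have := h.mul_cancel hx
  rw [eq_zero_of_add_self (a := a) (by nth_rewrite 1 [this]; simp), h.zero, mul_one]

theorem involution_fix (h : CExt π inc) {ε x : E} (hε : ε * ε = 1)
    (hx : π ε * π x = π x * π ε) : ε * x * ε = x := by
  have := h.involution_comm hε hx
  have h2 : x * ε = ε * x := by nth_rewrite 2 [← this]; group
  rw [mul_assoc, h2, ← mul_assoc, hε, one_mul]

end CExt

namespace Symp

variable {ι : Type*} [Fintype ι] [DecidableEq ι] {E A : Type*} [Group E] [AddCommGroup A]
  [Module ℚ A] {π : E →* Sp ι} {inc : A → E}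

theorem bilin_of_cocycle {D : Type*} [AddCommGroup D] (P : D → Prop)
    (hP : ∀ x y, P x → P y → P (x + y)) (B : D → D → A)
    (anti : ∀ x y, P x → P y → B y x = -B x y)
    (coc : ∀ x y z, P x → P y → P z → B (x + y) z + B x y = B x (y + z) + B y z) (x y z : D)
    (hx : P x) (hy : P y) (hz : P z) : B (x + y) z = B x z + B y z := by
  have h1 := coc x y z hx hy hz
  have h2 := coc x z y hx hz hy
  have h3 := coc z x y hz hx hy
  rw [anti (x + y) z (hP _ _ hx hy) hz, anti x z hx hz, add_comm z x] at h3
  rw [anti y z hy hz, add_comm z y] at h2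
  rw [← sub_eq_zero]
  refine CExt.eq_zero_of_add_self ?_
  have e1 : B x (y + z) = B (x + y) z + B x y - B y z := by rw [h1]; abel
  have e2 : B (x + z) y = B (x + y) z + B x y - B y z - B y z - B x z := by
    rw [← e1, eq_sub_iff_add_eq, h2]; abel
  rw [e2, ← sub_eq_zero] at h3
  rw [← h3]; abel

/-- A skew form which changes by multiples of `w` under the transvections of `w` vanishes as soon
as it vanishes on a hyperbolic pair. -/
theorem form_eq_zero {D : Type*} [AddCommGroup D] (w : D →ₗ[ℤ] D →ₗ[ℤ] ℤ) (b : D →+ D →+ A)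
    (self : ∀ x, w x x = 0) (skew : ∀ x y, w x y = -w y x) (alt : ∀ x y, b x y = -b y x)
    (hb : ∀ a, ∃ c, ∀ x y, b (x + w a x • a) (y + w a y • a) = b x y + w x y • c) {v v' : D}
    (hv : w v v' = 1) (hvv : b v v' = 0) (x y : D) : b x y = 0 := by
  have bself : ∀ a, b a a = 0 := fun a =>
    CExt.eq_zero_of_add_self (by nth_rewrite 1 [alt a a]; simp)
  have key : ∀ a t, w t a ≠ 0 → ∀ x y, w a y • b x a + w a x • b a y = 0 := by
    intro a t ht
    obtain ⟨c, hc⟩ := hb a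
    have h1 : ∀ x y, w a y • b x a + w a x • b a y = w x y • c := by
      intro x y
      have := hc x y
      simp only [map_add, map_zsmul, AddMonoidHom.add_apply, AddMonoidHom.smul_apply, bself,
        smul_zero, add_zero] at this
      rw [add_assoc, add_right_inj] at this
      rw [← this]
      abel
    have h2 : c = 0 := by
      refine CExt.eq_zero_of_zsmul ht ?_
      rw [← h1 t a, self, bself]; simp
    intro x y
    rw [h1, h2, smul_zero]
  have hv'v : w v' v = -1 := by rw [skew, hv]
  have h1 : ∀ x, b x v = 0 := by
    intro x
    have := key v v' (by rw [hv'v]; norm_num) x v'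
    simpa [hv, hvv] using this
  have h2 : ∀ x, b x v' = 0 := by
    intro x
    have := key v' v (by rw [hv]; norm_num) x v
    rw [hv'v, alt v' v, hvv] at this
    simpa using this
  have h3 : ∀ a x, w a v ≠ 0 → b x a = 0 := by
    intro a x ha
    have := key a v (by rwa [skew, neg_ne_zero]) x v
    rw [alt a v, alt v a, h1, neg_neg, smul_zero, add_zero] at this
    exact CExt.eq_zero_of_zsmul ha this
  by_cases hy : w y v = 0
  · have := h3 (y + v') x (by simp [hy, hv'v])
    simpa [h2] using this
  · exact h3 y x hy

/-- Lifts of the unipotent radical of the stabilizer of a basis vector. -/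
theorem exists_heisenberg (h : CExt π inc) {j k : ι} {K : Finset ι} (hj : j ∉ K) (hk : k ∈ K) :
    ∃ (σ : Vec ι → E) (l : E), π l = tv (e j) 1 ∧ (∀ m ∈ lat K, π (σ m) = nn (e j) m 0) ∧
      (∀ m ∈ lat K, ∀ m' ∈ lat K, σ m * σ m' = σ (m + m') * l ^ ω m m') ∧
      (∀ m ∈ lat K, Commute l (σ m)) ∧ (∀ q, π q ∈ fixer K → Commute q l) ∧
      (∀ q, π q ∈ fixer K → ∀ m ∈ lat K, q * σ m * q⁻¹ = σ ((π q).1 m)) := by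
  obtain ⟨ε, hε, hε2⟩ := h.exists_involution (z_mul_self (I := K))
  have hzu : (z K).1 (e j) = e j := z_e hj
  have hzi : (z K)⁻¹ = z K := inv_eq_of_mul_eq_one_right z_mul_self
  have hum : ∀ {m}, m ∈ lat K → ω (e j) m = 0 := fun hm => e_ω_lat hj hm
  have hex : ∀ m : Vec ι, ∃ x, m ∈ lat K → π x = nn (e j) m 0 ∧ ε * x * ε = x⁻¹ := by
    intro m
    by_cases hm : m ∈ lat K
    · obtain ⟨x, hx⟩ := h.exists_inverted (ε := ε) (g := nn (e j) m 0) (by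
        rw [hε, nn_inv (hum hm)]
        nth_rewrite 2 [← hzi]
        rw [conj_nn, hzu, z_neg subset_rfl hm, neg_zero])
      exact ⟨x, fun _ => hx⟩
    · exact ⟨1, fun h' => absurd h' hm⟩
  choose σ hσ using hex
  obtain ⟨τ, hτ⟩ := h.surj (tv (e j) 1)
  have hετ : ε * τ * ε = τ := h.involution_fix hε2 (by
    rw [hε, hτ, ← mul_inv_eq_iff_eq_mul, conj_tv, hzu])
  have hε' : ε⁻¹ = ε := inv_eq_of_mul_eq_one_right hε2
  have conj_mul : ∀ x y, ε * (x * y) * ε = (ε * x * ε) * (ε * y * ε) := by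
    intro x y
    simp only [mul_assoc]
    rw [← mul_assoc ε ε, hε2, one_mul]
  have hcomm : ∀ m ∈ lat K, Commute τ (σ m) := by
    intro m hm
    obtain ⟨a, ha⟩ := h.exists_eq_mul (e := σ m * τ) (e' := τ * σ m) (by
      rw [map_mul, map_mul, hτ, (hσ m hm).1, ← nn_zero, nn_mul (hum hm) (by simp),
        nn_mul (by simp) (hum hm)]; simp)
    have h1 := congrArg (fun x => ε * x * ε) ha
    simp only [conj_mul, (hσ m hm).2, hετ] at h1
    have h2 : ε * inc a * ε = inc a := by nth_rewrite 2 [← hε']; exact h.conj_ι a ε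
    rw [h2] at h1
    have h3 : τ * σ m = σ m * τ * inc a := by
      have := congrArg (fun x => σ m * x * σ m) h1
      simp only [mul_assoc, mul_inv_cancel_left, inv_mul_cancel_left, h.comm] at this
      simpa [mul_assoc] using this
    have h4 : a = 0 := by
      refine CExt.eq_zero_of_add_self (h.eq_zero_of_mul (x := σ m * τ) ?_)
      rw [h.add, ← mul_assoc, ← h3, ← ha]
    rw [h4, h.zero, mul_one] at ha
    exact ha.symm
  have hpτ : ∀ n : ℤ, π (τ ^ n) = nn (e j) 0 n := by
    intro n; rw [map_zpow, hτ, tv_zpow, mul_one, nn_zero]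
  have hB : ∀ m m' : Vec ι, ∃ b, m ∈ lat K → m' ∈ lat K →
      σ m * σ m' = σ (m + m') * τ ^ ω m m' * inc b := by
    intro m m'
    by_cases hm : m ∈ lat K ∧ m' ∈ lat K
    · obtain ⟨b, hb⟩ := h.exists_eq_mul (e := σ m * σ m') (e' := σ (m + m') * τ ^ ω m m') (by
        rw [map_mul, map_mul, (hσ m hm.1).1, (hσ m' hm.2).1, (hσ _ (add_mem hm.1 hm.2)).1, hpτ,
          nn_mul (hum hm.1) (hum hm.2), nn_mul (by simp [hum hm.1, hum hm.2]) (by simp)]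
        simp)
      exact ⟨b, fun _ _ => hb⟩
    · exact ⟨0, fun h1 h2 => absurd ⟨h1, h2⟩ hm⟩
  choose B hB using hB
  have hετn : ∀ n : ℤ, ε * τ ^ n * ε = τ ^ n := by
    intro n
    nth_rewrite 2 [← hε']
    rw [← conj_zpow, hε', hετ]
  have hει : ∀ a, ε * inc a * ε = inc a := by
    intro a; nth_rewrite 2 [← hε']; exact h.conj_ι a ε
  have anti : ∀ m m', m ∈ lat K → m' ∈ lat K → B m' m = -B m m' := by
    intro m m' hm hm'
    have h1 := congrArg (fun x => ε * x * ε) (hB m m' hm hm')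
    simp only [conj_mul, (hσ _ hm).2, (hσ _ hm').2, (hσ _ (add_mem hm hm')).2, hετn, hει] at h1
    have h2 := congrArg (·⁻¹) h1
    simp only [_root_.mul_inv_rev, inv_inv] at h2
    rw [hB m' m hm' hm, ← h.neg, ← _root_.zpow_neg, ← ω_skew, h.comm,
      ((hcomm _ (add_mem hm hm')).zpow_left _).eq, add_comm m' m] at h2
    exact h.mul_cancel h2
  have coc : ∀ x y w, x ∈ lat K → y ∈ lat K → w ∈ lat K →
      B (x + y) w + B x y = B x (y + w) + B y w := by
    intro x y w hx hy hw
    have h1 : σ x * σ y * σ w = σ (x + y + w) * τ ^ (ω x y + ω (x + y) w) *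
        inc (B (x + y) w + B x y) := by
      rw [hB x y hx hy, h.mul_mul_right, mul_assoc (σ (x + y)),
        ((hcomm _ hw).zpow_left _).eq, ← mul_assoc, hB _ _ (add_mem hx hy) hw, h.mul_mul_right,
        h.add, mul_assoc (σ (x + y + w)), ← _root_.zpow_add, add_comm (ω x y)]
      simp only [mul_assoc]
    have h2 : σ x * σ y * σ w = σ (x + y + w) * τ ^ (ω x y + ω (x + y) w) *
        inc (B x (y + w) + B y w) := by
      rw [mul_assoc, hB y w hy hw, ← mul_assoc, ← mul_assoc, hB _ _ hx (add_mem hy hw),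
        h.mul_mul_right, mul_assoc (σ _), ← _root_.zpow_add, h.add, ← mul_assoc, ← add_assoc]
      simp only [map_add, LinearMap.add_apply, add_assoc]
    exact h.mul_cancel (h1.symm.trans h2)
  have bil : ∀ x y w, x ∈ lat K → y ∈ lat K → w ∈ lat K → B (x + y) w = B x w + B y w :=
    fun x y w => bilin_of_cocycle (· ∈ lat K) (fun _ _ => add_mem) B anti coc x y w
  have hqσ : ∀ q, π q ∈ fixer K → ∀ m ∈ lat K, q * σ m * q⁻¹ = σ ((π q).1 m) := by
    intro q hq m hm
    have hqε := h.involution_comm (ε := ε) (q := q) hε2 (by rw [hε]; exact z_comm hq (Or.inl subset_rfl))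
    have hqm := map_mem_lat hq hm
    refine h.inverted_unique (ε := ε) ?_ (hσ _ hqm).2 ?_
    · nth_rewrite 1 [← hqε]
      nth_rewrite 2 [← hqε]
      calc _ = q * (ε * σ m * ε) * q⁻¹ := by group
        _ = _ := by rw [(hσ m hm).2]; group
    · rw [map_mul, map_mul, map_inv, (hσ m hm).1, (hσ _ hqm).1, conj_nn, (hq j hj).1]
  have hχ : ∀ q, π q ∈ fixer K → ∃ c, q * τ * q⁻¹ = τ * inc c ∧
      ∀ m ∈ lat K, ∀ m' ∈ lat K, B ((π q).1 m) ((π q).1 m') = B m m' + ω m m' • c := by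
    intro q hq
    obtain ⟨c, hc⟩ := h.exists_eq_mul (e := q * τ * q⁻¹) (e' := τ) (by
      rw [map_mul, map_mul, map_inv, hτ, conj_tv, (hq j hj).1])
    refine ⟨c, hc, fun m hm m' hm' => ?_⟩
    have h1 := congrArg (fun x => q * x * q⁻¹) (hB m m' hm hm')
    have h2 : q * (σ m * σ m') * q⁻¹ = (q * σ m * q⁻¹) * (q * σ m' * q⁻¹) := by group
    have h3 : q * (σ (m + m') * τ ^ ω m m') * q⁻¹ =
        (q * σ (m + m') * q⁻¹) * (q * τ * q⁻¹) ^ ω m m' := by rw [conj_zpow]; group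
    rw [h2, h.conj_mul, h3, hqσ q hq _ hm, hqσ q hq _ hm', hqσ q hq _ (add_mem hm hm'), hc,
      hB _ _ (map_mem_lat hq hm) (map_mem_lat hq hm'), ω_map, map_add, h.mul_zpow,
      mul_assoc, mul_assoc, mul_assoc] at h1
    have h4 := mul_left_cancel (mul_left_cancel h1)
    rw [← h.add] at h4
    rw [h.injective h4, add_comm]
  have hv : e k ∈ lat K := e_mem_lat hk
  have hv' : f k ∈ lat K := f_mem_lat hk
  set κ := B (e k) (f k) with hκ
  have hBκ : ∀ x ∈ lat K, ∀ y ∈ lat K, B x y = ω x y • κ := by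
    have bil' : ∀ x y w, x ∈ lat K → y ∈ lat K → w ∈ lat K → B w (x + y) = B w x + B w y := by
      intro x y w hx hy hw
      rw [anti _ _ (add_mem hx hy) hw, bil _ _ _ hx hy hw, anti _ _ hw hx, anti _ _ hw hy]
      abel
    let b : lat K →+ lat K →+ A := AddMonoidHom.mk'
      (fun x => AddMonoidHom.mk' (fun y => B x y - ω x.1 y.1 • κ) (fun y y' => by
        simp only [Submodule.coe_add, map_add, add_smul, bil' _ _ _ y.2 y'.2 x.2]; abel))
      (fun x x' => AddMonoidHom.ext fun y => by
        simp only [Submodule.coe_add, map_add, add_smul, bil _ _ _ x.2 x'.2 y.2,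
          AddMonoidHom.mk'_apply, LinearMap.add_apply, AddMonoidHom.add_apply]
        abel)
    have hb : ∀ x y : lat K, b x y = B x y - ω x.1 y.1 • κ := fun _ _ => rfl
    intro x hx y hy
    have := form_eq_zero (ω.domRestrict₁₂ (lat K) (lat K)) b (fun x => ω_self x.1)
      (fun x y => ω_skew x.1 y.1)
      (fun x y => by rw [hb, hb, anti _ _ y.2 x.2, ω_skew x.1 y.1, neg_smul]; abel)
      (fun a => by
        obtain ⟨q, hq⟩ := h.surj (tv a.1 1)
        obtain ⟨c, -, hc⟩ := hχ q (by rw [hq]; exact tv_mem a.2 1)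
        refine ⟨c, fun x y => ?_⟩
        have h1 := hc x x.2 y y.2
        have h2 := ω_map (tv a.1 1) x.1 y.1
        simp only [hq, tv_apply, one_mul] at h1 h2
        simp only [hb, LinearMap.domRestrict₁₂_apply, Submodule.coe_add, Submodule.coe_smul, h1, h2]
        abel)
      (v := ⟨e k, hv⟩) (v' := ⟨f k, hv'⟩) (ω_e_f k) (by rw [hb]; simp [← hκ]) ⟨x, hx⟩ ⟨y, hy⟩
    rwa [hb, sub_eq_zero] at this
  refine ⟨σ, τ * inc κ, by simp [h.proj, hτ], fun m hm => (hσ m hm).1, ?_, ?_, ?_, hqσ⟩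
  · intro m hm m' hm'
    rw [hB m m' hm hm', h.mul_zpow, hBκ m hm m' hm', mul_assoc]
  · intro m hm
    exact (hcomm m hm).mul_left (h.commute _ _)
  · intro q hq
    obtain ⟨c, hc, hc'⟩ := hχ q hq
    have hc0 : c = 0 := by
      have := hc' _ hv _ hv'
      rw [hBκ _ (map_mem_lat hq hv) _ (map_mem_lat hq hv'), ω_map, ω_e_f, one_smul, one_smul,
        ← hκ] at this
      simpa using this
    rw [hc0, h.zero, mul_one, mul_inv_eq_iff_eq_mul] at hc
    exact Commute.mul_right hc (h.commute _ _).symm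

end Symp

/-! ### Retractions over the stabilizer of a line -/

namespace Symp

variable {ι : Type*} [Fintype ι] [DecidableEq ι] {E A : Type*} [Group E] [AddCommGroup A]
  [Module ℚ A] {π : E →* Sp ι} {inc : A → E}

/-- The stabilizer of a basis vector. -/
def stabVec (I : Finset ι) (j : ι) : Subgroup (Sp ι) where
  carrier := {p | p ∈ fixer I ∧ p.1 (e j) = e j}
  mul_mem' := fun {a b} ha hb => ⟨mul_mem ha.1 hb.1, by rw [mul_apply, hb.2, ha.2]⟩
  one_mem' := ⟨one_mem _, rfl⟩
  inv_mem' := fun {a} ha => ⟨inv_mem ha.1, by rw [inv_apply_eq, ha.2]⟩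

/-- The stabilizer of the line through a basis vector. -/
def stabLine (I : Finset ι) (j : ι) : Subgroup (Sp ι) where
  carrier := {p | p ∈ fixer I ∧ (p.1 (e j) = e j ∨ p.1 (e j) = -e j)}
  mul_mem' := fun {a b} ha hb => ⟨mul_mem ha.1 hb.1, by
    rcases ha.2 with h | h <;> rcases hb.2 with h' | h' <;> simp [h, h']⟩
  one_mem' := ⟨one_mem _, Or.inl rfl⟩
  inv_mem' := fun {a} ha => ⟨inv_mem ha.1, by
    rw [inv_apply_eq, inv_apply_eq, map_neg]
    rcases ha.2 with h | h <;> simp [h]⟩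

theorem stabVec_le (I : Finset ι) (j : ι) : stabVec I j ≤ stabLine I j :=
  fun _ hp => ⟨hp.1, Or.inl hp.2⟩

theorem exists_retr_stabVec (h : CExt π inc) {j k : ι} {K : Finset ι} (hj : j ∉ K) (hk : k ∈ K)
    {r' : E → A} (hr : IsRetr π inc (fixer K) r') :
    ∃ r, IsRetr π inc (stabVec (insert j K) j) r := by
  obtain ⟨σ, l, hl, hσ, hmul, hlσ, hql, hqσ⟩ := exists_heisenberg h hj hk
  have hp : ∀ m ∈ lat K, ∀ t : ℤ, π (σ m * l ^ t) = nn (e j) m t := by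
    intro m hm t
    rw [map_mul, hσ m hm, map_zpow, hl, tv_zpow, mul_one, ← nn_zero,
      nn_mul (e_ω_lat hj hm) (by simp)]
    simp
  have hdec : ∀ x, ∃ (m : Vec ι) (t : ℤ) (y : E), π x ∈ stabVec (insert j K) j →
      m ∈ lat K ∧ π y ∈ fixer K ∧ x = σ m * l ^ t * y := by
    intro x
    by_cases hx : π x ∈ stabVec (insert j K) j
    · obtain ⟨m, hm, t, q, hq, hpq⟩ := exists_decomp (Finset.mem_insert_self j K) hx.1 hx.2
      rw [Finset.erase_insert hj] at hm hq
      refine ⟨m, t, (σ m * l ^ t)⁻¹ * x, fun _ => ⟨hm, ?_, by group⟩⟩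
      rw [map_mul, map_inv, hp m hm, hpq]
      simpa using hq
    · exact ⟨0, 0, 1, fun h' => absurd h' hx⟩
  choose M T Y hdec using hdec
  have huniq : ∀ m ∈ lat K, ∀ (t : ℤ) y, π y ∈ fixer K →
      π (σ m * l ^ t * y) ∈ stabVec (insert j K) j → Y (σ m * l ^ t * y) = y := by
    intro m hm t y hy hx
    obtain ⟨h1, h2, h3⟩ := hdec _ hx
    have h4 := congrArg π h3
    rw [map_mul, hp m hm, map_mul, hp _ h1] at h4
    obtain ⟨h5, h6, -⟩ := nn_unique hj hm h1 hy h2 h4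
    rw [← h5, ← h6] at h3
    exact (mul_left_cancel h3).symm
  refine ⟨fun x => r' (Y x), fun x x' hx hx' => ?_, fun a => ?_⟩
  · obtain ⟨h1, h2, h3⟩ := hdec x hx
    obtain ⟨h1', h2', h3'⟩ := hdec x' hx'
    have hm := map_mem_lat h2 h1'
    have key : x * x' = σ (M x + (π (Y x)).1 (M x')) *
        l ^ (ω (M x) ((π (Y x)).1 (M x')) + T x + T x') * (Y x * Y x') := by
      have c1 : Y x * σ (M x') = σ ((π (Y x)).1 (M x')) * Y x := by
        rw [← hqσ _ h2 _ h1']; group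
      have c2 : Y x * l ^ T x' = l ^ T x' * Y x := ((hql _ h2).zpow_right _).eq
      have c3 := ((hlσ _ hm).zpow_left (T x)).eq
      rw [_root_.zpow_add, _root_.zpow_add]
      nth_rewrite 1 [h3, h3']
      calc _ = σ (M x) * l ^ T x * (Y x * σ (M x')) * l ^ T x' * Y x' := by group
        _ = σ (M x) * (l ^ T x * σ ((π (Y x)).1 (M x'))) * (Y x * l ^ T x') * Y x' := by
          rw [c1]; group
        _ = (σ (M x) * σ ((π (Y x)).1 (M x'))) * l ^ T x * l ^ T x' * Y x * Y x' := by
          rw [c2, c3]; group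
        _ = _ := by rw [hmul _ h1 _ hm]; group
    have hxx : π (x * x') ∈ stabVec (insert j K) j := by rw [map_mul]; exact mul_mem hx hx'
    have hYY : π (Y x * Y x') ∈ fixer K := by rw [map_mul]; exact mul_mem h2 h2'
    rw [key, huniq _ (add_mem h1 hm) _ _ hYY (by rw [← key]; exact hxx), hr.mul _ _ h2 h2']
  · have h0 : σ 0 = 1 := by
      have := hmul 0 (zero_mem _) 0 (zero_mem _)
      simpa using this
    have := huniq 0 (zero_mem _) 0 (inc a) (by simp [h.proj, one_mem]) (by simp [h0, h.proj, one_mem])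
    rw [h0, zpow_zero, one_mul, one_mul] at this
    rw [this, hr.inc]

theorem exists_retr_stabLine (h : CExt π inc) {j k : ι} {K : Finset ι} (hj : j ∉ K) (hk : k ∈ K)
    {r' : E → A} (hr : IsRetr π inc (fixer K) r') :
    ∃ r, IsRetr π inc (stabLine (insert j K) j) r := by
  obtain ⟨r, hr⟩ := exists_retr_stabVec h hj hk hr
  obtain ⟨ζ, hζ, hζ2⟩ := h.exists_involution (z_mul_self (I := insert j K))
  have hc : ∀ p ∈ fixer (insert j K), z (insert j K) * p = p * z (insert j K) :=
    fun p hp => z_comm hp (Or.inl subset_rfl)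
  obtain ⟨r1, hr1, -⟩ := hr.exists_extend h (K' := stabLine (insert j K) j) hζ2
    (fun p hp => by rw [hζ, hc p hp.1, mul_assoc, z_mul_self, mul_one]; exact hp)
    (fun p hp => by
      rcases hp.2 with h' | h'
      · exact Or.inl ⟨hp.1, h'⟩
      · refine Or.inr ⟨?_, ?_⟩
        · rw [hζ]; exact mul_mem (z_mem subset_rfl) hp.1
        · rw [hζ, mul_apply, h', map_neg, z_e_neg (by simp), neg_neg])
    (fun x hx => by rw [h.involution_fix hζ2 (by rw [hζ]; exact hc _ hx.1)])
  exact ⟨r1, hr1⟩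

end Symp

/-! ### Invariance of retractions under a Weyl element -/

namespace Symp

variable {ι : Type*} [Fintype ι] [DecidableEq ι] {E A : Type*} [Group E] [AddCommGroup A]
  [Module ℚ A] {π : E →* Sp ι} {inc : A → E}

/-- `SL(2, ℤ)` acting on a coordinate plane. -/
abbrev pl (i : ι) : SL2Z →* Sp ι := plane (e i) (f i) (ω_e_f i)

/-- `SL(2, ℤ)` acting on a pair of coordinate planes. -/
abbrev lv {i j : ι} (h : i ≠ j) : SL2Z →* Sp ι := levi (e i) (f i) (e j) (f j) (hyp h)

theorem pl_T (i : ι) : pl i ModularGroup.T = tv (e i) 1 := by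
  refine ext fun x => ?_
  rw [plane_apply]; simp [ModularGroup.T]

/-- The vanishing of the commutator invariant of a central extension. -/
def CommZero (h : CExt π inc) (j k : ι) : Prop :=
  ∀ x y, π x = nn (e j) (e k) 0 → π y = nn (e j) (f k) 0 →
    x * y * x⁻¹ * y⁻¹ = h.lift (pl j) (ModularGroup.T ^ 2)

theorem levi_S_e {i j : ι} (h : i ≠ j) : (lv h ModularGroup.S).1 (e i) = e j := by
  rw [levi_e h]; simp [ModularGroup.S]

theorem levi_S_e' {i j : ι} (h : i ≠ j) : (lv h ModularGroup.S).1 (e j) = -e i := by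
  rw [levi_e' h]; simp [ModularGroup.S]

theorem levi_S_f {i j : ι} (h : i ≠ j) : (lv h ModularGroup.S).1 (f i) = f j := by
  rw [levi_apply]; simp [ModularGroup.S, h]

theorem levi_S_f' {i j : ι} (h : i ≠ j) : (lv h ModularGroup.S).1 (f j) = -f i := by
  rw [levi_apply]; simp [ModularGroup.S, h.symm]

theorem lv_mem {I : Finset ι} {i j : ι} (h : i ≠ j) (hi : i ∈ I) (hj : j ∈ I) (k : SL2Z) :
    lv h k ∈ fixer I :=
  levi_mem (hyp h) (e_mem_lat hi) (f_mem_lat hi) (e_mem_lat hj) (f_mem_lat hj) k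

theorem pl_mem {I : Finset ι} {i : ι} (hi : i ∈ I) (k : SL2Z) : pl i k ∈ fixer I :=
  plane_mem (e_mem_lat hi) (f_mem_lat hi) _ k

theorem conj_pl {q : Sp ι} {i j : ι} (he : q.1 (e i) = e j) (hf : q.1 (f i) = f j) (k : SL2Z) :
    q * pl i k * q⁻¹ = pl j k := by
  rw [conj_plane]; simp only [he, hf]

theorem conj_pl_neg {q : Sp ι} {i j : ι} (he : q.1 (e i) = -e j) (hf : q.1 (f i) = -f j)
    (k : SL2Z) : q * pl i k * q⁻¹ = pl j k := by
  rw [conj_plane]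
  refine ext fun x => ?_
  rw [plane_apply, plane_apply, he, hf]
  simp; module

theorem CommZero.congr {h : CExt π inc} {j j' k : ι} (hc : CommZero h j k) (hj : j ≠ k)
    (hj' : j' ≠ k) : CommZero h j' k := by
  by_cases hjj : j = j'
  · rwa [← hjj]
  intro x y hx hy
  set w := lv hjj ModularGroup.S with hw
  obtain ⟨q, hq⟩ := h.surj w
  have hwm : w ∈ fixer {j, j'} := lv_mem hjj (by simp) (by simp) _
  have hek : w.1 (e k) = e k := (hwm k (by simp [hj.symm, hj'.symm])).1
  have hfk : w.1 (f k) = f k := (hwm k (by simp [hj.symm, hj'.symm])).2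
  have h1 : ∀ m, w.1 m = m → w⁻¹ * nn (e j') m 0 * w = nn (e j) m 0 := by
    intro m hm
    have := conj_nn w (e j) m 0
    rw [levi_S_e hjj, hm] at this
    rw [← this]; group
  have h2 := hc (q⁻¹ * x * q) (q⁻¹ * y * q) (by simp [hq, hx, h1 _ hek]) (by simp [hq, hy, h1 _ hfk])
  have h3 := h.conj_lift (pl j) (pl j') q (fun k => by
    rw [hq]; exact conj_pl (levi_S_e hjj) (levi_S_f hjj) k) (ModularGroup.T ^ 2)
  rw [← h3, ← h2]; group

theorem retr_lift_T {h : CExt π inc} {I : Finset ι} {j k : ι} (hj : j ∈ I) (hk : k ∈ I)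
    (hjk : j ≠ k) {r : E → A} (hr : IsRetr π inc (stabLine I j) r) (hc : CommZero h j k) :
    r (h.lift (pl j) ModularGroup.T) = 0 := by
  obtain ⟨x, hx⟩ := h.surj (nn (e j) (e k) 0)
  obtain ⟨y, hy⟩ := h.surj (nn (e j) (f k) 0)
  have hx' : π x ∈ stabLine I j := by
    rw [hx]
    exact ⟨nn_mem (e_mem_lat hj) (e_mem_lat hk) 0, Or.inl (nn_fix (by simp) 0)⟩
  have hy' : π y ∈ stabLine I j := by
    rw [hy]
    exact ⟨nn_mem (e_mem_lat hj) (f_mem_lat hk) 0, Or.inl (nn_fix (by simp [hjk.symm]) 0)⟩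
  have hT : π (h.lift (pl j) ModularGroup.T) ∈ stabLine I j := by
    rw [h.proj_lift, pl_T]
    exact ⟨tv_mem (e_mem_lat hj) 1, Or.inl (by simp)⟩
  refine CExt.eq_zero_of_nsmul (n := 2) (by norm_num) ?_
  rw [← hr.pow hT, ← map_pow, ← hc x y hx hy,
    hr.mul _ _ (by simpa using mul_mem (mul_mem hx' hy') (inv_mem hx')) (by simpa using hy'),
    hr.conj hx' hy', hr.inv hy', add_neg_cancel]

/-- A retraction over the stabilizer of a line is invariant under conjugation by a Weyl element. -/
theorem retr_conj_weyl {h : CExt π inc} {K : Finset ι} {j k : ι} (hj : j ∉ K) (hk : k ∈ K)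
    (hjk : j ≠ k) {r : E → A} (hr : IsRetr π inc (stabLine (insert j K) j) r)
    (hT : r (h.lift (pl j) ModularGroup.T) = 0) {x : E} (hx : π x ∈ stabVec (insert j K) j)
    (hx' : π x ∈ stabVec (insert j K) k) :
    r (h.lift (lv hjk) ModularGroup.S * x * (h.lift (lv hjk) ModularGroup.S)⁻¹) = r x := by
  set I := insert j K with hI
  have hjI : j ∈ I := by simp [hI]
  have hkI : k ∈ I := by simp [hI, hk]
  set w := lv hjk ModularGroup.S with hw
  set W := h.lift (lv hjk) ModularGroup.S with hW
  have hπW : π W = w := by rw [hW, h.proj_lift]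
  set P := stabLine I j ⊓ stabLine I k with hP
  have hwI : w ∈ fixer I := lv_mem hjk hjI hkI _
  have hwj : w.1 (e j) = e k := levi_S_e hjk
  have hwk : w.1 (e k) = -e j := levi_S_e' hjk
  have hPw : ∀ p ∈ P, w * p * w⁻¹ ∈ stabLine I j := by
    intro p hp
    refine ⟨mul_mem (mul_mem hwI hp.1.1) (inv_mem hwI), ?_⟩
    have : (w⁻¹).1 (e j) = -e k := by rw [inv_apply_eq, map_neg, hwk, neg_neg]
    rw [mul_apply, mul_apply, this, map_neg, map_neg]
    rcases hp.2.2 with h' | h' <;> simp [h', hwk]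
  let Good : E → Prop := fun x => π x ∈ P ∧ r (W * x * W⁻¹) = r x
  have good_mul : ∀ x y, Good x → Good y → Good (x * y) := by
    rintro x y ⟨hx, hx'⟩ ⟨hy, hy'⟩
    refine ⟨by rw [map_mul]; exact mul_mem hx hy, ?_⟩
    rw [hr.mul _ _ hx.1 hy.1, ← hx', ← hy', ← hr.mul]
    · congr 1; group
    · simpa [hπW] using hPw _ hx
    · simpa [hπW] using hPw _ hy
  have good_of_inverted : ∀ x, π x ∈ P → ∀ g ∈ P, g * g = 1 → g * π x * g = (π x)⁻¹ →
      Good x := by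
    intro x hx g hg hg2 hgx
    refine ⟨hx, ?_⟩
    obtain ⟨ε, rfl, hε⟩ := h.exists_involution hg2
    have hε' : ε⁻¹ = ε := inv_eq_of_mul_eq_one_right hε
    obtain ⟨a, ha⟩ := h.exists_eq_mul (e := ε * x * ε⁻¹) (e' := x⁻¹) (by simpa [hε'] using hgx)
    have h1 := hr.conj hg.1 hx.1
    rw [ha, hr.mul_ι h (by simpa using (stabLine I j).inv_mem hx.1), hr.inv hx.1] at h1
    have hWx : π (W * x * W⁻¹) ∈ stabLine I j := by simpa [hπW] using hPw _ hx
    have hWε : π (W * ε * W⁻¹) ∈ stabLine I j := by simpa [hπW] using hPw _ hg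
    have h2 := hr.conj hWε hWx
    have h3 : W * ε * W⁻¹ * (W * x * W⁻¹) * (W * ε * W⁻¹)⁻¹ = (W * x * W⁻¹)⁻¹ * inc a := by
      calc _ = W * (ε * x * ε⁻¹) * W⁻¹ := by group
        _ = _ := by rw [ha, h.conj_mul]; group
    rw [h3, hr.mul_ι h (by simpa using inv_mem hWx), hr.inv hWx] at h2
    rw [← sub_eq_zero]
    apply CExt.eq_zero_of_add_self
    nth_rewrite 1 [← h2, ← h1]
    abel
  obtain ⟨m, hm, t, q, hq, hpq⟩ := exists_decomp hjI hx.1 hx.2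
  rw [hI, Finset.erase_insert hj] at hm hq
  have hjm : ω (e j) m = 0 := e_ω_lat hj hm
  have hqv := map_mem_lat hq (e_mem_lat hk)
  have h1 := hx'.2
  rw [hpq, mul_apply, nn_apply hjm, e_ω_lat hj hqv] at h1
  simp only [zero_smul, add_zero, mul_zero] at h1
  have hmv : ω m (q.1 (e k)) = 0 := by
    have := congrFun h1 (Sum.inl j)
    simpa [(hqv j hj).1, hjk] using this
  rw [hmv, zero_smul, add_zero] at h1
  rw [h1, ω_e, neg_eq_zero] at hmv
  set n := m (Sum.inl k) with hn
  set m' : Vec ι := m - n • e k with hm'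
  have hm'K : m' ∈ lat (K.erase k) := by
    intro i hi
    by_cases hik : i = k
    · subst hik; simp [hm', hmv, hn]
    · have : i ∉ K := fun h' => hi (Finset.mem_erase.2 ⟨hik, h'⟩)
      simp [hm', hm i this, hik]
  have hKK : lat (K.erase k) ≤ lat K := lat_mono (Finset.erase_subset _ _)
  have hKI : lat K ≤ lat I := lat_mono (Finset.subset_insert _ _)
  have hjk' : ω (e j) (e k) = 0 := by simp
  obtain ⟨m2, hm2, t2, q2, hq2, hq2'⟩ := exists_decomp hk hq h1
  have hkm2 : ω (e k) m2 = 0 := e_ω_lat (by simp) hm2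
  have hjK : j ∉ K.erase k := fun h' => hj (Finset.mem_of_mem_erase h')
  have hkK : k ∉ K.erase k := by simp
  have hjm2 : ω (e j) m2 = 0 := e_ω_lat hjK hm2
  have hjm' : ω (e j) m' = 0 := e_ω_lat hjK hm'K
  have hkm' : ω (e k) m' = 0 := e_ω_lat hkK hm'K
  obtain ⟨x1, hx1⟩ := h.surj (nn (e j) m' 0)
  obtain ⟨x2, hx2⟩ := h.surj (nn (e j) (n • e k) 0)
  obtain ⟨x3, hx3⟩ := h.surj (nn (e k) m2 0)
  obtain ⟨x4, hx4⟩ := h.surj q2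
  set X := h.lift (pl j) (ModularGroup.T ^ t) with hX
  set Y := h.lift (pl k) (ModularGroup.T ^ t2) with hY
  have hXπ : π X = nn (e j) 0 t := by
    rw [hX, h.proj_lift, map_zpow, pl_T, tv_zpow, mul_one, nn_zero]
  have hYπ : π Y = nn (e k) 0 t2 := by
    rw [hY, h.proj_lift, map_zpow, pl_T, tv_zpow, mul_one, nn_zero]
  obtain ⟨a, ha⟩ := h.exists_eq_mul (e := x) (e' := x1 * x2 * X * (x3 * Y * x4)) (by
    simp only [map_mul, hx1, hx2, hx3, hx4, hXπ, hYπ]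
    have c1 : nn (e j) m t = nn (e j) m' 0 * nn (e j) (n • e k) 0 * nn (e j) 0 t := by
      rw [nn_mul hjm' (by simp), nn_mul (by simp [hjm']) (by simp)]
      congr 1
      · simp [hm']
      · simp [(hm'K k hkK).2]
    have c2 : nn (e k) m2 t2 = nn (e k) m2 0 * nn (e k) 0 t2 := by
      rw [nn_mul hkm2 (by simp)]; simp
    rw [hpq, hq2', c1, c2])
  have mem_P : ∀ {p : Sp ι}, p ∈ fixer I → (p.1 (e j) = e j ∨ p.1 (e j) = -e j) →
      (p.1 (e k) = e k ∨ p.1 (e k) = -e k) → p ∈ P := fun h1 h2 h3 => ⟨⟨h1, h2⟩, ⟨h1, h3⟩⟩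
  have zP : ∀ J ⊆ I, z J ∈ P := by
    intro J hJ
    refine mem_P (z_mem hJ) ?_ ?_
    · by_cases h' : j ∈ J
      · exact Or.inr (z_e_neg h')
      · exact Or.inl (z_e h')
    · by_cases h' : k ∈ J
      · exact Or.inr (z_e_neg h')
      · exact Or.inl (z_e h')
  have hzi : ∀ J : Finset ι, (z J)⁻¹ = z J := fun J => inv_eq_of_mul_eq_one_right z_mul_self
  have hKI' : K.erase k ⊆ I := (Finset.erase_subset _ _).trans (Finset.subset_insert _ _)
  have nn_z : ∀ (J : Finset ι) (a b : Vec ι), ω a b = 0 → (z J).1 a = a → (z J).1 b = -b →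
      z J * nn a b 0 * z J = (nn a b 0)⁻¹ := by
    intro J a b hab h1 h2
    nth_rewrite 2 [← hzi]
    rw [conj_nn, h1, h2, nn_inv hab, neg_zero]
  have g1 : Good x1 := by
    refine good_of_inverted x1 ?_ (z (K.erase k)) (zP _ hKI') z_mul_self ?_
    · rw [hx1]
      refine mem_P (nn_mem (e_mem_lat hjI) (hKI (hKK hm'K)) 0) (Or.inl (nn_fix hjm' 0)) (Or.inl ?_)
      rw [nn_apply hjm', hjk', ω_skew, hkm']; simp
    · rw [hx1]; exact nn_z _ _ _ hjm' (z_e hjK) (z_neg subset_rfl hm'K)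
  have g2 : Good x2 := by
    refine good_of_inverted x2 ?_ (z {k}) (zP _ (by simpa using hkI)) z_mul_self ?_
    · rw [hx2]
      refine mem_P (nn_mem (e_mem_lat hjI) (Submodule.smul_mem _ _ (e_mem_lat hkI)) 0)
        (Or.inl (nn_fix (by simp) 0)) (Or.inl ?_)
      rw [nn_apply (by simp)]; simp
    · rw [hx2]
      exact nn_z _ _ _ (by simp) (z_e (by simpa using hjk)) (by rw [map_zsmul, z_e_neg (by simp)]; simp)
  have g3 : Good x3 := by
    refine good_of_inverted x3 ?_ (z (K.erase k)) (zP _ hKI') z_mul_self ?_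
    · rw [hx3]
      refine mem_P (nn_mem (e_mem_lat hkI) (hKI (hKK hm2)) 0) (Or.inl ?_) (Or.inl (nn_fix hkm2 0))
      rw [nn_apply hkm2, ω_skew m2, hjm2, ω_skew, hjk']; simp
    · rw [hx3]; exact nn_z _ _ _ hkm2 (z_e hkK) (z_neg subset_rfl hm2)
  have g4 : Good x4 := by
    refine ⟨?_, ?_⟩
    · rw [hx4]
      exact mem_P (fixer_mono hKI' hq2) (Or.inl (hq2 j hjK).1) (Or.inl (hq2 k hkK).1)
    · have := h.conj_lift (lv hjk) (lv hjk) x4 (fun s => by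
        rw [hx4, conj_levi]
        simp only [(hq2 j hjK).1, (hq2 j hjK).2, (hq2 k hkK).1, (hq2 k hkK).2]) ModularGroup.S
      rw [← hW] at this
      congr 1
      nth_rewrite 1 [← this]
      group
  have hPT : ∀ i : ι, i = j ∨ i = k → ∀ s : ℤ, π (h.lift (pl i) (ModularGroup.T ^ s)) ∈ P := by
    intro i hi s
    have hiI : i ∈ I := by rcases hi with rfl | rfl <;> assumption
    rw [h.proj_lift, map_zpow, pl_T, tv_zpow]
    exact mem_P (tv_mem (e_mem_lat hiI) _) (by simp) (by simp)
  have hrk : ∀ s, r (h.lift (pl k) s) = 0 := hr.sl2 (fun s => by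
    rw [h.proj_lift]
    refine ⟨pl_mem hkI s, Or.inl ?_⟩
    rw [plane_apply]; simp [hjk.symm])
  have hTn : ∀ s : ℤ, r (h.lift (pl j) (ModularGroup.T ^ s)) = 0 := by
    intro s
    rw [map_zpow, hr.zpow (by simpa using (hPT j (Or.inl rfl) 1).1), hT, smul_zero]
  have g5 : Good X := by
    refine ⟨hPT j (Or.inl rfl) t, ?_⟩
    rw [hX, hTn, h.conj_lift (pl j) (pl k) W (fun s => by
      rw [hπW]; exact conj_pl hwj (levi_S_f hjk) s), hrk]
  have g6 : Good Y := by
    refine ⟨hPT k (Or.inr rfl) t2, ?_⟩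
    rw [hY, hrk, h.conj_lift (pl k) (pl j) W (fun s => by
      rw [hπW]; exact conj_pl_neg hwk (levi_S_f' hjk) s), hTn]
  have g := good_mul _ _ (good_mul _ _ (good_mul _ _ g1 g2) g5)
    (good_mul _ _ (good_mul _ _ g3 g6) g4)
  have gi : Good (inc a) := ⟨by simp [h.proj, one_mem], by rw [h.conj_ι]⟩
  rw [ha]
  exact (good_mul _ _ g gi).2

end Symp

/-! ### Retractions over the stabilizer of an isotropic plane -/

namespace Symp

variable {ι : Type*} [Fintype ι] [DecidableEq ι] {E A : Type*} [Group E] [AddCommGroup A]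
  [Module ℚ A] {π : E →* Sp ι} {inc : A → E}

/-- The stabilizer of a coordinate isotropic plane. -/
def stabPlane (I : Finset ι) (j k : ι) : Subgroup (Sp ι) where
  carrier := {p | p ∈ fixer I ∧ ∃ a b c d : ℤ, p.1 (e j) = a • e j + c • e k ∧
    p.1 (e k) = b • e j + d • e k ∧ (a * d - b * c) * (a * d - b * c) = 1}
  mul_mem' := by
    rintro p q ⟨hp, a, b, c, d, h1, h2, h3⟩ ⟨hq, a', b', c', d', h1', h2', h3'⟩
    refine ⟨mul_mem hp hq, a * a' + b * c', a * b' + b * d', c * a' + d * c', c * b' + d * d',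
      ?_, ?_, ?_⟩
    · rw [mul_apply, h1', map_add, map_zsmul, map_zsmul, h1, h2]; module
    · rw [mul_apply, h2', map_add, map_zsmul, map_zsmul, h1, h2]; module
    · linear_combination ((a' * d' - b' * c') * (a' * d' - b' * c')) * h3 + h3'
  one_mem' := ⟨one_mem _, 1, 0, 0, 1, by simp, by simp, by simp⟩
  inv_mem' := by
    rintro p ⟨hp, a, b, c, d, h1, h2, h3⟩
    obtain ⟨D, hD⟩ : ∃ D, D = a * d - b * c := ⟨_, rfl⟩
    rw [← hD] at h3
    have hD' : D * (a * d - b * c) = 1 := by rw [← hD, h3]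
    refine ⟨inv_mem hp, D * d, -(D * b), -(D * c), D * a, ?_, ?_, ?_⟩
    · rw [inv_apply_eq, map_add, map_zsmul, map_zsmul, h1, h2]
      have : (D * d) • (a • e j + c • e k) + (-(D * c)) • (b • e j + d • e k) =
        (D * (a * d - b * c)) • e (ι := ι) j := by module
      rw [this, hD', one_smul]
    · rw [inv_apply_eq, map_add, map_zsmul, map_zsmul, h1, h2]
      have : (-(D * b)) • (a • e j + c • e k) + (D * a) • (b • e j + d • e k) =
        (D * (a * d - b * c)) • e (ι := ι) k := by module
      rw [this, hD', one_smul]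
    · have : D * d * (D * a) - -(D * b) * -(D * c) = D := by linear_combination D * hD'
      rw [this, h3]

/-- The orientation preserving stabilizer of a coordinate isotropic plane. -/
def stabPlanePos (I : Finset ι) {j k : ι} (hjk : j ≠ k) : Subgroup (Sp ι) where
  carrier := {p | p ∈ fixer I ∧ ∃ b : SL2Z, p.1 (e j) = (lv hjk b).1 (e j) ∧
    p.1 (e k) = (lv hjk b).1 (e k)}
  mul_mem' := by
    rintro p q ⟨hp, b, h1, h2⟩ ⟨hq, b', h1', h2'⟩
    have key : ∀ x y : ℤ, p.1 (x • e j + y • e k) = (lv hjk b).1 (x • e j + y • e k) := by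
      intro x y
      rw [map_add, map_add, map_zsmul, map_zsmul, map_zsmul, map_zsmul, h1, h2]
    refine ⟨mul_mem hp hq, b * b', ?_, ?_⟩
    · rw [mul_apply, h1', map_mul, mul_apply]
      nth_rewrite 1 [levi_e hjk b']
      rw [key, ← levi_e hjk b']
    · rw [mul_apply, h2', map_mul, mul_apply]
      nth_rewrite 1 [levi_e' hjk b']
      rw [key, ← levi_e' hjk b']
  one_mem' := ⟨one_mem _, 1, by simp, by simp⟩
  inv_mem' := by
    rintro p ⟨hp, b, h1, h2⟩
    have key : ∀ x y : ℤ, p.1 (x • e j + y • e k) = (lv hjk b).1 (x • e j + y • e k) := by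
      intro x y
      rw [map_add, map_add, map_zsmul, map_zsmul, map_zsmul, map_zsmul, h1, h2]
    refine ⟨inv_mem hp, b⁻¹, ?_, ?_⟩
    · rw [inv_apply_eq, levi_e hjk, key, ← levi_e hjk, ← mul_apply, ← map_mul]; simp
    · rw [inv_apply_eq, levi_e' hjk, key, ← levi_e' hjk, ← mul_apply, ← map_mul]; simp

theorem exists_lv {j k : ι} (hjk : j ≠ k) {p : Sp ι} {I : Finset ι} (hp : p ∈ fixer I)
    {a b c d : ℤ} (h1 : p.1 (e j) = a • e j + c • e k) (h2 : p.1 (e k) = b • e j + d • e k)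
    (hd : a * d - b * c = 1) : p ∈ stabPlanePos I hjk := by
  obtain ⟨M, m1, m2, m3, m4⟩ : ∃ M : SL2Z, M 0 0 = a ∧ M 0 1 = b ∧ M 1 0 = c ∧ M 1 1 = d :=
    ⟨⟨!![a, b; c, d], by rw [Matrix.det_fin_two_of, hd]⟩, rfl, rfl, rfl, rfl⟩
  refine ⟨hp, M, ?_, ?_⟩
  · rw [levi_e hjk, h1, m1, m3]
  · rw [levi_e' hjk, h2, m2, m4]

theorem mem_pos_or {j k : ι} (hjk : j ≠ k) {p : Sp ι} {I : Finset ι} (hk : k ∈ I)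
    (hp : p ∈ stabPlane I j k) : p ∈ stabPlanePos I hjk ∨ z {k} * p ∈ stabPlanePos I hjk := by
  obtain ⟨hpI, a, b, c, d, h1, h2, h3⟩ := hp
  rcases mul_self_eq_one_iff.1 h3 with h3 | h3
  · exact Or.inl (exists_lv hjk hpI h1 h2 h3)
  · have hj : (z {k}).1 (e j) = e j := z_e (by simpa using hjk)
    have hk' : (z {k}).1 (e k) = -e k := z_e_neg (by simp)
    refine Or.inr (exists_lv hjk (mul_mem (z_mem (by simpa using hk)) hpI) (a := a) (b := b)
      (c := -c) (d := -d) ?_ ?_ ?_)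
    · rw [mul_apply, h1, map_add, map_zsmul, map_zsmul, hj, hk']; module
    · rw [mul_apply, h2, map_add, map_zsmul, map_zsmul, hj, hk']; module
    · linear_combination -h3

/-- A retraction over the stabilizer of a line determines one over the stabilizer of an isotropic
plane containing it. -/
theorem exists_retr_stabPlane {h : CExt π inc} {K : Finset ι} {j k : ι} (hj : j ∉ K) (hk : k ∈ K)
    (hjk : j ≠ k) {r : E → A} (hr : IsRetr π inc (stabLine (insert j K) j) r)
    (hT : r (h.lift (pl j) ModularGroup.T) = 0) :
    ∃ r₂, IsRetr π inc (stabPlane (insert j K) j k) r₂ ∧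
      ∀ x, π x ∈ stabLine (insert j K) j → π x ∈ stabPlane (insert j K) j k → r₂ x = r x := by
  set I := insert j K with hI
  have hjI : j ∈ I := by simp [hI]
  have hkI : k ∈ I := by simp [hI, hk]
  set L := h.lift (lv hjk) with hL
  have hπL : ∀ b, π (L b) = lv hjk b := fun b => h.proj_lift _ b
  let N : Subgroup (Sp ι) := stabVec I j ⊓ stabVec I k
  have hN1 : ∀ {p}, p ∈ N → p ∈ stabLine I j := fun hp => stabVec_le I j hp.1
  have mem_N : ∀ {p : Sp ι}, p ∈ fixer I → p.1 (e j) = e j → p.1 (e k) = e k → p ∈ N :=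
    fun h1 h2 h3 => ⟨⟨h1, h2⟩, ⟨h1, h3⟩⟩
  have hNfix : ∀ {p}, p ∈ N → ∀ x y : ℤ, p.1 (x • e j + y • e k) = x • e j + y • e k := by
    intro p hp x y
    rw [map_add, map_zsmul, map_zsmul, hp.1.2, hp.2.2]
  have hNconj : ∀ b, ∀ p ∈ N, lv hjk b * p * (lv hjk b)⁻¹ ∈ N := by
    intro b p hp
    rw [← map_inv]
    refine mem_N (mul_mem (mul_mem (lv_mem hjk hjI hkI _) hp.1.1) (lv_mem hjk hjI hkI _)) ?_ ?_
    · rw [mul_apply, mul_apply, levi_e hjk, hNfix hp, ← levi_e hjk, ← mul_apply, ← map_mul]; simp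
    · rw [mul_apply, mul_apply, levi_e' hjk, hNfix hp, ← levi_e' hjk, ← mul_apply, ← map_mul]; simp
  have hNconj' : ∀ b x, π x ∈ N → π (L b * x * (L b)⁻¹) ∈ N := by
    intro b x hx
    rw [map_mul, map_mul, map_inv, hπL]; exact hNconj b _ hx
  have hTmem : lv hjk ModularGroup.T ∈ stabLine I j := by
    refine ⟨lv_mem hjk hjI hkI _, Or.inl ?_⟩
    rw [levi_e hjk]; simp [ModularGroup.T]
  have hinvar : ∀ b x, π x ∈ N → r (L b * x * (L b)⁻¹) = r x := by
    intro b
    induction b using SL2Pres.induction_ST with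
    | hS => exact fun x hx => retr_conj_weyl hj hk hjk hr hT hx.1 hx.2
    | hT =>
      intro x hx
      exact hr.conj (by rw [hπL]; exact hTmem) (hN1 hx)
    | one => intro x _; simp
    | mul b c hb hc =>
      intro x hx
      rw [← hc x hx, ← hb _ (hNconj' c x hx), map_mul]
      congr 1; group
    | inv b hb =>
      intro x hx
      have := hb _ (hNconj' b⁻¹ x hx)
      rw [← this, map_inv]
      congr 1; group
  have hBex : ∀ x, ∃ b, π x ∈ stabPlanePos I hjk → π (x * (L b)⁻¹) ∈ N := by
    intro x
    by_cases hx : π x ∈ stabPlanePos I hjk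
    · obtain ⟨hxI, b, h1, h2⟩ := hx
      refine ⟨b, fun _ => ?_⟩
      have key : ∀ x' y' : ℤ, (π x).1 (x' • e j + y' • e k) =
          (lv hjk b).1 (x' • e j + y' • e k) := by
        intro x y
        rw [map_add, map_add, map_zsmul, map_zsmul, map_zsmul, map_zsmul, h1, h2]
      rw [map_mul, map_inv, hπL, ← map_inv]
      refine mem_N (mul_mem hxI (lv_mem hjk hjI hkI _)) ?_ ?_
      · rw [mul_apply, levi_e hjk, key, ← levi_e hjk, ← mul_apply, ← map_mul]; simp
      · rw [mul_apply, levi_e' hjk, key, ← levi_e' hjk, ← mul_apply, ← map_mul]; simp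
    · exact ⟨1, fun h' => absurd h' hx⟩
  choose B hB using hBex
  have hlv1 : ∀ b, lv hjk b ∈ N → b = 1 := by
    intro b hb
    have h1 := hb.1.2
    have h2 := hb.2.2
    rw [levi_e hjk] at h1
    rw [levi_e' hjk] at h2
    have e1 := congrFun h1 (Sum.inl j)
    have e2 := congrFun h1 (Sum.inl k)
    have e3 := congrFun h2 (Sum.inl j)
    have e4 := congrFun h2 (Sum.inl k)
    simp [hjk, hjk.symm] at e1 e2 e3 e4
    ext i i'
    fin_cases i <;> fin_cases i' <;> simp [e1, e2, e3, e4]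
  have hBuniq : ∀ x b, π x ∈ stabPlanePos I hjk → π (x * (L b)⁻¹) ∈ N → B x = b := by
    intro x b hx hb
    have h1 := mul_mem (inv_mem hb) (hB x hx)
    have h2 : (π (x * (L b)⁻¹))⁻¹ * π (x * (L (B x))⁻¹) = lv hjk (b * (B x)⁻¹) := by
      rw [← map_inv, ← map_mul, ← hπL, map_mul L, map_inv L]
      congr 1; group
    rw [h2] at h1
    exact (mul_inv_eq_one.1 (hlv1 _ h1)).symm
  have hNpos : N ≤ stabPlanePos I hjk := fun p hp =>
    ⟨hp.1.1, 1, by simp [hp.1.2], by simp [hp.2.2]⟩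
  have hLpos : ∀ b, π (L b) ∈ stabPlanePos I hjk := fun b => by
    rw [hπL]; exact ⟨lv_mem hjk hjI hkI _, b, rfl, rfl⟩
  let rp : E → A := fun x => r (x * (L (B x))⁻¹)
  have rp_N : ∀ x, π x ∈ N → rp x = r x := by
    intro x hx
    have : B x = 1 := hBuniq x 1 (hNpos hx) (by simpa using hx)
    simp [rp, this]
  have hrp : IsRetr π inc (stabPlanePos I hjk) rp := by
    refine ⟨fun x y hx hy => ?_, fun a => ?_⟩
    · have hx' := hB x hx
      have hy' := hB y hy
      have hc := hNconj' (B x) _ hy'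
      have key : x * y * (L (B x * B y))⁻¹ =
          (x * (L (B x))⁻¹) * (L (B x) * (y * (L (B y))⁻¹) * (L (B x))⁻¹) := by
        rw [map_mul]; group
      have hb : B (x * y) = B x * B y := by
        refine hBuniq _ _ (by rw [map_mul]; exact mul_mem hx hy) ?_
        rw [key, map_mul]
        exact mul_mem hx' hc
      change r (x * y * (L (B (x * y)))⁻¹) = _
      rw [hb, key, hr.mul _ _ (hN1 hx') (hN1 hc), hinvar _ _ hy']
    · rw [rp_N _ (by simp [h.proj, one_mem]), hr.inc]
  have hrpL : ∀ b, rp (L b) = 0 := hrp.sl2 hLpos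
  obtain ⟨ε, hε, hε2⟩ := h.exists_involution (z_mul_self (I := {k}))
  have hε' : ε⁻¹ = ε := inv_eq_of_mul_eq_one_right hε2
  have hzj : (z {k}).1 (e j) = e j := z_e (by simpa using hjk)
  have hzk : (z {k}).1 (e k) = -e k := z_e_neg (by simp)
  have hzI : z {k} ∈ fixer I := z_mem (by simpa using hkI)
  have hε1 : π ε ∈ stabLine I j := by rw [hε]; exact ⟨hzI, Or.inl hzj⟩
  have hεpos : ∀ p ∈ stabPlanePos I hjk, π ε * p * π ε ∈ stabPlanePos I hjk := by
    rintro p ⟨hp, b, h1, h2⟩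
    rw [levi_e hjk] at h1
    rw [levi_e' hjk] at h2
    have hd := b.det_coe
    rw [Matrix.det_fin_two] at hd
    rw [hε]
    refine exists_lv hjk (mul_mem (mul_mem hzI hp) hzI) (a := b 0 0) (b := -b 0 1) (c := -b 1 0)
      (d := b 1 1) ?_ ?_ ?_
    · rw [mul_apply, mul_apply, hzj, h1, map_add, map_zsmul, map_zsmul, hzj, hzk]; module
    · rw [mul_apply, mul_apply, hzk, map_neg, h2, map_neg, map_add, map_zsmul, map_zsmul, hzj, hzk]
      module
    · linear_combination hd
  have hεN : ∀ p ∈ N, π ε * p * π ε ∈ N := by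
    intro p hp
    rw [hε]
    refine mem_N (mul_mem (mul_mem hzI hp.1.1) hzI) ?_ ?_
    · rw [mul_apply, mul_apply, hzj, hp.1.2, hzj]
    · rw [mul_apply, mul_apply, hzk, map_neg, hp.2.2, map_neg, hzk, neg_neg]
  have hrpε : ∀ b, rp (ε * L b * ε) = 0 := by
    intro b
    have := hrp.sl2 (φ := (MulAut.conj ε).toMonoidHom.comp L) (fun b => by
      have := hεpos _ (hLpos b)
      rw [← map_mul, ← map_mul] at this
      simpa [hε', mul_assoc] using this) b
    simpa [hε', mul_assoc] using this
  obtain ⟨r₂, hr₂, hr₂1, hr₂2⟩ := hrp.exists_extend h (K' := stabPlane I j k) hε2 hεpos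
    (fun p hp => by rw [hε]; exact mem_pos_or hjk hkI hp)
    (fun x hx => by
      have h1 := hB x hx
      have h2 := hεN _ h1
      rw [← map_mul, ← map_mul] at h2
      have h3 : ε * x * ε = (ε * (x * (L (B x))⁻¹) * ε) * (ε * L (B x) * ε) := by
        have : ε * (x * (L (B x))⁻¹) * ε * (ε * L (B x) * ε) =
          ε * (x * (L (B x))⁻¹) * (ε * ε) * (L (B x) * ε) := by group
        rw [this, hε2]; group
      have h4 := hεpos _ (hLpos (B x))
      rw [← map_mul, ← map_mul] at h4
      have h5 : r (ε * (x * (L (B x))⁻¹) * ε) = r (x * (L (B x))⁻¹) := by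
        nth_rewrite 2 [← hε']
        exact hr.conj hε1 (hN1 h1)
      rw [h3, hrp.mul _ _ (hNpos h2) h4, hrpε, add_zero, rp_N _ h2, h5])
  have hLT : r (L ModularGroup.T) = 0 := by
    have hzi : (z ({k} : Finset ι))⁻¹ = z {k} := inv_eq_of_mul_eq_one_right z_mul_self
    obtain ⟨a, ha⟩ := h.exists_eq_mul (e := ε * L ModularGroup.T * ε) (e' := L ModularGroup.T⁻¹) (by
      rw [map_mul, map_mul, hε, hπL, hπL]
      nth_rewrite 2 [← hzi]
      rw [conj_levi]
      refine ext fun x => ?_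
      rw [levi_apply, levi_apply]
      have hfj : (z {k}).1 (f j) = f j := z_f (by simpa using hjk)
      have hfk : (z {k}).1 (f k) = -f k := z_f_neg (by simp)
      rw [hzj, hzk, hfj, hfk]
      have t1 : (ModularGroup.T⁻¹ : SL2Z) 0 0 = 1 := by rw [ModularGroup.coe_T_inv]; rfl
      have t2 : (ModularGroup.T⁻¹ : SL2Z) 0 1 = -1 := by rw [ModularGroup.coe_T_inv]; rfl
      have t3 : (ModularGroup.T⁻¹ : SL2Z) 1 0 = 0 := by rw [ModularGroup.coe_T_inv]; rfl
      have t4 : (ModularGroup.T⁻¹ : SL2Z) 1 1 = 1 := by rw [ModularGroup.coe_T_inv]; rfl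
      rw [t1, t2, t3, t4]
      simp [ModularGroup.T])
    have h1 := hrpε ModularGroup.T
    rw [ha, hrp.mul_ι h (hLpos _), hrpL, zero_add] at h1
    rw [h1, h.zero, mul_one] at ha
    have hTm : π (L ModularGroup.T) ∈ stabLine I j := by rw [hπL]; exact hTmem
    have h2 := hr.conj hε1 hTm
    rw [hε', ha, map_inv, hr.inv hTm] at h2
    apply CExt.eq_zero_of_add_self
    nth_rewrite 1 [← h2]
    simp
  have hagree : ∀ x, π x ∈ stabLine I j → π x ∈ stabPlanePos I hjk → rp x = r x := by
    intro x hx1 hx2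
    have hx' := hB x hx2
    obtain ⟨b, hb⟩ : ∃ b, b = B x := ⟨_, rfl⟩
    have e1 : (π x).1 (e j) = b 0 0 • e j + b 1 0 • e k := by
      have : x = x * (L b)⁻¹ * L b := by group
      rw [this, map_mul, mul_apply, hπL, levi_e hjk, hNfix (by rw [hb]; exact hx')]
    have hc0 : b 1 0 = 0 := by
      have e2 := congrFun e1 (Sum.inl k)
      rcases hx1.2 with h' | h' <;> rw [h'] at e2 <;> simpa [hjk, hjk.symm] using e2.symm
    have hd := b.det_coe
    rw [Matrix.det_fin_two, hc0, mul_zero, sub_zero] at hd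
    have hLTn : ∀ n : ℤ, π (L (ModularGroup.T ^ n)) ∈ stabLine I j := fun n => by
      rw [map_zpow, map_zpow, hπL]; exact zpow_mem hTmem n
    have hLTn' : ∀ n : ℤ, r (L (ModularGroup.T ^ n)) = 0 := fun n => by
      rw [map_zpow, hr.zpow (by rw [hπL]; exact hTmem), hLT, smul_zero]
    have hSmem : π (L (ModularGroup.S ^ 2)) ∈ stabLine I j := by
      rw [hπL]
      refine ⟨lv_mem hjk hjI hkI _, Or.inr ?_⟩
      rw [pow_two, map_mul, mul_apply, levi_S_e hjk, levi_S_e' hjk]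
    have hSr : r (L (ModularGroup.S ^ 2)) = 0 := by
      refine hr.torsion hSmem (CExt.isOfFinOrder_of_pow (n := 2) (by norm_num) ?_)
      rw [← map_pow, ← pow_mul, SL2Pres.S_pow_four, map_one]
    have hLb : π (L b) ∈ stabLine I j ∧ r (L b) = 0 := by
      rcases Int.mul_eq_one_iff_eq_one_or_neg_one.1 hd with ⟨ha, hd'⟩ | ⟨ha, hd'⟩
      · have : b = ModularGroup.T ^ (b 0 1) := by
          ext i i'
          rw [ModularGroup.coe_T_zpow]
          fin_cases i <;> fin_cases i' <;> simp [ha, hd', hc0]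
        rw [this]; exact ⟨hLTn _, hLTn' _⟩
      · have : b = ModularGroup.S ^ 2 * ModularGroup.T ^ (-b 0 1) := by
          rw [SL2Pres.S_sq]
          ext i i'
          rw [Matrix.SpecialLinearGroup.coe_mul, ModularGroup.coe_T_zpow]
          fin_cases i <;> fin_cases i' <;> simp [ha, hd', hc0]
        rw [this, map_mul, hr.mul _ _ hSmem (hLTn _), hSr, hLTn', map_mul]
        exact ⟨mul_mem hSmem (hLTn _), add_zero _⟩
    have h3 : x = x * (L b)⁻¹ * L b := by group
    change r (x * (L (B x))⁻¹) = r x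
    rw [← hb] at hx' ⊢
    conv_rhs => rw [h3, hr.mul _ _ (hN1 hx') hLb.1, hLb.2, add_zero]
  refine ⟨r₂, hr₂, fun x hx1 hx2 => ?_⟩
  rcases mem_pos_or hjk hkI hx2 with h' | h'
  · rw [hr₂1 x h', hagree x hx1 h']
  · rw [← hε] at h'
    rw [hr₂2 x h', hagree _ (by rw [map_mul]; exact mul_mem hε1 hx1) (by rwa [map_mul]),
      hr.mul _ _ hε1 hx1, hr.torsion hε1 (CExt.isOfFinOrder_of_pow (n := 2) (by norm_num)
        (by rw [pow_two, hε2])), zero_add]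

end Symp

/-! ### The connection on the orthogonality graph -/

namespace Symp

variable {ι : Type*} [Fintype ι] [DecidableEq ι]

theorem e_ne_zero (j : ι) : e j ≠ 0 := fun h => by simpa using congrFun h (Sum.inl j)

theorem mem_stabLine_of_smul {I : Finset ι} {j : ι} {g g' : Sp ι} (hg : g ∈ fixer I)
    (hg' : g' ∈ fixer I) {a b : ℤ} (ha : a ≠ 0) (h : a • g.1 (e j) = b • g'.1 (e j)) :
    g⁻¹ * g' ∈ stabLine I j := by
  obtain ⟨n, hn⟩ : ∃ n, a = b * n := by
    refine ⟨ω (g'.1 (e j)) (g.1 (f j)), ?_⟩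
    have := congrArg (fun x => ω x (g.1 (f j))) h
    simpa [-ω_f, ω_e_f] using this
  obtain ⟨m, hm⟩ : ∃ m, b = a * m := by
    refine ⟨ω (g.1 (e j)) (g'.1 (f j)), ?_⟩
    have := congrArg (fun x => ω x (g'.1 (f j))) h
    simpa [-ω_f, ω_e_f] using this.symm
  have hmn : m * n = 1 := by
    apply mul_left_cancel₀ ha
    rw [mul_one, ← mul_assoc, ← hm, ← hn]
  have key : g.1 (e j) = m • g'.1 (e j) := by
    rw [hm, mul_smul] at h
    funext s
    exact mul_left_cancel₀ ha (by simpa using congrFun h s)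
  refine ⟨mul_mem (inv_mem hg) hg', ?_⟩
  rw [mul_apply, inv_apply_eq, inv_apply_eq, map_neg, key]
  rcases Int.mul_eq_one_iff_eq_one_or_neg_one.1 hmn with ⟨h1, _⟩ | ⟨h1, _⟩ <;> simp [h1]

theorem eq_span_of_smul {j k : ι} (hjk : j ≠ k) {x : Vec ι} {c α β : ℤ} (hc : c ≠ 0)
    (h : c • x = α • e j + β • e k) : x = x (Sum.inl j) • e j + x (Sum.inl k) • e k := by
  have hs : ∀ s, c * x s = α * e j s + β * e k s := fun s => by simpa using congrFun h s
  funext s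
  rcases s with i | i
  · by_cases h1 : i = j
    · subst h1; simp [hjk]
    · by_cases h2 : i = k
      · subst h2; simp [h1]
      · have := hs (Sum.inl i)
        simp [h1, h2, hc] at this
        simp [h1, h2, this]
  · have := hs (Sum.inr i)
    simp [hc] at this
    simp [this]

theorem mem_stabPlane_of_smul {I : Finset ι} {j k : ι} (hjk : j ≠ k) {p : Sp ι}
    (hp : p ∈ stabLine I j) {c α β : ℤ} (hc : c ≠ 0) (h : c • p.1 (e k) = α • e j + β • e k) :
    p ∈ stabPlane I j k := by
  have h1 := eq_span_of_smul hjk hc h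
  set γ := (p.1 (e k)) (Sum.inl j)
  set δ := (p.1 (e k)) (Sum.inl k)
  have h0 : ω (e j) (p.1 (f k)) = 0 := by
    have h2 : ω (p.1 (e j)) (p.1 (f k)) = 0 := by simp [-ω_f, e_ω, hjk]
    rcases hp.2 with h' | h' <;> rw [h'] at h2
    · exact h2
    · simpa using h2
  have hδ : δ * ω (e k) (p.1 (f k)) = 1 := by
    have h2 : ω (p.1 (e k)) (p.1 (f k)) = 1 := by rw [ω_map, ω_e_f]
    rw [h1, map_add, LinearMap.add_apply, map_smul, map_smul, LinearMap.smul_apply,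
      LinearMap.smul_apply, h0] at h2
    simpa using h2
  have hδ2 : δ * δ = 1 := by
    rcases Int.mul_eq_one_iff_eq_one_or_neg_one.1 hδ with ⟨h1, _⟩ | ⟨h1, _⟩ <;> simp [h1]
  rcases hp.2 with h' | h'
  · exact ⟨hp.1, 1, γ, 0, δ, by simp [h'], h1, by simpa using hδ2⟩
  · exact ⟨hp.1, -1, γ, 0, δ, by simp [h'], h1, by simpa using hδ2⟩

theorem lv_mem_stabPlane {I : Finset ι} {j k : ι} (hjk : j ≠ k) (hj : j ∈ I) (hk : k ∈ I)
    (b : SL2Z) : lv hjk b ∈ stabPlane I j k := by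
  have hd := b.det_coe
  rw [Matrix.det_fin_two] at hd
  exact ⟨lv_mem hjk hj hk b, b 0 0, b 0 1, b 1 0, b 1 1, levi_e hjk b, levi_e' hjk b, by
    rw [hd, one_mul]⟩

theorem exists_plane_factor {I : Finset ι} {j k : ι} (hjk : j ≠ k) (hj : j ∈ I) (hk : k ∈ I)
    {g : Sp ι} (hg : g ∈ fixer I) {a b : ℤ} (h : g.1 (e j) = a • e j + b • e k) :
    ∃ s ∈ stabPlane I j k, s⁻¹ * g ∈ stabLine I j := by
  obtain ⟨c, m, ha, hb⟩ := exists_column a b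
  refine ⟨lv hjk m, lv_mem_stabPlane hjk hj hk m, ?_⟩
  have h1 : g.1 (e j) = c • (lv hjk m).1 (e j) := by
    rw [h, levi_e hjk, ha, hb]; module
  have hc : c ≠ 0 := by
    rintro rfl
    rw [zero_smul] at h1
    exact map_ne_zero g (e_ne_zero j) h1
  exact mem_stabLine_of_smul (lv_mem hjk hj hk m) hg hc (b := 1) (by rw [one_smul, h1])

theorem exists_factor {K : Finset ι} {j k : ι} (hj : j ∉ K) (hk : k ∈ K) {g : Sp ι}
    (hg : g ∈ fixer (insert j K)) (h : ω (g.1 (e j)) (e j) = 0) :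
    ∃ t ∈ stabLine (insert j K) j, ∃ s ∈ stabPlane (insert j K) j k,
      ∃ t' ∈ stabLine (insert j K) j, g = t * s * t' := by
  have hjI : j ∈ insert j K := by simp
  have hjk : j ≠ k := by rintro rfl; exact hj hk
  set x := g.1 (e j) with hx
  have hxI := map_mem_lat hg (e_mem_lat hjI)
  have hm : x - x (Sum.inl j) • e j ∈ lat K := by
    intro i hi
    by_cases hij : i = j
    · subst hij; simpa using h
    · have := hxI i (by simp [hij, hi])
      rw [← hx] at this
      simp [this, hij]
  obtain ⟨q, -, hq, γ, hγ⟩ := exists_translate ⊤ (by simp) (by simp) hk hm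
  have hqI : q ∈ fixer (insert j K) := fixer_mono (Finset.subset_insert _ _) hq
  have hqj : q.1 (e j) = e j := (hq j hj).1
  have h1 : (q⁻¹ * g).1 (e j) = x (Sum.inl j) • e j + γ • e k := by
    rw [mul_apply, inv_apply_eq, map_add, map_zsmul, map_zsmul, hqj, ← hγ, ← hx]; abel
  obtain ⟨s, hs, hs'⟩ := exists_plane_factor hjk hjI (by simp [hk]) (mul_mem (inv_mem hqI) hg) h1
  exact ⟨q, ⟨hqI, Or.inl hqj⟩, s, hs, _, hs', by group⟩

end Symp

/-! ### Extending retractions from parabolic subgroups -/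

namespace Symp

variable {ι : Type*} [Fintype ι] [DecidableEq ι] {E A : Type*} [Group E] [AddCommGroup A]
  {π : E →* Sp ι} {inc : A → E}

/-- Compatible retractions over the stabilizers of a line and of an isotropic plane containing
it. -/
structure ConnData (h : CExt π inc) (I : Finset ι) (j k : ι) (r₁ r₂ : E → A) : Prop where
  jI : j ∈ I
  kI : k ∈ I
  ne : j ≠ k
  fac : ∀ g ∈ fixer I, ω (g.1 (e j)) (e j) = 0 →
    ∃ t ∈ stabLine I j, ∃ s ∈ stabPlane I j k, ∃ t' ∈ stabLine I j, g = t * s * t'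
  retr₁ : IsRetr π inc (stabLine I j) r₁
  retr₂ : IsRetr π inc (stabPlane I j k) r₂
  agree : ∀ x, π x ∈ stabLine I j → π x ∈ stabPlane I j k → r₂ x = r₁ x

namespace ConnData

variable {h : CExt π inc} {I : Finset ι} {j k : ι} {r₁ r₂ : E → A}

theorem swap (D : ConnData h I j k r₁ r₂) {p p' s s' : E} (hp : π p ∈ stabLine I j)
    (hp' : π p' ∈ stabLine I j) (hs : π s ∈ stabPlane I j k) (hs' : π s' ∈ stabPlane I j k)
    (hps : p * s = s' * p') : r₁ p + r₂ s = r₂ s' + r₁ p' := by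
  obtain ⟨hsI, a, b, c, d, h1, h2, h3⟩ := id hs
  obtain ⟨hsI', a', b', c', d', h1', h2', h3'⟩ := id hs'
  by_cases hc : c = 0
  · have ha : a * a = 1 := by
      rw [hc] at h3
      have : a * (a * (d * d)) = 1 := by linear_combination h3
      rcases Int.mul_eq_one_iff_eq_one_or_neg_one.1 this with ⟨h', _⟩ | ⟨h', _⟩ <;> simp [h']
    have hs1 : π s ∈ stabLine I j := by
      refine ⟨hsI, ?_⟩
      rw [h1, hc]
      rcases Int.mul_eq_one_iff_eq_one_or_neg_one.1 ha with ⟨h', _⟩ | ⟨h', _⟩ <;> simp [h']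
    have hs1' : π s' ∈ stabLine I j := by
      have : s' = p * s * p'⁻¹ := by rw [hps]; group
      rw [this, map_mul, map_mul, map_inv]
      exact mul_mem (mul_mem hp hs1) (inv_mem hp')
    rw [D.agree s hs1 hs, D.agree s' hs1' hs', ← D.retr₁.mul _ _ hp hs1,
      ← D.retr₁.mul _ _ hs1' hp', hps]
  · have e1 : (π p).1 ((π s).1 (e j)) = (π s').1 ((π p').1 (e j)) := by
      rw [← mul_apply, ← mul_apply, ← map_mul, ← map_mul, hps]
    obtain ⟨η, hη⟩ : ∃ η : ℤ, (π p).1 (e j) = η • e j := by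
      rcases hp.2 with h' | h'
      · exact ⟨1, by simp [h']⟩
      · exact ⟨-1, by simp [h']⟩
    obtain ⟨η', hη'⟩ : ∃ η : ℤ, (π p').1 (e j) = η • e j := by
      rcases hp'.2 with h' | h'
      · exact ⟨1, by simp [h']⟩
      · exact ⟨-1, by simp [h']⟩
    rw [h1, hη', map_add, map_zsmul, map_zsmul, map_zsmul, h1', hη] at e1
    have hpQ : π p ∈ stabPlane I j k := by
      refine mem_stabPlane_of_smul D.ne hp hc (α := η' * a' - a * η) (β := η' * c') ?_
      rw [← sub_eq_zero] at e1 ⊢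
      rw [← e1]; module
    have hpQ' : π p' ∈ stabPlane I j k := by
      have : p' = s'⁻¹ * (p * s) := by rw [hps]; group
      rw [this, map_mul, map_mul, map_inv]
      exact mul_mem (inv_mem hs') (mul_mem hpQ hs)
    rw [← D.agree p hp hpQ, ← D.agree p' hp' hpQ', ← D.retr₂.mul _ _ hpQ hs,
      ← D.retr₂.mul _ _ hs' hpQ', hps]

theorem exists_conn (D : ConnData h I j k r₁ r₂) : ∃ C : E → A, ∀ t s t', π t ∈ stabLine I j →
    π s ∈ stabPlane I j k → π t' ∈ stabLine I j → C (t * s * t') = r₁ t + r₂ s + r₁ t' := by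
  classical
  have key : ∀ x, ∃ a, ∀ t s t', π t ∈ stabLine I j → π s ∈ stabPlane I j k →
      π t' ∈ stabLine I j → x = t * s * t' → a = r₁ t + r₂ s + r₁ t' := by
    intro x
    by_cases hx : ∃ t s t', π t ∈ stabLine I j ∧ π s ∈ stabPlane I j k ∧
      π t' ∈ stabLine I j ∧ x = t * s * t'
    · obtain ⟨t, s, t', ht, hs, ht', rfl⟩ := hx
      refine ⟨r₁ t + r₂ s + r₁ t', fun u v u' hu hv hu' huv => ?_⟩
      have hp : π (u⁻¹ * t) ∈ stabLine I j := by
        rw [map_mul, map_inv]; exact mul_mem (inv_mem hu) ht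
      have hp' : π (u' * t'⁻¹) ∈ stabLine I j := by
        rw [map_mul, map_inv]; exact mul_mem hu' (inv_mem ht')
      have := D.swap hp hp' hs hv (by
        have : u⁻¹ * t * s = u⁻¹ * (t * s * t') * t'⁻¹ := by group
        rw [this, huv]; group)
      have h1 : r₁ t = r₁ u + r₁ (u⁻¹ * t) := by rw [← D.retr₁.mul _ _ hu hp]; congr 1; group
      have h2 : r₁ u' = r₁ (u' * t'⁻¹) + r₁ t' := by
        rw [← D.retr₁.mul _ _ hp' ht']; congr 1; group
      rw [h1, h2, add_assoc (r₁ u), this]; abel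
    · refine ⟨0, fun t s t' ht hs ht' hx' => ?_⟩
      exact absurd ⟨t, s, t', ht, hs, ht', hx'⟩ hx
  choose C hC using key
  exact ⟨C, fun t s t' ht hs ht' => hC _ t s t' ht hs ht' rfl⟩

theorem exists_fac (D : ConnData h I j k r₁ r₂) {x : E} (hx : π x ∈ fixer I)
    (h0 : ω ((π x).1 (e j)) (e j) = 0) : ∃ t s t', π t ∈ stabLine I j ∧ π s ∈ stabPlane I j k ∧
      π t' ∈ stabLine I j ∧ x = t * s * t' := by
  obtain ⟨t, ht, s, hs, t', ht', hx'⟩ := D.fac _ hx h0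
  obtain ⟨t, rfl⟩ := h.surj t
  obtain ⟨s, rfl⟩ := h.surj s
  refine ⟨t, s, (t * s)⁻¹ * x, ht, hs, ?_, by group⟩
  rwa [map_mul, hx', map_inv, map_mul, inv_mul_cancel_left]

theorem conn_mul {C : E → A} (D : ConnData h I j k r₁ r₂)
    (hC : ∀ t s t', π t ∈ stabLine I j → π s ∈ stabPlane I j k → π t' ∈ stabLine I j →
      C (t * s * t') = r₁ t + r₂ s + r₁ t')
    {x p p' : E} (hx : π x ∈ fixer I) (h0 : ω ((π x).1 (e j)) (e j) = 0)
    (hp : π p ∈ stabLine I j) (hp' : π p' ∈ stabLine I j) :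
    C (p * x * p') = r₁ p + C x + r₁ p' := by
  obtain ⟨t, s, t', ht, hs, ht', rfl⟩ := D.exists_fac hx h0
  have : p * (t * s * t') * p' = (p * t) * s * (t' * p') := by group
  rw [this, hC _ _ _ ht hs ht', hC _ _ _ (by rw [map_mul]; exact mul_mem hp ht) hs
    (by rw [map_mul]; exact mul_mem ht' hp'), D.retr₁.mul _ _ hp ht, D.retr₁.mul _ _ ht' hp']
  abel

theorem conn_line {C : E → A} (D : ConnData h I j k r₁ r₂)
    (hC : ∀ t s t', π t ∈ stabLine I j → π s ∈ stabPlane I j k → π t' ∈ stabLine I j →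
      C (t * s * t') = r₁ t + r₂ s + r₁ t')
    {x : E} (hx : π x ∈ stabLine I j) : C x = r₁ x := by
  have := hC x 1 1 hx (by simp [one_mem]) (by simp [one_mem])
  rw [D.retr₁.one, D.retr₂.one] at this
  simpa using this

theorem conn_inv {C : E → A} (D : ConnData h I j k r₁ r₂)
    (hC : ∀ t s t', π t ∈ stabLine I j → π s ∈ stabPlane I j k → π t' ∈ stabLine I j →
      C (t * s * t') = r₁ t + r₂ s + r₁ t')
    {x : E} (hx : π x ∈ fixer I) (h0 : ω ((π x).1 (e j)) (e j) = 0) :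
    C x⁻¹ = -C x := by
  obtain ⟨t, s, t', ht, hs, ht', rfl⟩ := D.exists_fac hx h0
  have : (t * s * t')⁻¹ = t'⁻¹ * s⁻¹ * t⁻¹ := by group
  rw [this, hC _ _ _ ht hs ht', hC _ _ _ (by rw [map_inv]; exact inv_mem ht')
    (by rw [map_inv]; exact inv_mem hs) (by rw [map_inv]; exact inv_mem ht), D.retr₁.inv ht,
    D.retr₁.inv ht', D.retr₂.inv hs]
  abel

theorem conn_dep {C : E → A} (D : ConnData h I j k r₁ r₂)
    (hC : ∀ t s t', π t ∈ stabLine I j → π s ∈ stabPlane I j k → π t' ∈ stabLine I j →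
      C (t * s * t') = r₁ t + r₂ s + r₁ t')
    {x y : E} (hx : π x ∈ fixer I) (hy : π y ∈ fixer I)
    (h0 : ω ((π x).1 (e j)) (e j) = 0) (h1 : ω ((π y).1 (e j)) (e j) = 0)
    {α β γ : ℤ} (hαβγ : α ≠ 0 ∨ β ≠ 0 ∨ γ ≠ 0)
    (hd : α • e j + β • (π x).1 (e j) + γ • (π (x * y)).1 (e j) = 0) :
    C x + C y = C (x * y) := by
  by_cases hxP : π x ∈ stabLine I j
  · have := D.conn_mul hC hy h1 hxP (p' := 1) (by simp [one_mem])
    rw [mul_one, D.retr₁.one, add_zero] at this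
    rw [this, D.conn_line hC hxP]
  obtain ⟨t, s, t', ht, hs, ht', hfac⟩ := D.exists_fac hx h0
  obtain ⟨hsI, a, b, c, d, hs1, hs2, hs3⟩ := id hs
  obtain ⟨η, hη⟩ : ∃ η : ℤ, (π t').1 (e j) = η • e j := by
    rcases ht'.2 with h' | h'
    · exact ⟨1, by simp [h']⟩
    · exact ⟨-1, by simp [h']⟩
  obtain ⟨η', hη'⟩ : ∃ η : ℤ, ((π t)⁻¹).1 (e j) = η • e j := by
    rcases (inv_mem ht).2 with h' | h'
    · exact ⟨1, by rw [h', one_smul]⟩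
    · exact ⟨-1, by rw [h', neg_one_smul]⟩
  have hγ : γ ≠ 0 := by
    rintro rfl
    rw [zero_smul, add_zero] at hd
    have hβ : β ≠ 0 := by
      rintro rfl
      rw [zero_smul, add_zero] at hd
      have := congrFun hd (Sum.inl j)
      simp at this
      simp [this] at hαβγ
    have := mem_stabLine_of_smul (j := j) hx (one_mem (fixer I)) hβ (b := -α) (by
      rw [one_apply, ← sub_eq_zero, ← hd]; module)
    rw [mul_one] at this
    exact hxP (inv_mem_iff.1 this)
  have htxy : π (t⁻¹ * (x * y)) ∈ fixer I := by
    rw [map_mul, map_mul, map_inv]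
    exact mul_mem (inv_mem ht.1) (mul_mem hx hy)
  have hv : γ • (π (t⁻¹ * (x * y))).1 (e j) =
      (-(α * η') - β * η * a) • e j + (-(β * η * c)) • e k := by
    have h2 := congrArg ((π t)⁻¹).1 hd
    rw [map_add, map_add, map_zsmul, map_zsmul, map_zsmul, map_zero, hη', hfac] at h2
    simp only [map_mul, mul_apply, inv_apply_self, hη, map_zsmul, hs1] at h2
    rw [hfac]
    simp only [map_mul, mul_apply, map_inv, inv_apply_self]
    rw [← sub_eq_zero, ← h2]; module
  obtain ⟨s₂, hs₂, hp⟩ := exists_plane_factor D.ne D.jI D.kI htxy (eq_span_of_smul D.ne hγ hv)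
  obtain ⟨s₂, rfl⟩ := h.surj s₂
  rw [← map_inv, ← map_mul] at hp
  have e1 : x * y = t * s₂ * (s₂⁻¹ * (t⁻¹ * (x * y))) := by group
  have e2 : y = t'⁻¹ * (s⁻¹ * s₂) * (s₂⁻¹ * (t⁻¹ * (x * y))) := by
    rw [hfac]; group
  have hss : π (s⁻¹ * s₂) ∈ stabPlane I j k := by
    rw [map_mul, map_inv]; exact mul_mem (inv_mem hs) hs₂
  have c1 := hC _ _ _ ht hs₂ hp
  have c2 := hC _ _ _ (by rw [map_inv]; exact inv_mem ht') hss hp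
  rw [← e1] at c1
  rw [← e2, D.retr₁.inv ht', D.retr₂.mul _ _ (by rw [map_inv]; exact inv_mem hs) hs₂,
    D.retr₂.inv hs] at c2
  have c3 := hC _ _ _ ht hs ht'
  rw [← hfac] at c3
  rw [c1, c2, c3]; abel

end ConnData

end Symp

namespace Symp

variable {ι : Type*} [Fintype ι] [DecidableEq ι] {E A : Type*} [Group E] [AddCommGroup A]
  [Module ℚ A] {π : E →* Sp ι} {inc : A → E}

/-- Compatible retractions over two parabolic subgroups extend. -/
theorem ConnData.exists_retr {h : CExt π inc} {I : Finset ι} {j k : ι} {r₁ r₂ : E → A}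
    (D : ConnData h I j k r₁ r₂) : ∃ r, IsRetr π inc (fixer I) r := by
  obtain ⟨C, hC⟩ := D.exists_conn
  have hex : ∀ x : Vec ι, ∃ y : E, x ∈ lat I → x ≠ 0 →
      π y ∈ fixer I ∧ ∃ c : ℤ, c ≠ 0 ∧ x = c • (π y).1 (e j) := by
    intro x
    by_cases hx : x ∈ lat I
    · obtain ⟨q, -, hq, c, hc⟩ := exists_translate ⊤ (by simp) (by simp) D.jI hx
      obtain ⟨y, rfl⟩ := h.surj q
      refine ⟨y, fun _ h0 => ⟨hq, c, ?_, hc⟩⟩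
      rintro rfl
      exact h0 (by simpa using hc)
    · exact ⟨1, fun h' => absurd h' hx⟩
  choose s hs using hex
  have hsF : ∀ x ∈ lat I, x ≠ 0 → π (s x) ∈ fixer I := fun x hx h0 => (hs x hx h0).1
  have hsum : ∀ {x y}, x ∈ lat I → y ∈ lat I → x ≠ 0 → y ≠ 0 →
      π ((s x)⁻¹ * s y) ∈ fixer I := by
    intro x y hx hy hx0 hy0
    rw [map_mul, map_inv]
    exact mul_mem (inv_mem (hsF x hx hx0)) (hsF y hy hy0)
  have horth : ∀ {x y}, x ∈ lat I → y ∈ lat I → x ≠ 0 → y ≠ 0 → ω x y = 0 →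
      ω ((π ((s x)⁻¹ * s y)).1 (e j)) (e j) = 0 := by
    intro x y hx hy hx0 hy0 hxy
    obtain ⟨c, hc, hcx⟩ := (hs x hx hx0).2
    obtain ⟨d, hd, hdy⟩ := (hs y hy hy0).2
    rw [hcx, hdy, map_smul, map_smul, LinearMap.smul_apply, smul_eq_mul, smul_eq_mul] at hxy
    rw [map_mul, map_inv, mul_apply, ← ω_map (π (s x)), apply_inv_self, ω_skew]
    simpa [hc, hd, -ω_map] using hxy
  let c : Vec ι → Vec ι → A := fun x y => C ((s x)⁻¹ * s y)
  let φ : E → Vec ι → A := fun q x => r₁ ((s ((π q).1 x))⁻¹ * q * s x)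
  have hφm : ∀ q x, π q ∈ fixer I → x ∈ lat I → x ≠ 0 →
      π ((s ((π q).1 x))⁻¹ * q * s x) ∈ stabLine I j := by
    intro q x hq hx hx0
    have hqx := map_mem_lat hq hx
    have hqx0 := map_ne_zero (π q) hx0
    obtain ⟨a, ha, hax⟩ := (hs x hx hx0).2
    obtain ⟨b, hb, hbx⟩ := (hs _ hqx hqx0).2
    have := mem_stabLine_of_smul (j := j) (hsF _ hqx hqx0) (mul_mem hq (hsF _ hx hx0)) hb (b := a)
      (by rw [← hbx, mul_apply]; nth_rewrite 1 [hax]; rw [map_zsmul])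
    rw [map_mul, map_mul, map_inv, mul_assoc]; exact this
  have hinv : ∀ q x y, π q ∈ fixer I → x ∈ lat I → y ∈ lat I → x ≠ 0 → y ≠ 0 → ω x y = 0 →
      c ((π q).1 x) ((π q).1 y) = φ q x + c x y - φ q y := by
    intro q x y hq hx hy hx0 hy0 hxy
    have := D.conn_mul hC (hsum hx hy hx0 hy0) (horth hx hy hx0 hy0 hxy) (hφm q x hq hx hx0)
      (p' := ((s ((π q).1 y))⁻¹ * q * s y)⁻¹)
      (by rw [map_inv]; exact inv_mem (hφm q y hq hy hy0))
    rw [D.retr₁.inv (hφm q y hq hy hy0)] at this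
    rw [sub_eq_add_neg, ← this]
    change C _ = C _
    congr 1; group
  have hanti : ∀ x y, x ∈ lat I → y ∈ lat I → x ≠ 0 → y ≠ 0 → ω x y = 0 → c x y = -c y x := by
    intro x y hx hy hx0 hy0 hxy
    rw [← neg_eq_iff_eq_neg, ← D.conn_inv hC (hsum hx hy hx0 hy0) (horth hx hy hx0 hy0 hxy)]
    change C _ = C _
    congr 1; group
  have hdep : ∀ x y z, x ∈ lat I → y ∈ lat I → z ∈ lat I → x ≠ 0 → y ≠ 0 → z ≠ 0 → ω x y = 0 →
      ω y z = 0 → ω z x = 0 → ∀ α β γ : ℤ, (α ≠ 0 ∨ β ≠ 0 ∨ γ ≠ 0) →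
      α • x + β • y + γ • z = 0 → c x y + c y z + c z x = 0 := by
    intro x y z hx hy hz hx0 hy0 hz0 hxy hyz hzx α β γ hne hlin
    obtain ⟨a, ha, hax⟩ := (hs x hx hx0).2
    obtain ⟨b, hb, hby⟩ := (hs y hy hy0).2
    obtain ⟨d, hd, hdz⟩ := (hs z hz hz0).2
    have h1 : (s x)⁻¹ * s y * ((s y)⁻¹ * s z) = (s x)⁻¹ * s z := by group
    have := D.conn_dep hC (hsum hx hy hx0 hy0) (hsum hy hz hy0 hz0) (horth hx hy hx0 hy0 hxy)
      (horth hy hz hy0 hz0 hyz) (α := α * a) (β := β * b) (γ := γ * d)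
      (by simpa [ha, hb, hd] using hne) (by
        have h2 := congrArg ((π (s x))⁻¹).1 hlin
        rw [map_add, map_add, map_zsmul, map_zsmul, map_zsmul, map_zero] at h2
        nth_rewrite 2 [hax] at h2
        rw [hby, hdz, map_zsmul, map_zsmul, map_zsmul, inv_apply_self, smul_smul, smul_smul,
          smul_smul, ← mul_apply, ← mul_apply, ← map_inv, ← map_mul, ← map_mul] at h2
        rw [h1]
        exact h2)
    rw [h1] at this
    change c x y + c y z = c x z at this
    rw [this, hanti z x hz hx hz0 hx0 hzx, add_neg_cancel]
  have hnegp : ∀ a b d, a ∈ lat I → b ∈ lat I → d ∈ lat I → a ≠ 0 → b ≠ 0 → d ≠ 0 → ω a d = 0 →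
      ω d b = 0 → c a (-d) + c (-d) b = c a d + c d b := by
    intro a b d ha hb hd ha0 hb0 hd0 had hdb
    have hd' : -d ∈ lat I := neg_mem hd
    have hd0' : -d ≠ 0 := neg_ne_zero.2 hd0
    have hda : ω d a = 0 := by rw [ω_skew, had, neg_zero]
    have hbd : ω b d = 0 := by rw [ω_skew, hdb, neg_zero]
    have h1 := hdep a d (-d) ha hd hd' ha0 hd0 hd0' had (by simp) (by simp [hda]) 0 1 1 (by simp)
      (by simp)
    have h2 := hdep b d (-d) hb hd hd' hb0 hd0 hd0' hbd (by simp) (by simp [hdb]) 0 1 1 (by simp)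
      (by simp)
    rw [hanti (-d) a hd' ha hd0' ha0 (by simp [hda])] at h1
    rw [hanti b d hb hd hb0 hd0 hbd] at h2
    rw [← sub_eq_zero, ← neg_eq_zero, ← sub_eq_zero_of_eq (h1.trans h2.symm)]
    abel
  have hhyp : ∀ a b x d, a ∈ lat I → b ∈ lat I → x ∈ lat I → d ∈ lat I → a ≠ 0 → x ≠ 0 →
      ω a b = 0 → ω b x = 0 → ω x d = 0 → ω d a = 0 → ω b d = 1 →
      c a b + c b x + c x d + c d a = 0 := by
    intro a b x d ha hb hx hd ha0 hx0 hab hbx hxd hda hbd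
    have hba : ω b a = 0 := by rw [ω_skew, hab, neg_zero]
    have hdx : ω d x = 0 := by rw [ω_skew, hxd, neg_zero]
    have hxb : ω x b = 0 := by rw [ω_skew, hbx, neg_zero]
    have had : ω a d = 0 := by rw [ω_skew, hda, neg_zero]
    have hdb : ω d b = -1 := by rw [ω_skew, hbd]
    have hb0 : b ≠ 0 := by rintro rfl; simp at hbd
    have hd0 : d ≠ 0 := by rintro rfl; simp at hbd
    obtain ⟨q, hq⟩ := h.surj (tv b 1 * tv d 1 * tv b 1)
    have hqI : π q ∈ fixer I := by
      rw [hq]; exact mul_mem (mul_mem (tv_mem hb 1) (tv_mem hd 1)) (tv_mem hb 1)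
    have qa : (π q).1 a = a := by rw [hq]; simp [hba, hda]
    have qx : (π q).1 x = x := by rw [hq]; simp [hbx, hdx]
    have qb : (π q).1 b = -d := by rw [hq]; simp [hdb, hbd]
    have qd : (π q).1 d = b := by rw [hq]; simp [hdb, hbd]
    have e1 := hinv q a b hqI ha hb ha0 hb0 hab
    have e2 := hinv q b x hqI hb hx hb0 hx0 hbx
    have e3 := hinv q x d hqI hx hd hx0 hd0 hxd
    have e4 := hinv q d a hqI hd ha hd0 ha0 hda
    rw [qa, qb] at e1
    rw [qb, qx] at e2
    rw [qx, qd] at e3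
    rw [qd, qa] at e4
    have e5 := hnegp a x d ha hx hd ha0 hx0 hd0 had hdx
    rw [e1, e2] at e5
    rw [hanti x b hx hb hx0 hb0 hxb] at e3
    rw [hanti b a hb ha hb0 ha0 hba] at e4
    rw [hanti a d ha hd ha0 hd0 had, hanti d x hd hx hd0 hx0 hdx] at e5
    apply CExt.eq_zero_of_add_self
    linear_combination (norm := abel) e5 - e3 - e4
  let f' : lat I → lat I → A := fun x y => c x y
  let ω' : lat I →ₗ[ℤ] lat I →ₗ[ℤ] ℤ := ω.domRestrict₁₂ (lat I) (lat I)
  have hdata : OrthGraph.IsData ω' f' := by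
    refine ⟨fun x => ω_self _, fun x y => ω_skew _ _, fun m a ha => ?_,
      fun x y hx hy hxy => hanti x y x.2 y.2 (by simpa using hx) (by simpa using hy) hxy,
      fun x y z hx hy hz hxy hyz hzx α β γ hne hlin => hdep x y z x.2 y.2 z.2 (by simpa using hx)
        (by simpa using hy) (by simpa using hz) hxy hyz hzx α β γ hne
        (by simpa using congrArg Subtype.val hlin),
      fun a b x d ha hx hab hbx hxd hda hbd => hhyp a b x d a.2 b.2 x.2 d.2 (by simpa using ha)
        (by simpa using hx) hab hbx hxd hda hbd⟩
    obtain ⟨y, hy, hay⟩ := exists_div m a.2 (fun y hy => ha ⟨y, hy⟩)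
    exact ⟨⟨y, hy⟩, Subtype.ext hay⟩
  have hu : (⟨e j, e_mem_lat D.jI⟩ : lat I) ≠ 0 := fun h' => e_ne_zero j (congrArg Subtype.val h')
  have huv : ω' ⟨e j, e_mem_lat D.jI⟩ ⟨e k, e_mem_lat D.kI⟩ = 0 := by
    change ω (e j) (e k) = 0
    simp
  have hind : ∀ α β : ℤ, α • (⟨e j, e_mem_lat D.jI⟩ : lat I) + β • ⟨e k, e_mem_lat D.kI⟩ = 0 →
      α = 0 ∧ β = 0 := by
    intro α β h'
    have h1 : α • e j + β • e k = 0 := congrArg Subtype.val h'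
    have h2 := congrFun h1 (Sum.inl j)
    have h3 := congrFun h1 (Sum.inl k)
    simp [D.ne, D.ne.symm] at h2 h3
    exact ⟨h2, h3⟩
  obtain ⟨ψ', hψ'⟩ := hdata.exists_potential hu huv hind
  obtain ⟨ψ, hψ⟩ : ∃ ψ : Vec ι → A, ∀ x y, x ∈ lat I → y ∈ lat I → x ≠ 0 → y ≠ 0 → ω x y = 0 →
      c x y = ψ y - ψ x := by
    classical
    refine ⟨fun x => if hx : x ∈ lat I then ψ' ⟨x, hx⟩ else 0, fun x y hx hy hx0 hy0 hxy => ?_⟩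
    simp only [dif_pos hx, dif_pos hy]
    exact hψ' ⟨x, hx⟩ ⟨y, hy⟩ (fun h' => hx0 (congrArg Subtype.val h'))
      (fun h' => hy0 (congrArg Subtype.val h')) hxy
  let R : E → Vec ι → A := fun q x => φ q x + ψ ((π q).1 x) - ψ x
  have hR : ∀ q x y, π q ∈ fixer I → x ∈ lat I → y ∈ lat I → x ≠ 0 → y ≠ 0 → ω x y = 0 →
      R q x = R q y := by
    intro q x y hq hx hy hx0 hy0 hxy
    have e1 := hinv q x y hq hx hy hx0 hy0 hxy
    rw [hψ x y hx hy hx0 hy0 hxy, hψ _ _ (map_mem_lat hq hx) (map_mem_lat hq hy)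
      (map_ne_zero _ hx0) (map_ne_zero _ hy0) (by rw [ω_map, hxy]), ← sub_eq_zero] at e1
    rw [← sub_eq_zero, ← neg_eq_zero, ← e1]
    change -(φ q x + ψ ((π q).1 x) - ψ x - (φ q y + ψ ((π q).1 y) - ψ y)) = _
    abel
  have hRu : ∀ q x, π q ∈ fixer I → x ∈ lat I → x ≠ 0 → R q x = R q (e j) := by
    intro q x hq hx hx0
    obtain ⟨w, hw0, hw1, hw2⟩ := hdata.exists_perp hu huv hind ⟨x, hx⟩
    have hw0' : (w : Vec ι) ≠ 0 := by simpa using hw0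
    rw [hR q x w hq hx w.2 hx0 hw0' hw2, ← hR q (e j) w hq (e_mem_lat D.jI) w.2 (e_ne_zero j) hw0'
      hw1]
  refine ⟨fun q => R q (e j), fun x y hx hy => ?_, fun a => ?_⟩
  · have hy' := map_mem_lat hy (e_mem_lat D.jI)
    have hy0 := map_ne_zero (π y) (e_ne_zero j)
    have h1 : φ (x * y) (e j) = φ x ((π y).1 (e j)) + φ y (e j) := by
      change r₁ _ = r₁ _ + r₁ _
      rw [← D.retr₁.mul _ _ (hφm x _ hx hy' hy0) (hφm y _ hy (e_mem_lat D.jI) (e_ne_zero j)),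
        map_mul, mul_apply]
      congr 1; group
    change R (x * y) (e j) = R x (e j) + R y (e j)
    rw [← hRu x _ hx hy' hy0]
    change φ _ _ + ψ _ - ψ _ = (φ _ _ + ψ _ - ψ _) + (φ _ _ + ψ _ - ψ _)
    rw [h1, map_mul, mul_apply]; abel
  · change r₁ _ + ψ _ - ψ _ = a
    rw [h.proj, one_apply]
    have : (s (e j))⁻¹ * inc a * s (e j) = inc a := by
      rw [mul_assoc, h.comm]; group
    rw [this, D.retr₁.inc]; abel

end Symp

/-! ### Splitting central extensions of the symplectic group -/

namespace Symp

variable {ι : Type*} [Fintype ι] [DecidableEq ι] {E A : Type*} [Group E] [AddCommGroup A]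
  [Module ℚ A] {π : E →* Sp ι} {inc : A → E}

theorem eq_pl_of_mem {k : ι} {p : Sp ι} (hp : p ∈ fixer {k}) : ∃ b, p = pl k b := by
  have h1 : ∀ x ∈ lat {k}, x = x (Sum.inl k) • e k + x (Sum.inr k) • f k := by
    intro x hx
    conv_lhs => rw [vec_eq_sum x]
    refine Finset.sum_eq_single k (fun i _ hi => ?_) (by simp)
    simp [hx i (by simpa using hi)]
  have he := h1 _ (map_mem_lat hp (e_mem_lat (Finset.mem_singleton_self k)))
  have hf := h1 _ (map_mem_lat hp (f_mem_lat (Finset.mem_singleton_self k)))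
  generalize (p.1 (e k)) (Sum.inl k) = a, (p.1 (e k)) (Sum.inr k) = c,
    (p.1 (f k)) (Sum.inl k) = b, (p.1 (f k)) (Sum.inr k) = d at he hf
  have hd : a * d - b * c = 1 := by
    have := ω_map p (e k) (f k)
    rw [he, hf] at this
    simp [e_ω] at this
    linear_combination this
  obtain ⟨M, m1, m2, m3, m4⟩ : ∃ M : SL2Z, M 0 0 = a ∧ M 0 1 = b ∧ M 1 0 = c ∧ M 1 1 = d :=
    ⟨⟨!![a, b; c, d], by rw [Matrix.det_fin_two_of, hd]⟩, rfl, rfl, rfl, rfl⟩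
  refine ⟨M, ext_basis (fun i => ?_) (fun i => ?_)⟩
  · by_cases hi : i = k
    · subst hi
      rw [he, plane_apply, m1, m2, m3, m4]; simp; module
    · rw [(hp i (by simpa using hi)).1, (pl_mem (I := {k}) (by simp) M i (by simpa using hi)).1]
  · by_cases hi : i = k
    · subst hi
      rw [hf, plane_apply, m1, m2, m3, m4]; simp; module
    · rw [(hp i (by simpa using hi)).2, (pl_mem (I := {k}) (by simp) M i (by simpa using hi)).2]

theorem pl_injective {k : ι} {b b' : SL2Z} (h : pl k b = pl k b') : b = b' := by
  have h1 := congrArg (fun p : Sp ι => p.1 (e k)) h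
  have h2 := congrArg (fun p : Sp ι => p.1 (f k)) h
  simp only [plane_apply] at h1 h2
  have e1 := congrFun h1 (Sum.inl k)
  have e2 := congrFun h1 (Sum.inr k)
  have e3 := congrFun h2 (Sum.inl k)
  have e4 := congrFun h2 (Sum.inr k)
  simp at e1 e2 e3 e4
  ext i i'
  fin_cases i <;> fin_cases i' <;> assumption

theorem exists_retr_singleton (h : CExt π inc) (k : ι) : ∃ r, IsRetr π inc (fixer {k}) r := by
  set L := h.lift (pl k) with hL
  have hex : ∀ x, ∃ a, π x ∈ fixer {k} → ∃ b, x = L b * inc a := by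
    intro x
    by_cases hx : π x ∈ fixer {k}
    · obtain ⟨b, hb⟩ := eq_pl_of_mem hx
      obtain ⟨a, ha⟩ := h.exists_eq_mul (e := x) (e' := L b) (by rw [hb, hL, h.proj_lift])
      exact ⟨a, fun _ => ⟨b, ha⟩⟩
    · exact ⟨0, fun h' => absurd h' hx⟩
  choose r hr using hex
  have huniq : ∀ b b' a a', L b * inc a = L b' * inc a' → a = a' := by
    intro b b' a a' hab
    have h1 := congrArg π hab
    rw [map_mul, map_mul, h.proj, h.proj, mul_one, mul_one, hL, h.proj_lift, h.proj_lift] at h1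
    rw [pl_injective h1] at hab
    exact h.mul_cancel hab
  refine ⟨r, fun x y hx hy => ?_, fun a => ?_⟩
  · obtain ⟨b, hb⟩ := hr x hx
    obtain ⟨b', hb'⟩ := hr y hy
    obtain ⟨b'', hb''⟩ := hr (x * y) (by rw [map_mul]; exact mul_mem hx hy)
    refine huniq b'' (b * b') _ _ ?_
    rw [← hb'', map_mul, h.add]
    nth_rewrite 1 [hb, hb']
    rw [mul_assoc, mul_assoc, ← mul_assoc (inc _) (L b'), h.comm, mul_assoc]
  · obtain ⟨b, hb⟩ := hr (inc a) (by rw [h.proj]; exact one_mem _)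
    exact huniq b 1 _ _ (by rw [← hb, map_one, one_mul])

/-- A central extension by a rational vector space with vanishing commutator invariant splits. -/
theorem exists_retr {h : CExt π inc} {j k : ι} (hjk : j ≠ k) (hc : CommZero h j k) :
    ∃ r, IsRetr π inc ⊤ r := by
  have key : ∀ K : Finset ι, k ∉ K → ∃ r, IsRetr π inc (fixer (insert k K)) r := by
    intro K
    induction K using Finset.induction_on with
    | empty => intro _; exact exists_retr_singleton h k
    | insert i K hi ih =>
      intro hk
      rw [Finset.mem_insert, not_or] at hk
      obtain ⟨r', hr'⟩ := ih hk.2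
      have hiK : i ∉ insert k K := by simp [hi, Ne.symm hk.1]
      have hkK : k ∈ insert k K := by simp
      have hik : i ≠ k := Ne.symm hk.1
      obtain ⟨r₁, hr₁⟩ := exists_retr_stabLine h hiK hkK hr'
      obtain ⟨r₂, hr₂, hag⟩ := exists_retr_stabPlane (h := h) hiK hkK hik hr₁
        (retr_lift_T (by simp) (by simp) hik hr₁ (hc.congr hjk hik))
      rw [Finset.insert_comm]
      exact ConnData.exists_retr (h := h) (j := i) (k := k) (r₁ := r₁) (r₂ := r₂)
        ⟨by simp, by simp, hik, fun g hg hg' => exists_factor hiK hkK hg hg', hr₁, hr₂, hag⟩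
  obtain ⟨r, hr⟩ := key (Finset.univ.erase k) (by simp)
  rw [Finset.insert_erase (Finset.mem_univ k)] at hr
  exact ⟨r, hr.mono fun g _ i hi => absurd (Finset.mem_univ i) hi⟩

end Symp

/-! ### Perfectness of the symplectic group -/

theorem SL2Pres.hom_eq_one {B : Type*} [CommGroup B] (φ : SL2Z →* B)
    (hT : φ ModularGroup.T = 1) (b : SL2Z) : φ b = 1 := by
  have hS : φ ModularGroup.S = 1 := by
    have h := congrArg φ (SL2Pres.U_cube.trans SL2Pres.S_sq.symm)
    simp only [SL2Pres.U, map_pow, map_mul, hT, mul_one] at h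
    rw [pow_succ] at h
    exact mul_eq_left.1 h
  have : φ = 1 := SL2Pres.hom_ext (by simpa using hS) (by simp [SL2Pres.U, hS, hT])
  rw [this]; rfl

namespace Symp

variable {ι : Type*} [Fintype ι] [DecidableEq ι] {B : Type*} [CommGroup B]

theorem hom_conj (χ : Sp ι →* B) (p q : Sp ι) : χ (q * p * q⁻¹) = χ p := by
  rw [map_mul, map_mul, map_inv, mul_comm, inv_mul_cancel_left]

theorem hom_nn (χ : Sp ι →* B) {i k : ι} (hik : i ≠ k) {v : Vec ι} (c : ℤ) (hv : ω (e i) v = 0)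
    (hve : ω v (e k) = 0) (hvf : ω v (f k) = 0) : χ (nn (e i) (c • v) 0) = 1 := by
  have h1 : nn (e i) (e k) 0 * nn v (c • f k) 0 * (nn (e i) (e k) 0)⁻¹
      = nn v (c • f k) 0 * nn v (c • e i) 0 := by
    have hve' : ω (e k) v = 0 := by rw [ω_skew, hve, neg_zero]
    have hv' : ω v (e i) = 0 := by rw [ω_skew, hv, neg_zero]
    rw [conj_nn, nn_mul (by rw [map_smul, hvf, smul_zero]) (by rw [map_smul, hv', smul_zero]),
      nn_apply (by simp), nn_apply (by simp), hv, hve']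
    have h2 : ω (e i) (f k) = 0 := by simp [hik.symm]
    have h3 : ω (f k) (e i) = 0 := by simp [hik]
    rw [map_smul, map_smul, map_smul, map_smul, ω_e_f, h2, LinearMap.smul_apply, h3]
    simp
  have h2 := congrArg χ h1
  rw [hom_conj, map_mul] at h2
  have h3 := mul_eq_left.1 h2.symm
  have h4 : nn (e i) (c • v) 0 = nn v (c • e i) 0 := by
    refine ext fun x => ?_
    rw [nn_apply (by rw [map_smul, hv, smul_zero]),
      nn_apply (by rw [map_smul, ω_skew, hv, neg_zero, smul_zero])]
    simp only [map_smul, LinearMap.smul_apply, smul_eq_mul]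
    module
  rw [h4, h3]

variable {i j k : ι}

theorem hom_nn_e (χ : Sp ι →* B) (hik : i ≠ k) (hjk : j ≠ k) (c : ℤ) :
    χ (nn (e i) (c • e j) 0) = 1 :=
  hom_nn χ hik c (by simp) (by simp) (by simp [hjk.symm])

theorem hom_nn_f (χ : Sp ι →* B) (hij : i ≠ j) (hik : i ≠ k) (hjk : j ≠ k) (c : ℤ) :
    χ (nn (e i) (c • f j) 0) = 1 :=
  hom_nn χ hik c (by simp [hij.symm]) (by simp [hjk.symm]) (by simp)

theorem hom_tv (χ : Sp ι →* B) (hij : i ≠ j) (hik : i ≠ k) (hjk : j ≠ k) : χ (tv (e i) 1) = 1 := by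
  have h1 : tv (e j) 1 * nn (e i) (f j) 0 * (tv (e j) 1)⁻¹
      = nn (e i) (f j) 0 * nn (e i) (e j) 0 * tv (e i) 1 := by
    have h2 : ω (e i) (f j) = 0 := by simp [hij.symm]
    have h3 : ω (e i) (e j) = 0 := by simp
    rw [conj_nn, nn_mul h2 h3, ← nn_zero (e i), nn_mul (by rw [map_add, h2, h3, add_zero]) (by simp)]
    simp
  have h2 := congrArg χ h1
  have hf := hom_nn_f χ hij hik hjk 1
  have he := hom_nn_e χ hik hjk 1
  rw [one_smul] at hf he
  rw [hom_conj, map_mul, map_mul, hf, he] at h2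
  simpa using h2.symm

theorem hom_pl (χ : Sp ι →* B) (hij : i ≠ j) (hik : i ≠ k) (hjk : j ≠ k) (b : SL2Z) :
    χ (pl i b) = 1 :=
  SL2Pres.hom_eq_one (χ.comp (pl i)) (by
    rw [MonoidHom.comp_apply, pl_T, hom_tv χ hij hik hjk]) b

theorem lv_T (hij : i ≠ j) : lv hij ModularGroup.T = nn (e i) (-1 • f j) 0 := by
  refine ext fun x => ?_
  rw [levi_apply, nn_apply (by simp [hij.symm])]
  simp [ModularGroup.T, f_ω]
  module

theorem hom_lv (χ : Sp ι →* B) (hij : i ≠ j) (hik : i ≠ k) (hjk : j ≠ k) (b : SL2Z) :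
    χ (lv hij b) = 1 :=
  SL2Pres.hom_eq_one (χ.comp (lv hij)) (by
    rw [MonoidHom.comp_apply, lv_T, hom_nn_f χ hij hik hjk]) b

theorem exists_third (hι : 3 ≤ Fintype.card ι) (i j : ι) : ∃ k, i ≠ k ∧ j ≠ k := by
  have : ({i, j} : Finset ι).card < Fintype.card ι := lt_of_le_of_lt Finset.card_le_two (by omega)
  obtain ⟨k, hk⟩ := Finset.exists_mem_notMem_of_card_lt_card (s := {i, j}) (t := Finset.univ)
    (by simpa using this)
  refine ⟨k, ?_, ?_⟩ <;> rintro rfl <;> simp at hk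

/-- The symplectic group of genus at least three is perfect. -/
theorem hom_eq_one (hι : 3 ≤ Fintype.card ι) (χ : Sp ι →* B) (p : Sp ι) : χ p = 1 := by
  have hpl : ∀ i b, χ (pl i b) = 1 := fun i b => by
    obtain ⟨j, hij, -⟩ := exists_third hι i i
    obtain ⟨k, hik, hjk⟩ := exists_third hι i j
    exact hom_pl χ hij hik hjk b
  have hlv : ∀ i j (h : i ≠ j) b, χ (lv h b) = 1 := fun i j hij b => by
    obtain ⟨k, hik, hjk⟩ := exists_third hι i j
    exact hom_lv χ hij hik hjk b
  have htr := fun (I : Finset ι) (x : Vec ι) (j : ι) => exists_translate (I := I) (x := x) χ.ker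
    (fun i b => hpl i b) (fun i j h b => hlv i j h b) (j := j)
  have key : ∀ I : Finset ι, ∀ p ∈ fixer I, χ p = 1 := by
    intro I
    induction I using Finset.induction_on with
    | empty =>
      intro p hp
      have : p = 1 := ext_basis (fun i => (hp i (by simp)).1) (fun i => (hp i (by simp)).2)
      rw [this, map_one]
    | insert j I hj ih =>
      intro p hp
      have hjI : j ∈ insert j I := by simp
      obtain ⟨q, hqχ, hq, c, hc⟩ := htr (insert j I) _ j hjI (map_mem_lat hp (e_mem_lat hjI))
      have h1 : (q⁻¹ * p).1 (e j) = c • e j := by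
        rw [mul_apply, hc, map_smul, inv_apply_self]
      have hunit : c = 1 ∨ c = -1 := by
        have := ω_map (q⁻¹ * p) (e j) (f j)
        rw [h1, map_smul, LinearMap.smul_apply, ω_e_f, smul_eq_mul] at this
        exact Int.eq_one_or_neg_one_of_mul_eq_one this
      obtain ⟨s, hsχ, hs, hse⟩ : ∃ s, χ s = 1 ∧ s ∈ fixer (insert j I) ∧
          (s * (q⁻¹ * p)).1 (e j) = e j := by
        rcases hunit with h | h
        · exact ⟨1, map_one _, one_mem _, by rw [one_mul, h1, h, one_smul]⟩
        · refine ⟨pl j (ModularGroup.S ^ 2), hpl _ _, pl_mem hjI _, ?_⟩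
          rw [mul_apply, h1, h, map_smul, plane_e, SL2Pres.S_sq]
          simp
      obtain ⟨m, hm, t, r, hr, hd⟩ := exists_decomp hjI
        (mul_mem hs (mul_mem (inv_mem hq) hp)) hse
      rw [Finset.erase_insert hj] at hm hr
      have hn0 : χ (nn (e j) m 0) = 1 := by
        rcases I.eq_empty_or_nonempty with rfl | ⟨k, hk⟩
        · have : m = 0 := by
            funext s
            rcases s with i | i
            · exact (hm i (by simp)).1
            · exact (hm i (by simp)).2
          rw [this, nn_zero, tv_zero, map_one]
        · obtain ⟨q', -, hq', c', hc'⟩ := htr I m k hk hm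
          have hjk : j ≠ k := fun h => hj (h ▸ hk)
          obtain ⟨l, hjl, hkl⟩ := exists_third hι j k
          have : q' * nn (e j) (c' • e k) 0 * q'⁻¹ = nn (e j) m 0 := by
            rw [conj_nn, (hq' j hj).1, hc', map_smul]
          rw [← this, hom_conj, hom_nn_e χ hjl hkl]
      have htv : χ (tv (e j) t) = 1 := by
        have : tv (e j) t = tv (e j) 1 ^ t := by rw [tv_zpow, mul_one]
        rw [this, map_zpow, ← pl_T, hpl, _root_.one_zpow]
      have hnn : nn (e j) m t = nn (e j) m 0 * tv (e j) t := by
        rw [← nn_zero, nn_mul (e_ω_lat hj hm) (by simp)]; simp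
      have h2 := congrArg χ hd
      rw [hnn, map_mul, map_mul, map_mul, map_mul, map_inv, hsχ, ih r hr, hn0, htv,
        MonoidHom.mem_ker.1 hqχ] at h2
      simpa using h2
  exact key Finset.univ p fun i hi => absurd (Finset.mem_univ i) hi

end Symp

/-! ### Extensions defined by cocycles -/

section

variable {Γ A : Type*} [Group Γ] [AddCommGroup A]

variable (Γ A) in
/-- Two-cocycles for the trivial action. -/
def cocyc : AddSubgroup (Γ → Γ → A) where
  carrier := {F | ∀ x y z, F (x * y) z + F x y = F y z + F x (y * z)}
  add_mem' := fun {F F'} hF hF' x y z => by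
    simp only [Pi.add_apply]
    rw [add_add_add_comm, hF, hF', add_add_add_comm]
  zero_mem' := fun x y z => rfl
  neg_mem' := fun {F} hF x y z => by
    simp only [Pi.neg_apply]
    rw [← neg_add, hF, neg_add]

theorem cocyc_eq (F : cocyc Γ A) (x y z : Γ) : F.1 (x * y) z + F.1 x y = F.1 y z + F.1 x (y * z) :=
  F.2 x y z

theorem cocyc_one_left (F : cocyc Γ A) (x : Γ) : F.1 1 x = F.1 1 1 := by
  have := cocyc_eq F 1 1 x
  rw [one_mul, one_mul] at this
  exact (add_left_cancel this).symm

theorem cocyc_one_right (F : cocyc Γ A) (x : Γ) : F.1 x 1 = F.1 1 1 := by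
  have := cocyc_eq F x 1 1
  rw [mul_one, mul_one] at this
  exact add_right_cancel this

theorem cocyc_inv (F : cocyc Γ A) (x : Γ) : F.1 x⁻¹ x = F.1 x x⁻¹ := by
  have := cocyc_eq F x⁻¹ x x⁻¹
  rw [inv_mul_cancel, mul_inv_cancel, cocyc_one_left, cocyc_one_right F x⁻¹, add_comm] at this
  exact add_right_cancel this

/-- The central extension defined by a cocycle. -/
@[ext] structure CocExt (F : cocyc Γ A) where
  /-- The coordinate in the kernel. -/
  fst : A
  /-- The coordinate in the quotient. -/
  snd : Γ

namespace CocExt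

variable {F : cocyc Γ A}

instance : Mul (CocExt F) := ⟨fun p q => ⟨p.fst + q.fst + F.1 p.snd q.snd, p.snd * q.snd⟩⟩

instance : One (CocExt F) := ⟨⟨-F.1 1 1, 1⟩⟩

instance : Inv (CocExt F) := ⟨fun p => ⟨-p.fst - F.1 p.snd p.snd⁻¹ - F.1 1 1, p.snd⁻¹⟩⟩

@[simp] theorem mul_fst (p q : CocExt F) : (p * q).fst = p.fst + q.fst + F.1 p.snd q.snd := rfl
@[simp] theorem mul_snd (p q : CocExt F) : (p * q).snd = p.snd * q.snd := rfl
@[simp] theorem one_fst : (1 : CocExt F).fst = -F.1 1 1 := rfl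
@[simp] theorem one_snd : (1 : CocExt F).snd = 1 := rfl
@[simp] theorem inv_fst (p : CocExt F) : p⁻¹.fst = -p.fst - F.1 p.snd p.snd⁻¹ - F.1 1 1 := rfl
@[simp] theorem inv_snd (p : CocExt F) : p⁻¹.snd = p.snd⁻¹ := rfl

instance : Group (CocExt F) :=
  Group.ofLeftAxioms
    (fun p q r => CocExt.ext (by
      simp only [mul_fst, mul_snd]
      linear_combination (norm := abel) cocyc_eq F p.snd q.snd r.snd) (mul_assoc _ _ _))
    (fun p => CocExt.ext (by simp [cocyc_one_left]) (one_mul _))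
    (fun p => CocExt.ext (by simp [cocyc_inv]; abel) (inv_mul_cancel _))

/-- The projection of the extension, composed with a homomorphism. -/
def proj (F : cocyc Γ A) {G : Type*} [Group G] (φ : Γ →* G) : CocExt F →* G where
  toFun p := φ p.snd
  map_one' := map_one φ
  map_mul' _ _ := map_mul φ _ _

/-- The inclusion of the kernel. -/
def inc (F : cocyc Γ A) (a : A) : CocExt F := ⟨a - F.1 1 1, 1⟩

theorem cext (F : cocyc Γ A) {G : Type*} [Group G] (φ : Γ ≃* G) :
    CExt (proj F φ.toMonoidHom) (inc F) where
  surj g := ⟨⟨0, φ.symm g⟩, by simp [proj]⟩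
  add a b := CocExt.ext (by simp [inc]; abel) (by simp [inc])
  inj a h := by
    have := congrArg CocExt.fst h
    simpa [inc] using this
  proj a := map_one φ
  ker p h := ⟨p.fst + F.1 1 1, CocExt.ext (by simp [inc]) (by
    have : φ p.snd = 1 := h
    simpa [inc] using this)⟩
  comm a p := CocExt.ext (by simp [inc, cocyc_one_left, cocyc_one_right]; abel) (by simp [inc])

/-- Functoriality of the extension in the coefficients. -/
def map {A' : Type*} [AddCommGroup A'] {F' : cocyc Γ A'} (ev : A →+ A')
    (h : ∀ x y, ev (F.1 x y) = F'.1 x y) : CocExt F →* CocExt F' where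
  toFun p := ⟨ev p.fst, p.snd⟩
  map_one' := CocExt.ext (by simp [h]) rfl
  map_mul' p q := CocExt.ext (by simp [h]) rfl

end CocExt

/-- Elements on which a functional takes values in `(1/n)ℤ`. -/
def fracSub {F : cocyc Γ A} (ev : A →+ ℚ) (hev : ∀ x y, ∃ m : ℤ, ev (F.1 x y) = m) (n : ℕ) :
    Subgroup (CocExt F) where
  carrier := {p | ∃ m : ℤ, n * ev p.fst = m}
  mul_mem' := fun {p q} ⟨a, ha⟩ ⟨b, hb⟩ => by
    obtain ⟨c, hc⟩ := hev p.snd q.snd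
    exact ⟨a + b + n * c, by simp [mul_add, ha, hb, hc]⟩
  one_mem' := by
    obtain ⟨c, hc⟩ := hev 1 1
    exact ⟨-(n * c), by simp [hc]⟩
  inv_mem' := fun {p} ⟨a, ha⟩ => by
    obtain ⟨c, hc⟩ := hev p.snd p.snd⁻¹
    obtain ⟨d, hd⟩ := hev 1 1
    exact ⟨-a - n * c - n * d, by simp [mul_sub, ha, hc, hd]⟩

theorem mem_fracSub_of_pow {F : cocyc Γ A} (ev : A →+ ℚ)
    (hev : ∀ x y, ∃ m : ℤ, ev (F.1 x y) = m) {n d : ℕ} (hd : d ∣ n) {p : CocExt F}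
    (hp : p ^ d = 1) : p ∈ fracSub ev hev n := by
  obtain ⟨s, rfl⟩ := hd
  have h := CocExt.cext F (MulEquiv.refl Γ)
  obtain ⟨a, ha⟩ := h.exists_eq_mul (e := p) (e' := ⟨0, p.snd⟩) rfl
  have h0 : (⟨0, p.snd⟩ : CocExt F) ∈ fracSub ev hev 1 := ⟨0, by simp⟩
  rw [ha, h.mul_pow] at hp
  have h1 : CocExt.inc F (d • a) ∈ fracSub ev hev 1 := by
    rw [eq_inv_of_mul_eq_one_right hp]
    exact inv_mem (pow_mem h0 d)
  obtain ⟨m, hm⟩ := h1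
  obtain ⟨c, hc⟩ := hev 1 1
  obtain ⟨c', hc'⟩ := hev p.snd 1
  have h2 : p.fst = a - F.1 1 1 + F.1 p.snd 1 := by
    conv_lhs => rw [ha]
    simp [CocExt.inc]
  simp [CocExt.inc, hc] at hm
  refine ⟨s * (m + c) - d * s * c + d * s * c', ?_⟩
  rw [h2, map_add, map_sub, hc, hc']
  push_cast
  linear_combination s * hm

end

/-! ### The commutator invariant of a cocycle -/

namespace Symp

variable {ι : Type*} [Fintype ι] [DecidableEq ι] {Γ : Type*} [Group Γ]

theorem comm_nn {j k : ι} (hjk : j ≠ k) :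
    nn (e j) (e k) 0 * nn (e j) (f k) 0 * (nn (e j) (e k) 0)⁻¹ * (nn (e j) (f k) 0)⁻¹
      = pl j (ModularGroup.T ^ 2) := by
  have h1 : ω (e j) (e k) = 0 := by simp
  have h2 : ω (e j) (f k) = 0 := by simp [hjk.symm]
  rw [mul_inv_eq_iff_eq_mul, mul_inv_eq_iff_eq_mul, map_pow, pl_T, ← zpow_natCast, tv_zpow,
    ← nn_zero, nn_mul h1 h2, nn_mul (by simp) h2, nn_mul (by rw [map_add, h2]; simp) h1]
  congr 1
  · abel
  · simp

variable (Γ) in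
/-- The cocycle with values in the dual of the group of integral cocycles. -/
def univCocyc : cocyc Γ (cocyc Γ ℤ →+ ℚ) :=
  ⟨fun x y => AddMonoidHom.mk' (fun F => (F.1 x y : ℚ)) (fun F F' => by simp), fun x y z => by
    ext F
    simpa using congrArg (Int.cast : ℤ → ℚ) (cocyc_eq F x y z)⟩

/-- The rational cocycle underlying an integral one. -/
def ratCocyc (F : cocyc Γ ℤ) : cocyc Γ ℚ :=
  ⟨fun x y => (F.1 x y : ℚ), fun x y z => by
    simpa using congrArg (Int.cast : ℤ → ℚ) (cocyc_eq F x y z)⟩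

/-- Evaluation at a cocycle. -/
def evalAt (F : cocyc Γ ℤ) : (cocyc Γ ℤ →+ ℚ) →+ ℚ := AddMonoidHom.eval F

theorem exists_invariant (hι : 3 ≤ Fintype.card ι) (φ : Γ ≃* Sp ι) :
    ∃ c : cocyc Γ ℤ →+ ℤ, ∀ F, c F = 0 ↔ ∃ b : Γ → ℤ, ∀ x y, F.1 x y = b x + b y - b (x * y) := by
  obtain ⟨j⟩ : Nonempty ι := Fintype.card_pos_iff.1 (by omega)
  obtain ⟨k, hjk, -⟩ := exists_third hι j j
  have h₀ := CocExt.cext (univCocyc Γ) φ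
  obtain ⟨x, hx⟩ := h₀.surj (nn (e j) (e k) 0)
  obtain ⟨y, hy⟩ := h₀.surj (nn (e j) (f k) 0)
  set L := h₀.lift (pl j) with hL
  obtain ⟨c₀, hc₀⟩ := h₀.exists_eq_mul (e := x * y * x⁻¹ * y⁻¹) (e' := L (ModularGroup.T ^ 2)) (by
    rw [hL, h₀.proj_lift, map_mul, map_mul, map_mul, map_inv, map_inv, hx, hy, comm_nn hjk])
  have hint : ∀ F, ∃ m : ℤ, (12 : ℚ) * c₀ F = m := by
    intro F
    have hev : ∀ a b : Γ, ∃ m : ℤ, evalAt F ((univCocyc Γ).1 a b) = m := fun a b => ⟨F.1 a b, rfl⟩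
    set K := fracSub (evalAt F) hev 12 with hK
    have hz : ∀ g : Γ, (⟨0, g⟩ : CocExt (univCocyc Γ)) ∈ K := fun g => ⟨0, by simp⟩
    have hLmem : ∀ b, L b ∈ K := by
      intro b
      induction b using SL2Pres.induction with
      | hS => exact mem_fracSub_of_pow _ _ (d := 4) (by norm_num)
                (by rw [← map_pow, SL2Pres.S_pow_four, map_one])
      | hU => exact mem_fracSub_of_pow _ _ (d := 6) (by norm_num)
                (by rw [← map_pow, SL2Pres.U_pow_six, map_one])
      | one => rw [map_one]; exact one_mem _
      | mul x y hx hy => rw [map_mul]; exact mul_mem hx hy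
      | inv x hx => rw [map_inv]; exact inv_mem hx
    have hcomm : x * y * x⁻¹ * y⁻¹ ∈ K := by
      obtain ⟨a, ha⟩ := h₀.exists_eq_mul (e := x) (e' := ⟨0, x.snd⟩) rfl
      obtain ⟨b, hb⟩ := h₀.exists_eq_mul (e := y) (e' := ⟨0, y.snd⟩) rfl
      set x' : CocExt (univCocyc Γ) := ⟨0, x.snd⟩
      set y' : CocExt (univCocyc Γ) := ⟨0, y.snd⟩
      have : x * y * x⁻¹ * y⁻¹ = x' * y' * x'⁻¹ * y'⁻¹ := by
        rw [h₀.conj_eq_of_proj (e := x) (e' := x') rfl, hb]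
        have := h₀.conj_ι b x'
        rw [show x' * (y' * CocExt.inc (univCocyc Γ) b) * x'⁻¹
          = x' * y' * x'⁻¹ * (x' * CocExt.inc (univCocyc Γ) b * x'⁻¹) by group, this]
        group
      rw [this]
      exact mul_mem (mul_mem (mul_mem (hz _) (hz _)) (inv_mem (hz _))) (inv_mem (hz _))
    have h1 : CocExt.inc (univCocyc Γ) c₀ ∈ K := by
      rw [hc₀] at hcomm
      exact (K.mul_mem_cancel_left (hLmem _)).1 hcomm
    obtain ⟨m, hm⟩ := h1
    refine ⟨m + 12 * F.1 1 1, ?_⟩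
    have h2 : evalAt F (CocExt.inc (univCocyc Γ) c₀).fst = c₀ F - F.1 1 1 := rfl
    rw [h2] at hm
    push_cast at hm ⊢
    linear_combination hm
  choose c hc using hint
  refine ⟨AddMonoidHom.mk' c (fun F F' => ?_), fun F => ?_⟩
  · have : ((c (F + F') : ℤ) : ℚ) = ((c F + c F' : ℤ) : ℚ) := by
      rw [← hc, map_add, mul_add, hc, hc]; push_cast; rfl
    exact_mod_cast this
  have h₁ := CocExt.cext (ratCocyc F) φ
  set ψ : CocExt (univCocyc Γ) →* CocExt (ratCocyc F) :=
    CocExt.map (evalAt F) (fun _ _ => rfl) with hψ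
  have hinc : ∀ a, ψ (CocExt.inc _ a) = CocExt.inc _ (a F) := fun a => rfl
  have hproj : ∀ p, CocExt.proj (ratCocyc F) φ.toMonoidHom (ψ p)
    = CocExt.proj (univCocyc Γ) φ.toMonoidHom p := fun p => rfl
  have hlift : ψ.comp L = h₁.lift (pl j) := h₁.lift_eq (fun b => by
    rw [MonoidHom.comp_apply, hproj, hL, h₀.proj_lift])
  have hcF : ψ x * ψ y * (ψ x)⁻¹ * (ψ y)⁻¹
      = h₁.lift (pl j) (ModularGroup.T ^ 2) * CocExt.inc _ (c₀ F) := by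
    rw [← hlift, ← hinc, MonoidHom.comp_apply, ← map_mul ψ (L _), ← hc₀]
    simp only [map_mul, map_inv]
  have hzero : c F = 0 ↔ c₀ F = 0 := by
    have := hc F
    constructor
    · intro h0
      rw [h0] at this
      simpa using this
    · intro h0
      rw [h0] at this
      simpa using this.symm
  rw [AddMonoidHom.mk'_apply, hzero]
  constructor
  · intro h0
    have hcz : CommZero h₁ j k := by
      intro x' y' hx' hy'
      rw [h0, h₁.zero, mul_one] at hcF
      rw [← hcF]
      obtain ⟨b, hb⟩ := h₁.exists_eq_mul (e := y') (e' := ψ y) (by rw [hy', hproj, hy])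
      rw [h₁.conj_eq_of_proj (e := x') (e' := ψ x) (by rw [hx', hproj, hx]), hb]
      have := h₁.conj_ι b (ψ x)
      rw [show ψ x * (ψ y * CocExt.inc (ratCocyc F) b) * (ψ x)⁻¹
        = ψ x * ψ y * (ψ x)⁻¹ * (ψ x * CocExt.inc (ratCocyc F) b * (ψ x)⁻¹) by group, this]
      group
    obtain ⟨r, hr⟩ := exists_retr hjk hcz
    set β : Γ → ℚ := fun g => r ⟨0, g⟩ with hβ
    have hβF : ∀ g g', (F.1 g g' : ℚ) = β g + β g' - β (g * g') := by
      intro g g'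
      have h1 := hr.mul ⟨0, g⟩ ⟨0, g'⟩ trivial trivial
      have h2 : (⟨0, g⟩ * ⟨0, g'⟩ : CocExt (ratCocyc F))
          = ⟨0, g * g'⟩ * CocExt.inc (ratCocyc F) (F.1 g g') := by
        refine CocExt.ext ?_ (by simp [CocExt.inc])
        simp [CocExt.inc, cocyc_one_right (ratCocyc F) (g * g')]
        rfl
      rw [h2, hr.mul_ι h₁ trivial] at h1
      simp only [hβ]
      linear_combination h1
    set q := QuotientAddGroup.mk' (Int.castAddHom ℚ).range with hq
    set χ : Γ →* Multiplicative (ℚ ⧸ (Int.castAddHom ℚ).range) :=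
      MonoidHom.mk' (fun g => Multiplicative.ofAdd (q (β g))) (fun g g' => by
        rw [← ofAdd_add, ← map_add]
        congr 1
        rw [eq_comm, ← sub_eq_zero, ← map_sub, ← hβF]
        exact (QuotientAddGroup.eq_zero_iff _).2 ⟨F.1 g g', rfl⟩) with hχ
    have hint : ∀ g, ∃ m : ℤ, (m : ℚ) = β g := by
      intro g
      have h1 := hom_eq_one hι (χ.comp φ.symm.toMonoidHom) (φ g)
      have h2 : q (β g) = 0 := by
        simpa [hχ] using h1
      obtain ⟨m, hm⟩ := (QuotientAddGroup.eq_zero_iff _).1 h2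
      exact ⟨m, hm⟩
    choose b hb using hint
    refine ⟨b, fun g g' => ?_⟩
    have := hβF g g'
    rw [← hb, ← hb, ← hb] at this
    exact_mod_cast this
  · rintro ⟨b, hb⟩
    have hr : IsRetr (CocExt.proj (ratCocyc F) φ.toMonoidHom) (CocExt.inc (ratCocyc F)) ⊤
        (fun p => p.fst + b p.snd) := by
      refine ⟨fun p q _ _ => ?_, fun a => ?_⟩
      · have h1 : (ratCocyc F).1 p.snd q.snd = b p.snd + b q.snd - b (p.snd * q.snd) := by
          have := congrArg (Int.cast : ℤ → ℚ) (hb p.snd q.snd)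
          push_cast at this
          exact this
        simp [h1]; ring
      · have h1 : (ratCocyc F).1 1 1 = b 1 := by
          have := hb 1 1
          rw [mul_one, add_sub_cancel_right] at this
          exact congrArg (Int.cast : ℤ → ℚ) this
        simp [CocExt.inc, h1]
    generalize (fun p : CocExt (ratCocyc F) => p.fst + (b p.snd : ℚ)) = r at hr
    have h1 := congrArg r hcF
    rw [hr.mul_ι h₁ trivial, hr.sl2 (fun _ => trivial), hr.mul _ _ trivial trivial,
      hr.conj trivial trivial, hr.inv trivial] at h1
    linear_combination -h1

end Symp

/-! ### The cocycle of a factor of automorphy -/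

open unitInterval in
theorem exists_continuous_log {X : Type*} [TopologicalSpace X] {x₀ : X} (H : C(I × X, X))
    (H0 : ∀ x, H (0, x) = x₀) (H1 : ∀ x, H (1, x) = x) {u : X → ℂ} (hu : Continuous u)
    (hu0 : ∀ x, u x ≠ 0) : ∃ v : X → ℂ, Continuous v ∧ ∀ x, Complex.exp (v x) = u x := by
  set K : C(I × X, {z : ℂ // z ≠ 0}) :=
    ⟨fun p => ⟨u (H p), hu0 _⟩, (hu.comp H.continuous).subtype_mk _⟩ with hK
  have hK0 : ∀ x, K (0, x) = ⟨_, (Complex.exp_ne_zero (ContinuousMap.const X (Complex.log (u x₀)) x))⟩ := by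
    intro x
    refine Subtype.ext ?_
    simp [hK, H0, Complex.exp_log (hu0 x₀)]
  refine ⟨fun x => Complex.isCoveringMap_exp.liftHomotopy K _ hK0 (1, x),
    (ContinuousMap.continuous _).comp (by fun_prop), fun x => ?_⟩
  have := congrFun (Complex.isCoveringMap_exp.liftHomotopy_lifts K _ hK0) (1, x)
  simpa [hK, H1] using congrArg Subtype.val this

open unitInterval in
theorem eq_of_continuous_int {d : I → ℂ} (hd : Continuous d) {n : I → ℤ}
    (hn : ∀ t, d t = n t * (2 * Real.pi * Complex.I)) : n 0 = n 1 := by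
  have hne : (2 * Real.pi * Complex.I : ℂ) ≠ 0 := Complex.two_pi_I_ne_zero
  have hc : Continuous n := by
    rw [Int.isClosedEmbedding_coe_real.isInducing.continuous_iff]
    have : (fun t => ((n t : ℤ) : ℝ)) = fun t => (d t / (2 * Real.pi * Complex.I)).re := by
      funext t
      rw [hn, mul_div_cancel_right₀ _ hne, Complex.intCast_re]
    change Continuous fun t => ((n t : ℤ) : ℝ)
    rw [this]
    exact Complex.continuous_re.comp (hd.div_const _)
  exact PreconnectedSpace.constant inferInstance hc

open unitInterval in
/-- A factor of automorphy on a contractible space defines an integral cocycle; it is not a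
coboundary if an involution with a fixed point has multiplier `-1` there. -/
theorem exists_cocyc_not_coboundary {Γ X : Type*} [Group Γ] [TopologicalSpace X] {x₀ : X}
    (H : C(I × X, X)) (H0 : ∀ x, H (0, x) = x₀) (H1 : ∀ x, H (1, x) = x) (act : Γ → X → X)
    (act_cont : ∀ γ, Continuous (act γ)) (act_mul : ∀ γ γ' x, act (γ * γ') x = act γ (act γ' x))
    (act_one : ∀ x, act 1 x = x) (j : Γ → X → ℂ)
    (j_cont : ∀ γ, Continuous (j γ)) (j_ne : ∀ γ x, j γ x ≠ 0)
    (j_mul : ∀ γ γ' x, j (γ * γ') x = j γ (act γ' x) * j γ' x) (γ₀ : Γ) (hγ₀ : γ₀ * γ₀ = 1)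
    (hfix : act γ₀ x₀ = x₀) (hj : j γ₀ x₀ = -1) :
    ∃ F : cocyc Γ ℤ, ¬ ∃ b : Γ → ℤ, ∀ x y, F.1 x y = b x + b y - b (x * y) := by
  choose φ φ_cont hφ using fun γ => exists_continuous_log H H0 H1 (j_cont γ) (j_ne γ)
  have hex : ∀ γ γ' x, ∃ n : ℤ,
      φ γ (act γ' x) + φ γ' x - φ (γ * γ') x = n * (2 * Real.pi * Complex.I) := by
    intro γ γ' x
    rw [← Complex.exp_eq_one_iff, Complex.exp_sub, Complex.exp_add, hφ, hφ, hφ, ← j_mul,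
      div_self (j_ne _ _)]
  choose n hn using hex
  have hconst : ∀ γ γ' x, n γ γ' x₀ = n γ γ' x := by
    intro γ γ' x
    have := eq_of_continuous_int (d := fun t => φ γ (act γ' (H (t, x))) + φ γ' (H (t, x))
      - φ (γ * γ') (H (t, x))) (n := fun t => n γ γ' (H (t, x))) (by
        have h1 := act_cont γ'
        have h2 := φ_cont γ
        have h3 := φ_cont γ'
        have h4 := φ_cont (γ * γ')
        fun_prop) (fun t => hn _ _ _)
    simpa only [H0, H1] using this
  have hne : (2 * Real.pi * Complex.I : ℂ) ≠ 0 := Complex.two_pi_I_ne_zero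
  refine ⟨⟨fun γ γ' => n γ γ' x₀, fun a b c => ?_⟩, ?_⟩
  · change n (a * b) c x₀ + n a b x₀ = n b c x₀ + n a (b * c) x₀
    rw [hconst a b (act c x₀)]
    have e1 := hn (a * b) c x₀
    have e2 := hn a b (act c x₀)
    have e3 := hn b c x₀
    have e4 := hn a (b * c) x₀
    rw [act_mul] at e4
    rw [mul_assoc] at e1
    have : ((n (a * b) c x₀ + n a b (act c x₀) : ℤ) : ℂ) * (2 * Real.pi * Complex.I)
        = ((n b c x₀ + n a (b * c) x₀ : ℤ) : ℂ) * (2 * Real.pi * Complex.I) := by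
      push_cast
      linear_combination -e1 - e2 + e3 + e4
    exact_mod_cast mul_right_cancel₀ hne this
  · rintro ⟨b, hb⟩
    have hb' : ∀ x y, n x y x₀ = b x + b y - b (x * y) := hb
    have e1 := hn 1 1 x₀
    have e2 := hn γ₀ γ₀ x₀
    rw [hb', hγ₀, hfix] at e2
    rw [hb', mul_one, act_one] at e1
    push_cast at e1 e2
    have h0 : φ γ₀ x₀ = b γ₀ * (2 * Real.pi * Complex.I) := by
      linear_combination (e2 + e1) / 2
    have h1 := hφ γ₀ x₀
    rw [Complex.exp_eq_one_iff.2 ⟨b γ₀, h0⟩, hj] at h1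
    norm_num at h1

/-! ### The Siegel upper half space -/

namespace Siegel

open scoped ComplexOrder

variable {n : Type*} [Fintype n] [DecidableEq n]

/-- The Hermitian form `-i Pᴴ J P` attached to a `2n × n` matrix. -/
noncomputable def herm (P : Matrix (n ⊕ n) n ℂ) : Matrix n n ℂ :=
  (-Complex.I) • (Pᴴ * J n ℂ * P)

theorem herm_fromRows (X Y : Matrix n n ℂ) :
    herm (fromRows X Y) = (-Complex.I) • (Yᴴ * X - Xᴴ * Y) := by
  rw [herm, J, conjTranspose_fromRows_eq_fromCols_conjTranspose, fromCols_mul_fromBlocks,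
    fromCols_mul_fromRows]
  congr 1
  simp [sub_eq_add_neg]

theorem herm_mul_right (P : Matrix (n ⊕ n) n ℂ) (M : Matrix n n ℂ) :
    herm (P * M) = star M * herm P * M := by
  simp [herm, conjTranspose_mul, Matrix.mul_assoc, star_eq_conjTranspose]

/-- The complexification of an integral symplectic matrix. -/
def toComplex (γ : symplecticGroup n ℤ) : Matrix (n ⊕ n) (n ⊕ n) ℂ := γ.1.map (Int.castRingHom ℂ)

theorem toComplex_mul (γ γ' : symplecticGroup n ℤ) :
    toComplex (γ * γ') = toComplex γ * toComplex γ' :=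
  Matrix.map_mul

theorem herm_mul_left (γ : symplecticGroup n ℤ) (P : Matrix (n ⊕ n) n ℂ) :
    herm (toComplex γ * P) = herm P := by
  have h := SymplecticGroup.mem_iff'.1 γ.2
  have h2 : (toComplex γ)ᴴ * J n ℂ * toComplex γ = J n ℂ := by
    have h3 := congrArg (fun M => M.map (Int.castRingHom ℂ)) h
    simp only [Matrix.map_mul, map_J] at h3
    have h4 : (toComplex γ)ᴴ = γ.1ᵀ.map (Int.castRingHom ℂ) := by
      ext i j
      simp [toComplex, conjTranspose_apply]
    rw [h4]
    exact h3
  rw [herm, herm, conjTranspose_mul]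
  congr 1
  calc _ = Pᴴ * ((toComplex γ)ᴴ * J n ℂ * toComplex γ) * P := by
        simp only [Matrix.mul_assoc]
    _ = _ := by rw [h2]

theorem isUnit_toRows₂ {P : Matrix (n ⊕ n) n ℂ} (hP : (herm P).PosDef) : IsUnit P.toRows₂ := by
  rw [Matrix.isUnit_iff_isUnit_det, isUnit_iff_ne_zero]
  intro h
  obtain ⟨v, hv, hv0⟩ := Matrix.exists_mulVec_eq_zero_iff.2 h
  have h1 := hP.dotProduct_mulVec_pos hv
  rw [← fromRows_toRows P, herm_fromRows, smul_mulVec, sub_mulVec, ← mulVec_mulVec,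
    ← mulVec_mulVec, hv0, mulVec_zero, sub_zero, dotProduct_smul, dotProduct_mulVec,
    ← star_mulVec, hv0] at h1
  simp at h1

variable (n) in
/-- Matrices with positive definite imaginary part. -/
abbrev Space := {τ : Matrix n n ℂ // (herm (fromRows τ 1)).PosDef}

/-- The `2n × n` matrix obtained by applying a symplectic matrix to the columns of `(τ, 1)`. -/
noncomputable def pair (γ : symplecticGroup n ℤ) (τ : Matrix n n ℂ) : Matrix (n ⊕ n) n ℂ :=
  toComplex γ * fromRows τ (1 : Matrix n n ℂ)

theorem isUnit_den (γ : symplecticGroup n ℤ) (τ : Space n) : IsUnit (pair γ τ.1).toRows₂ :=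
  isUnit_toRows₂ (by rw [pair, herm_mul_left]; exact τ.2)

theorem pair_eq {P : Matrix (n ⊕ n) n ℂ} (h : IsUnit P.toRows₂) :
    fromRows (P.toRows₁ * P.toRows₂⁻¹) 1 * P.toRows₂ = P := by
  rw [fromRows_mul, Matrix.one_mul, Matrix.mul_assoc,
    Matrix.nonsing_inv_mul _ ((Matrix.isUnit_iff_isUnit_det _).1 h), Matrix.mul_one, fromRows_toRows]

/-- The action by fractional linear transformations. -/
noncomputable def act (γ : symplecticGroup n ℤ) (τ : Space n) : Space n :=
  ⟨(pair γ τ.1).toRows₁ * (pair γ τ.1).toRows₂⁻¹, by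
    have h := isUnit_den γ τ
    rw [← Matrix.IsUnit.posDef_star_left_conjugate_iff h, ← herm_mul_right, pair_eq h, pair,
      herm_mul_left]
    exact τ.2⟩

theorem fromRows_act (γ : symplecticGroup n ℤ) (τ : Space n) :
    fromRows (act γ τ).1 1 * (pair γ τ.1).toRows₂ = pair γ τ.1 :=
  pair_eq (isUnit_den γ τ)

theorem act_eq {γ : symplecticGroup n ℤ} {τ : Space n} {σ M : Matrix n n ℂ} (hM : IsUnit M)
    (h : pair γ τ.1 = fromRows σ 1 * M) : (act γ τ).1 = σ ∧ (pair γ τ.1).toRows₂ = M := by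
  rw [fromRows_mul, Matrix.one_mul] at h
  have h2 : (pair γ τ.1).toRows₂ = M := by rw [h, toRows₂_fromRows]
  refine ⟨?_, h2⟩
  have h1 : (pair γ τ.1).toRows₁ = σ * M := by rw [h, toRows₁_fromRows]
  change (pair γ τ.1).toRows₁ * (pair γ τ.1).toRows₂⁻¹ = σ
  rw [h2, h1, Matrix.mul_assoc,
    Matrix.mul_nonsing_inv _ ((Matrix.isUnit_iff_isUnit_det _).1 hM), Matrix.mul_one]

theorem pair_mul (γ γ' : symplecticGroup n ℤ) (τ : Space n) :
    pair (γ * γ') τ.1 = fromRows (act γ (act γ' τ)).1 1 *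
      ((pair γ (act γ' τ).1).toRows₂ * (pair γ' τ.1).toRows₂) := by
  rw [← Matrix.mul_assoc, fromRows_act γ, pair, pair, Matrix.mul_assoc, fromRows_act,
    pair, ← Matrix.mul_assoc, toComplex_mul]

theorem act_mul (γ γ' : symplecticGroup n ℤ) (τ : Space n) :
    act (γ * γ') τ = act γ (act γ' τ) :=
  Subtype.ext (act_eq ((isUnit_den _ _).mul (isUnit_den _ _)) (pair_mul γ γ' τ)).1

theorem den_mul (γ γ' : symplecticGroup n ℤ) (τ : Space n) :
    (pair (γ * γ') τ.1).toRows₂ = (pair γ (act γ' τ).1).toRows₂ * (pair γ' τ.1).toRows₂ :=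
  (act_eq ((isUnit_den _ _).mul (isUnit_den _ _)) (pair_mul γ γ' τ)).2

theorem act_one (τ : Space n) : act 1 τ = τ :=
  Subtype.ext (act_eq (M := 1) isUnit_one (by simp [pair, toComplex])).1

theorem continuous_pair (γ : symplecticGroup n ℤ) :
    Continuous fun τ : Space n => pair γ τ.1 := by
  have h : Continuous fun τ : Space n => fromRows τ.1 (1 : Matrix n n ℂ) := by
    refine continuous_matrix fun i k => ?_
    rcases i with i | i
    · exact continuous_subtype_val.matrix_elem i k
    · exact continuous_const
  exact continuous_const.matrix_mul h

theorem continuous_toRows₁ : Continuous (toRows₁ : Matrix (n ⊕ n) n ℂ → Matrix n n ℂ) :=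
  continuous_matrix fun i k => continuous_id.matrix_elem (Sum.inl i) k

theorem continuous_toRows₂ : Continuous (toRows₂ : Matrix (n ⊕ n) n ℂ → Matrix n n ℂ) :=
  continuous_matrix fun i k => continuous_id.matrix_elem (Sum.inr i) k

theorem continuous_den (γ : symplecticGroup n ℤ) :
    Continuous fun τ : Space n => (pair γ τ.1).toRows₂ :=
  continuous_toRows₂.comp (continuous_pair γ)

theorem det_den_ne_zero (γ : symplecticGroup n ℤ) (τ : Space n) :
    (pair γ τ.1).toRows₂.det ≠ 0 :=
  isUnit_iff_ne_zero.1 ((Matrix.isUnit_iff_isUnit_det _).1 (isUnit_den γ τ))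

theorem continuous_act (γ : symplecticGroup n ℤ) : Continuous (act γ : Space n → Space n) := by
  refine Continuous.subtype_mk ?_ _
  refine (continuous_toRows₁.comp (continuous_pair γ)).matrix_mul ?_
  simp_rw [Matrix.inv_def, Ring.inverse_eq_inv']
  exact ((continuous_den γ).matrix_det.inv₀ (det_den_ne_zero γ)).smul
    (continuous_den γ).matrix_adjugate

theorem herm_combination (s t : ℝ) (σ τ : Matrix n n ℂ) :
    herm (fromRows ((s : ℂ) • σ + (t : ℂ) • τ) 1) =
      s • herm (fromRows σ 1) + t • herm (fromRows τ 1) := by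
  simp only [herm_fromRows, conjTranspose_add, conjTranspose_smul, conjTranspose_one,
    Matrix.one_mul, Matrix.mul_one]
  ext i k
  simp
  ring

/-- The base point `i`. -/
noncomputable def base : Space n :=
  ⟨Complex.I • 1, by
    rw [herm_fromRows]
    have : (-Complex.I) • ((1 : Matrix n n ℂ)ᴴ * Complex.I • 1 - (Complex.I • 1)ᴴ * 1)
        = (2 : ℝ) • (1 : Matrix n n ℂ) := by
      ext i k
      simp [Matrix.one_apply]
      split_ifs
      · ring_nf
        simp
      · simp
    rw [this]
    exact PosDef.one.smul two_pos⟩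

theorem posDef_combination {σ τ : Matrix n n ℂ} (hσ : (herm (fromRows σ 1)).PosDef)
    (hτ : (herm (fromRows τ 1)).PosDef) (t : unitInterval) :
    (herm (fromRows (((1 - t : ℝ) : ℂ) • σ + ((t : ℝ) : ℂ) • τ) 1)).PosDef := by
  rw [herm_combination]
  rcases eq_or_lt_of_le t.2.1 with h | h
  · rw [← h]
    simpa using hσ
  · exact PosDef.posSemidef_add (hσ.posSemidef.smul (sub_nonneg.2 t.2.2)) (hτ.smul h)

open unitInterval in
/-- The straight line contraction to the base point. -/
noncomputable def contraction : C(I × Space n, Space n) where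
  toFun p := ⟨((1 - p.1 : ℝ) : ℂ) • base.1 + ((p.1 : ℝ) : ℂ) • p.2.1,
    posDef_combination base.2 p.2.2 p.1⟩
  continuous_toFun := by
    refine Continuous.subtype_mk ?_ _
    have h : Continuous fun p : I × Space n => p.2.1 := continuous_subtype_val.comp continuous_snd
    fun_prop

/-- The vector with entry `-1` at `a` and `1` elsewhere. -/
def sign (R : Type*) [CommRing R] (a : n) : n → R := Function.update (fun _ => 1) a (-1)

theorem sign_mul_self (R : Type*) [CommRing R] (a i : n) : sign R a i * sign R a i = 1 := by
  by_cases hi : i = a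
  · subst hi; simp [sign]
  · simp [sign, hi]

/-- The diagonal symplectic matrix with entries `-1` on the hyperbolic plane of index `a`. -/
def reflection (a : n) : symplecticGroup n ℤ :=
  ⟨fromBlocks (diagonal (sign ℤ a)) 0 0 (diagonal (sign ℤ a)), by
    simp [-fromBlocks_diagonal, SymplecticGroup.mem_iff, J, fromBlocks_transpose, fromBlocks_multiply, sign_mul_self,
      ← diagonal_one, -diagonal_neg]⟩

theorem reflection_mul_self (a : n) : reflection a * reflection a = 1 := by
  refine Subtype.ext ?_
  simp [-fromBlocks_diagonal, reflection, fromBlocks_multiply, sign_mul_self]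

theorem pair_reflection (a : n) : pair (reflection a) (base (n := n)).1 =
    fromRows (base (n := n)).1 1 * diagonal (sign ℂ a) := by
  have h : (diagonal (sign ℤ a)).map (Int.castRingHom ℂ) = diagonal (sign ℂ a) := by
    rw [Matrix.diagonal_map (map_zero _)]
    congr 1
    ext i
    by_cases hi : i = a
    · subst hi; simp [sign]
    · simp [sign, hi]
  have h0 : (0 : Matrix n n ℤ).map (Int.castRingHom ℂ) = 0 := by ext; simp
  rw [pair, toComplex, reflection, fromBlocks_map, h, h0, fromBlocks_mul_fromRows, fromRows_mul]
  simp [base]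

theorem exists_cocyc (a : n) : ∃ F : cocyc (symplecticGroup n ℤ) ℤ,
    ¬ ∃ b : symplecticGroup n ℤ → ℤ, ∀ x y, F.1 x y = b x + b y - b (x * y) := by
  have hdet : (diagonal (sign ℂ a)).det = -1 := by
    rw [det_diagonal, sign, Finset.prod_update_of_mem (Finset.mem_univ a)]
    simp
  have hr := act_eq (γ := reflection a) (τ := base)
    (by rw [Matrix.isUnit_iff_isUnit_det, hdet]; exact isUnit_one.neg) (pair_reflection a)
  refine exists_cocyc_not_coboundary (x₀ := base) contraction
    (fun x => Subtype.ext ?_) (fun x => Subtype.ext ?_) act continuous_act act_mul act_one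
    (fun γ τ => (pair γ τ.1).toRows₂.det) (fun γ => (continuous_den γ).matrix_det) det_den_ne_zero
    (fun γ γ' τ => by rw [den_mul, det_mul]) (reflection a) (reflection_mul_self a)
    (Subtype.ext hr.1) (by rw [hr.2, hdet])
  · change ((1 - (0 : ℝ) : ℝ) : ℂ) • base.1 + ((0 : ℝ) : ℂ) • x.1 = base.1
    simp
  · change ((1 - (1 : ℝ) : ℝ) : ℂ) • base.1 + ((1 : ℝ) : ℂ) • x.1 = x.1
    simp

end Siegel

/-! ### Symplectic matrices as isometries -/

namespace Symp

variable {ι : Type*} [Fintype ι] [DecidableEq ι]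

theorem neg_dotProduct_J_mulVec (x y : ι ⊕ ι → ℤ) : -(x ⬝ᵥ (J ι ℤ *ᵥ y)) =
    ∑ i, (x (Sum.inl i) * y (Sum.inr i) - x (Sum.inr i) * y (Sum.inl i)) := by
  rw [J, fromBlocks_mulVec, dotProduct, Fintype.sum_sum_type, ← Finset.sum_add_distrib,
    ← Finset.sum_neg_distrib]
  refine Finset.sum_congr rfl fun i _ => ?_
  simp [neg_mulVec]
  ring

theorem ω_eq_dotProduct (x y : Vec ι) :
    ω x y = -dotProduct (m := ι ⊕ ι) x (mulVec (m := ι ⊕ ι) (n := ι ⊕ ι) (J ι ℤ) y) :=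
  (neg_dotProduct_J_mulVec _ _).symm

/-- Multiplication of column vectors by a matrix. -/
def mulVecMap (M : Matrix (ι ⊕ ι) (ι ⊕ ι) ℤ) : Vec ι →ₗ[ℤ] Vec ι :=
  AddMonoidHom.toIntLinearMap
    { toFun := fun x => mulVec (m := ι ⊕ ι) (n := ι ⊕ ι) M x
      map_zero' := mulVec_zero M
      map_add' := mulVec_add M }

theorem dotProduct_mulVec_mulVec (M N : Matrix (ι ⊕ ι) (ι ⊕ ι) ℤ) (x y : ι ⊕ ι → ℤ) :
    (M *ᵥ x) ⬝ᵥ (N *ᵥ (M *ᵥ y)) = x ⬝ᵥ ((Mᵀ * N * M) *ᵥ y) := by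
  rw [← mulVec_mulVec, ← mulVec_mulVec, dotProduct_mulVec x, vecMul_transpose]

/-- A symplectic matrix as an isometry of the symplectic lattice. -/
def ofMatrix : symplecticGroup ι ℤ →* Sp ι :=
  homMk (fun M => mulVecMap M.1) (fun x => one_mulVec x)
    (fun M N x => (mulVec_mulVec (x : ι ⊕ ι → ℤ) M.1 N.1).symm) (fun M x y => by
      rw [ω_eq_dotProduct, ω_eq_dotProduct]
      refine congrArg Neg.neg ((dotProduct_mulVec_mulVec M.1 (J ι ℤ) x y).trans ?_)
      rw [SymplecticGroup.mem_iff'.1 M.2])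

theorem ofMatrix_injective : Function.Injective (ofMatrix (ι := ι)) := by
  intro M N h
  refine Subtype.ext (Matrix.ext_of_mulVec_single fun i => ?_)
  exact congrArg (fun k : Sp ι => k.1 (Pi.single i 1 : ι ⊕ ι → ℤ)) h

theorem ofMatrix_surjective : Function.Surjective (ofMatrix (ι := ι)) := by
  intro k
  let L : (ι ⊕ ι → ℤ) →ₗ[ℤ] (ι ⊕ ι → ℤ) :=
    { toFun := fun x => k.1 x
      map_add' := fun x y => map_add k.1 (x : Vec ι) (y : Vec ι)
      map_smul' := fun c x => by
        have h1 : (c • x : ι ⊕ ι → ℤ) = (c • (show Vec ι from x) : Vec ι) := by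
          funext s
          exact (Vec.smul_apply c (show Vec ι from x) s).symm
        rw [h1, map_zsmul]
        funext s
        exact Vec.smul_apply c (k.1 (show Vec ι from x)) s }
  have hL : ∀ x : ι ⊕ ι → ℤ, L.toMatrix' *ᵥ x = k.1 (show Vec ι from x) := fun x =>
    LinearMap.toMatrix'_mulVec L x
  have hM : L.toMatrix' ∈ symplecticGroup ι ℤ := by
    rw [SymplecticGroup.mem_iff']
    refine Matrix.ext_of_mulVec_single fun i => dotProduct_eq _ _ fun w => ?_
    rw [dotProduct_comm, ← dotProduct_mulVec_mulVec, hL, hL, dotProduct_comm (J ι ℤ *ᵥ _)]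
    have := k.2 (show Vec ι from w) (show Vec ι from (Pi.single i 1 : ι ⊕ ι → ℤ))
    exact neg_injective ((ω_eq_dotProduct _ _).symm.trans (this.trans (ω_eq_dotProduct _ _)))
  exact ⟨⟨_, hM⟩, ext fun x => hL x⟩

/-- The isomorphism between symplectic matrices and isometries. -/
noncomputable def matrixEquiv : symplecticGroup ι ℤ ≃* Sp ι :=
  MulEquiv.ofBijective ofMatrix ⟨ofMatrix_injective, ofMatrix_surjective⟩

end Symp

/-! ### Computation of the second cohomology -/

theorem nonempty_addEquiv_int_of_ker {Z H : Type*} [AddCommGroup Z] [AddCommGroup H] (p : Z →+ H)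
    (hp : Function.Surjective p) (c : Z →+ ℤ) (hc : c ≠ 0) (h : ∀ z, p z = 0 ↔ c z = 0) :
    Nonempty (H ≃+ ℤ) := by
  have hker : p.ker = c.ker := AddSubgroup.ext h
  obtain ⟨m, hm⟩ := Int.subgroup_cyclic c.range
  have hm0 : m ≠ 0 := by
    rintro rfl
    refine hc (AddMonoidHom.ext fun z => ?_)
    have : c z ∈ c.range := ⟨z, rfl⟩
    rw [hm] at this
    simpa [AddSubgroup.mem_closure_singleton, eq_comm] using this
  rw [← AddSubgroup.zmultiples_eq_closure] at hm
  have hinj : Function.Injective (zmultiplesHom ℤ m) := fun a b hab => by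
    simpa [hm0] using hab
  exact ⟨(QuotientAddGroup.quotientKerEquivOfSurjective p hp).symm.trans
    ((QuotientAddGroup.quotientAddEquivOfEq hker).trans
    ((QuotientAddGroup.quotientKerEquivRange c).trans
    ((AddEquiv.addSubgroupCongr (hm.trans (AddSubgroup.range_zmultiplesHom m).symm)).trans
      (AddMonoidHom.ofInjective hinj).symm)))⟩

theorem nonempty_groupCohomology_two_addEquiv_int {Γ : Type} [Group Γ] (c : cocyc Γ ℤ →+ ℤ)
    (hc : ∀ F, c F = 0 ↔ ∃ b : Γ → ℤ, ∀ x y, F.1 x y = b x + b y - b (x * y))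
    (hF : ∃ F : cocyc Γ ℤ, ¬ ∃ b : Γ → ℤ, ∀ x y, F.1 x y = b x + b y - b (x * y)) :
    Nonempty (groupCohomology (Rep.trivial ℤ Γ ℤ) 2 ≃+ ℤ) := by
  let u : groupCohomology.cocycles₂ (Rep.trivial ℤ Γ ℤ) →+ cocyc Γ ℤ :=
    { toFun := fun f => ⟨fun x y => f.1 (x, y), fun x y z =>
        (groupCohomology.mem_cocycles₂_iff f.1).1 f.2 x y z⟩
      map_zero' := rfl
      map_add' := fun _ _ => rfl }
  refine nonempty_addEquiv_int_of_ker
    (groupCohomology.H2π (Rep.trivial ℤ Γ ℤ)).hom.toAddMonoidHom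
    (fun x => groupCohomology.H2_induction_on x fun y => ⟨y, rfl⟩) (c.comp u) ?_ ?_
  · intro h
    obtain ⟨F, hF⟩ := hF
    refine hF ((hc F).1 (DFunLike.congr_fun h ⟨fun p => F.1 p.1 p.2, ?_⟩))
    exact (groupCohomology.mem_cocycles₂_iff _).2 fun x y z => F.2 x y z
  · intro z
    refine (groupCohomology.H2π_eq_zero_iff z).trans (Iff.trans ?_ (hc (u z)).symm)
    constructor
    · rintro ⟨b, hb⟩
      refine ⟨b, fun x y => ?_⟩
      refine (congrFun hb (x, y)).symm.trans ?_
      change b y - b (x * y) + b x = b x + b y - b (x * y)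
      ring
    · rintro ⟨b, hb⟩
      refine ⟨b, funext fun p => ?_⟩
      refine Eq.trans ?_ (hb p.1 p.2).symm
      change b p.2 - b (p.1 * p.2) + b p.1 = b p.1 + b p.2 - b (p.1 * p.2)
      ring

/-- For every `g ≥ 3`, the second group cohomology of the Siegel modular
group `Γ_g = Sp_{2g}(ℤ)` with trivial integer coefficients is infinite cyclic:
`H²(Sp_{2g}(ℤ), ℤ) ≅ ℤ`. -/
theorem h2_siegelModularGroup_int (g : ℕ) (hg : 3 ≤ g) :
    Nonempty ((groupCohomology (Rep.trivial ℤ ↥(Matrix.symplecticGroup (Fin g) ℤ) ℤ) 2) ≃+ ℤ) := by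
  obtain ⟨c, hc⟩ := Symp.exists_invariant (ι := Fin g) (by simpa using hg) Symp.matrixEquiv
  exact nonempty_groupCohomology_two_addEquiv_int c hc (Siegel.exists_cocyc ⟨0, by lia⟩)
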